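/- Every (P_5, kite)-free graph G with clique number at most 6 satisfies χ(G) ≤ 9. -/

import Mathlib

open SimpleGraph

/-- The kite: a path 0-1-2-3 plus a vertex 4 adjacent to 0, 1, 2. -/
def kite : SimpleGraph (Fin 5) :=
  SimpleGraph.fromEdgeSet {s(0, 1), s(1, 2), s(2, 3), s(4, 0), s(4, 1), s(4, 2)}

namespace Kite

/-- The vertices of `S` can be properly coloured with `k` colours. -/
def Col {V : Type*} (G : SimpleGraph V) (S : Set V) (k : ℕ) : Prop :=
  ∃ c : V → ℕ, (∀ x ∈ S, c x < k) ∧ ∀ x ∈ S, ∀ y ∈ S, G.Adj x y → c x ≠ c y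

/-- The bound on the chromatic number in terms of the clique number. -/
def bound : ℕ → ℕ
  | 0 => 0
  | 1 => 1
  | 2 => 3
  | 3 => 4
  | 4 => 6
  | 5 => 8
  | _ => 9

/-- Every clique inside `S` has at most `m` vertices. -/
def OmegaLE {V : Type*} (G : SimpleGraph V) (S : Set V) (m : ℕ) : Prop :=
  ∀ s : Finset V, (s : Set V) ⊆ S → G.IsClique (s : Set V) → s.card ≤ m

section Coloring

variable {V : Type*} {G : SimpleGraph V}

theorem Col.mono {S T : Set V} {k l : ℕ} (h : Col G T l) (hST : S ⊆ T) (hkl : l ≤ k) :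
    Col G S k := by
  obtain ⟨c, h1, h2⟩ := h
  exact ⟨c, fun x hx => (h1 x (hST hx)).trans_le hkl, fun x hx y hy => h2 x (hST hx) y (hST hy)⟩

theorem Col.union {S T : Set V} {k l : ℕ} (hS : Col G S k) (hT : Col G T l) :
    Col G (S ∪ T) (k + l) := by
  classical
  obtain ⟨c, h1, h2⟩ := hS
  obtain ⟨d, h3, h4⟩ := hT
  refine ⟨fun x => if x ∈ S then c x else k + d x, ?_, ?_⟩
  · intro x hx
    by_cases hxS : x ∈ S
    · simp only [hxS, if_true]; have := h1 x hxS; omega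
    · have hxT : x ∈ T := hx.resolve_left hxS
      simp only [hxS, if_false]; have := h3 x hxT; omega
  · intro x hx y hy hxy
    by_cases hxS : x ∈ S <;> by_cases hyS : y ∈ S <;> simp only [hxS, hyS, if_true, if_false]
    · exact h2 x hxS y hyS hxy
    · have := h1 x hxS; omega
    · have := h1 y hyS; omega
    · have := h4 x (hx.resolve_left hxS) y (hy.resolve_left hyS) hxy; omega

theorem col_one {S : Set V} (h : ∀ x ∈ S, ∀ y ∈ S, ¬ G.Adj x y) : Col G S 1 :=
  ⟨fun _ => 0, fun _ _ => Nat.one_pos, fun x hx y hy hxy => absurd hxy (h x hx y hy)⟩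

theorem col_empty : Col G ∅ 0 :=
  ⟨fun _ => 0, fun _ hx => hx.elim, fun _ hx => hx.elim⟩

theorem col_biUnion {ι : Type*} (s : Finset ι) (B : ι → Set V)
    (h : ∀ i ∈ s, ∀ x ∈ B i, ∀ y ∈ B i, ¬ G.Adj x y) : Col G (⋃ i ∈ s, B i) s.card := by
  classical
  induction s using Finset.induction_on with
  | empty => simpa using col_empty
  | insert a s ha ih =>
    rw [Finset.card_insert_of_notMem ha, Finset.set_biUnion_insert, add_comm]
    exact (col_one (h a (Finset.mem_insert_self a s))).union
      (ih fun i hi => h i (Finset.mem_insert_of_mem hi))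

theorem OmegaLE.mono {S T : Set V} {k l : ℕ} (h : OmegaLE G T l) (hST : S ⊆ T) (hkl : l ≤ k) :
    OmegaLE G S k := fun s hs hc => (h s (hs.trans hST) hc).trans hkl

theorem exists_omega [Finite V] (S : Set V) :
    ∃ m, OmegaLE G S m ∧ ∃ s : Finset V, (s : Set V) ⊆ S ∧ G.IsClique (s : Set V) ∧
      s.card = m := by
  classical
  have := Fintype.ofFinite V
  let F : Finset (Finset V) := (Finset.univ : Finset (Finset V)).filter
    fun s => (s : Set V) ⊆ S ∧ G.IsClique (s : Set V)
  have hF : F.Nonempty := ⟨∅, by simp [F]⟩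
  obtain ⟨s, hs, hmax⟩ := Finset.exists_max_image F (fun s => s.card) hF
  have hs' := (Finset.mem_filter.1 hs).2
  exact ⟨s.card, fun t ht hc => hmax t (Finset.mem_filter.2 ⟨Finset.mem_univ _, ht, hc⟩),
    s, hs'.1, hs'.2, rfl⟩

theorem isClique_union {s t : Set V} (hs : G.IsClique s) (ht : G.IsClique t)
    (h : ∀ x ∈ s, ∀ y ∈ t, G.Adj x y) : G.IsClique (s ∪ t) := by
  rintro x (hx | hx) y (hy | hy) hne
  · exact hs hx hy hne
  · exact h x hx y hy
  · exact (h y hy x hx).symm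
  · exact ht hx hy hne

/-- Two colourings that agree up to a permutation on a clique can be glued. -/
theorem Col.glue {A B C : Set V} {k : ℕ} (hA : Col G (A ∪ C) k) (hB : Col G (B ∪ C) k)
    (hC : G.IsClique C) (hAB : ∀ x ∈ A, ∀ y ∈ B, ¬ G.Adj x y)  :
    Col G (A ∪ B ∪ C) k := by
  classical
  obtain ⟨c, h1, h2⟩ := hA
  obtain ⟨d, h3, h4⟩ := hB
  let p : Fin k → Prop := fun i => ∃ x ∈ C, d x = i
  let q : Fin k → Prop := fun i => ∃ x ∈ C, c x = i
  have hcinj : ∀ x ∈ C, ∀ y ∈ C, c x = c y → x = y := fun x hx y hy h => by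
    by_contra hne
    exact h2 x (Or.inr hx) y (Or.inr hy) (hC hx hy hne) h
  have hdinj : ∀ x ∈ C, ∀ y ∈ C, d x = d y → x = y := fun x hx y hy h => by
    by_contra hne
    exact h4 x (Or.inr hx) y (Or.inr hy) (hC hx hy hne) h
  let e1 : C ≃ {i // p i} := Equiv.ofBijective
    (fun x => ⟨⟨d x, h3 x (Or.inr x.2)⟩, x, x.2, rfl⟩)
    ⟨fun x y h => Subtype.ext (hdinj x x.2 y y.2 (by simpa using h)),
      fun ⟨i, x, hx, hi⟩ => ⟨⟨x, hx⟩, by ext; exact hi⟩⟩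
  let e2 : C ≃ {i // q i} := Equiv.ofBijective
    (fun x => ⟨⟨c x, h1 x (Or.inr x.2)⟩, x, x.2, rfl⟩)
    ⟨fun x y h => Subtype.ext (hcinj x x.2 y y.2 (by simpa using h)),
      fun ⟨i, x, hx, hi⟩ => ⟨⟨x, hx⟩, by ext; exact hi⟩⟩
  let σ : Equiv.Perm (Fin k) := (e1.symm.trans e2).extendSubtype
  have hσ : ∀ x (hx : x ∈ C), ((σ ⟨d x, h3 x (Or.inr hx)⟩ : Fin k) : ℕ) = c x := by
    intro x hx
    have : σ ⟨d x, h3 x (Or.inr hx)⟩ = (e2 (e1.symm ⟨⟨d x, h3 x (Or.inr hx)⟩, x, hx, rfl⟩)) :=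
      Equiv.extendSubtype_apply_of_mem _ _ ⟨x, hx, rfl⟩
    have h5 : e1.symm ⟨⟨d x, h3 x (Or.inr hx)⟩, x, hx, rfl⟩ = ⟨x, hx⟩ := by
      rw [Equiv.symm_apply_eq]; rfl
    rw [this, h5]; rfl
  let g : V → ℕ := fun x => if hx : x ∈ B ∪ C then σ ⟨d x, h3 x hx⟩ else c x
  have hg1 : ∀ x ∈ A ∪ C, (x ∉ B ∨ x ∈ C) → g x = c x := by
    rintro x hx hxB
    by_cases hxC : x ∈ C
    · simp only [g, dif_pos (show x ∈ B ∪ C from Or.inr hxC)]; exact hσ x hxC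
    · have : x ∉ B ∪ C := by rintro (h | h); exacts [hxB.elim (· h) hxC, hxC h]
      simp only [g, dif_neg this]
  have hg2 : ∀ x (hx : x ∈ B ∪ C), g x = σ ⟨d x, h3 x hx⟩ := fun x hx => by
    simp only [g, dif_pos hx]
  have hBB : ∀ x ∈ B ∪ C, ∀ y ∈ B ∪ C, G.Adj x y → g x ≠ g y := by
    intro x hx y hy hxy h
    rw [hg2 x hx, hg2 y hy] at h
    have := σ.injective (Fin.ext h)
    exact h4 x hx y hy hxy (Fin.mk.inj_iff.1 this)
  have key : ∀ x ∈ A ∪ B ∪ C, x ∉ B ∪ C → x ∈ A := by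
    rintro x ((h | h) | h) h'
    exacts [h, (h' (Or.inl h)).elim, (h' (Or.inr h)).elim]
  refine ⟨g, ?_, ?_⟩
  · intro x hx
    by_cases hxB : x ∈ B ∪ C
    · rw [hg2 x hxB]; exact Fin.is_lt _
    · have := key x hx hxB
      rw [hg1 x (Or.inl this) (Or.inl fun h => hxB (Or.inl h))]
      exact h1 x (Or.inl this)
  · have mix : ∀ x ∈ A ∪ B ∪ C, x ∉ B ∪ C → ∀ y ∈ A ∪ B ∪ C, G.Adj x y → g x ≠ g y := by
      intro x hx hxB y hy hxy
      have hxA := key x hx hxB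
      have hyB : y ∉ B := fun h => hAB x hxA y h hxy
      have hyA : y ∈ A ∪ C := by
        rcases hy with (h | h) | h
        exacts [Or.inl h, (hyB h).elim, Or.inr h]
      rw [hg1 x (Or.inl hxA) (Or.inl fun h => hxB (Or.inl h)), hg1 y hyA (Or.inl hyB)]
      exact h2 x (Or.inl hxA) y hyA hxy
    intro x hx y hy hxy
    by_cases hxB : x ∈ B ∪ C
    · by_cases hyB : y ∈ B ∪ C
      · exact hBB x hxB y hyB hxy
      · exact (mix y hy hyB x hx hxy.symm).symm
    · exact mix x hx hxB y hy hxy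

end Coloring

section Components

variable {V : Type*} (G : SimpleGraph V)

/-- The vertex set of the component of `a` in the subgraph induced on `S`. -/
def comp (S : Set V) (a : V) : Set V :=
  {b | Relation.ReflTransGen (fun x y => G.Adj x y ∧ x ∈ S ∧ y ∈ S) a b}

/-- A set of vertices that no outside vertex distinguishes. -/
def IsModule (M : Set V) : Prop :=
  ∀ y, y ∉ M → ∀ a ∈ M, ∀ b ∈ M, G.Adj y a → G.Adj y b

variable {G} {S : Set V} {a : V}

theorem mem_comp_self : a ∈ comp G S a := Relation.ReflTransGen.refl

theorem comp_subset (ha : a ∈ S) : comp G S a ⊆ S := by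
  intro b hb
  induction hb with
  | refl => exact ha
  | tail _ h _ => exact h.2.2

theorem mem_comp_of_adj (ha : a ∈ S) {x y : V} (hx : x ∈ comp G S a) (hy : y ∈ S)
    (h : G.Adj x y) : y ∈ comp G S a :=
  Relation.ReflTransGen.tail hx ⟨h, comp_subset ha hx, hy⟩

theorem exists_flip_of_base {x : V} (P : V → Prop) (hx : x ∈ comp G S a)
    (hPa : P a) (hPx : ¬ P x) :
    ∃ u ∈ comp G S a, ∃ v ∈ comp G S a, G.Adj u v ∧ P u ∧ ¬ P v := by
  induction hx with
  | refl => exact absurd hPa hPx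
  | @tail b c hb h ih =>
    by_cases hPb : P b
    · exact ⟨b, hb, c, hb.tail h, h.1, hPb, hPx⟩
    · exact ih hPb

/-- A predicate that is not constant on a component changes along one of its edges. -/
theorem exists_flip {x y : V} (P : V → Prop) (hx : x ∈ comp G S a) (hy : y ∈ comp G S a)
    (hPx : P x) (hPy : ¬ P y) :
    ∃ u ∈ comp G S a, ∃ v ∈ comp G S a, G.Adj u v ∧ P u ∧ ¬ P v := by
  by_cases hPa : P a
  · exact exists_flip_of_base P hy hPa hPy
  · obtain ⟨u, hu, v, hv, huv, h1, h2⟩ :=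
      exists_flip_of_base (fun z => ¬ P z) hx hPa (not_not.2 hPx)
    exact ⟨v, hv, u, hu, huv.symm, not_not.1 h2, h1⟩

end Components

theorem bound_add {i j n : ℕ} (hi : 1 ≤ i) (hj : 1 ≤ j) (hn : n ≤ 6) (h : i + j ≤ n) :
    bound i + bound j ≤ bound n := by
  have h1 : i ≤ 5 := by omega
  have h2 : j ≤ 5 := by omega
  interval_cases n <;> interval_cases i <;> interval_cases j <;> simp_all [bound]

/-- A minimal counterexample `G` to the bound, of clique number `n`. -/
structure Ctx {V : Type*} (G : SimpleGraph V) (n : ℕ) : Prop where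
  p5 : ∀ a b c d e, G.Adj a b → G.Adj b c → G.Adj c d → G.Adj d e → ¬ G.Adj a c →
    ¬ G.Adj a d → ¬ G.Adj a e → ¬ G.Adj b d → ¬ G.Adj b e → ¬ G.Adj c e → False
  kite : ∀ x y p r w, G.Adj x y → G.Adj p x → G.Adj p y → G.Adj r x → G.Adj r y →
    ¬ G.Adj p r → ¬ G.Adj w x → ¬ G.Adj w y → G.Adj w p → G.Adj w r
  ih : ∀ S : Set V, S ≠ Set.univ → ∀ m ≤ 6, OmegaLE G S m → Col G S (bound m)
  le6 : n ≤ 6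
  omega : OmegaLE G Set.univ n
  top : ∃ s : Finset V, G.IsClique (s : Set V) ∧ s.card = n
  hard : ¬ Col G Set.univ (bound n)

section Reductions

variable {V : Type*} {G : SimpleGraph V} {n : ℕ}

theorem OmegaLE.univ (h : OmegaLE G Set.univ n) (S : Set V) : OmegaLE G S n :=
  h.mono (Set.subset_univ S) le_rfl

theorem one_le_of_clique {S : Set V} {m : ℕ} (h : OmegaLE G S m) (hS : S.Nonempty) : 1 ≤ m := by
  obtain ⟨x, hx⟩ := hS
  simpa using h {x} (by simpa using hx) (by simp)

theorem Ctx.no_join [Finite V] (h : Ctx G n) (A : Set V) (hA : A.Nonempty) (hB : Aᶜ.Nonempty)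
    (hAB : ∀ x ∈ A, ∀ y ∉ A, G.Adj x y) : False := by
  classical
  obtain ⟨i, hi, s, hsA, hs, rfl⟩ := exists_omega (G := G) A
  obtain ⟨j, hj, t, htA, ht, rfl⟩ := exists_omega (G := G) Aᶜ
  have hdis : Disjoint s t := by
    rw [Finset.disjoint_left]; exact fun x hx hx' => htA hx' (hsA hx)
  have hn := h.omega (s ∪ t) (Set.subset_univ _) (by
    rw [Finset.coe_union]; exact isClique_union hs ht fun x hx y hy => hAB x (hsA hx) y (htA hy))
  rw [Finset.card_union_of_disjoint hdis] at hn
  have h6 := h.le6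
  obtain ⟨b, hb⟩ := hB
  obtain ⟨a, ha⟩ := hA
  have c1 := h.ih A (fun h => hb (h ▸ trivial)) _ (by omega) hi
  have c2 := h.ih Aᶜ (fun h => (h ▸ trivial : a ∈ Aᶜ) ha) _ (by omega) hj
  exact h.hard ((c1.union c2).mono (by simp)
    (bound_add (one_le_of_clique hi ⟨a, ha⟩) (one_le_of_clique hj ⟨b, hb⟩) h6 hn))

theorem Ctx.incomparable (h : Ctx G n) {u v : V} (hne : u ≠ v) (huv : ¬ G.Adj u v) :
    ∃ y, G.Adj u y ∧ ¬ G.Adj v y := by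
  classical
  by_contra! hcon
  obtain ⟨c, h1, h2⟩ := h.ih {u}ᶜ (fun h => (h ▸ trivial : u ∈ ({u}ᶜ : Set V)) rfl) n h.le6
    (h.omega.univ _)
  have key : ∀ y, G.Adj u y → c v ≠ c y := fun y hy =>
    h2 v (Ne.symm hne) y hy.ne' (hcon y hy)
  refine h.hard ⟨fun x => if x = u then c v else c x, ?_, ?_⟩
  · intro x _
    by_cases hx : x = u
    · simp only [hx, if_true]; exact h1 v (Ne.symm hne)
    · simp only [hx, if_false]; exact h1 x hx
  · intro x _ y _ hxy
    by_cases hx : x = u <;> by_cases hy : y = u <;> simp only [hx, hy, if_true, if_false]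
    · subst hx; subst hy; exact absurd rfl hxy.ne
    · exact key y (hx ▸ hxy)
    · exact (key x (hy ▸ hxy.symm)).symm
    · exact h2 x hx y hy hxy

theorem Ctx.no_clique_cutset (h : Ctx G n) (A C : Set V) (hC : G.IsClique C) {a b : V}
    (ha : a ∈ A) (haC : a ∉ C) (hbA : b ∉ A) (hbC : b ∉ C)
    (hA : ∀ x ∈ A, ∀ y, y ∉ A → y ∉ C → ¬ G.Adj x y) : False := by
  have c1 := h.ih (A ∪ C) (fun h => (h ▸ trivial : b ∈ A ∪ C).elim hbA hbC) n h.le6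
    (h.omega.univ _)
  have c2 := h.ih ((A ∪ C)ᶜ ∪ C) (fun h =>
    (h ▸ trivial : a ∈ (A ∪ C)ᶜ ∪ C).elim (fun h => h (Or.inl ha)) haC) n h.le6 (h.omega.univ _)
  refine h.hard ((c1.glue c2 hC fun x hx y hy => hA x hx y (fun h => hy (Or.inl h))
    fun h => hy (Or.inr h)).mono ?_ le_rfl)
  intro x _
  by_cases h : x ∈ A ∪ C
  · exact h.elim (fun h => Or.inl (Or.inl h)) Or.inr
  · exact Or.inl (Or.inr h)

/-- An edge inside a module forces the anticomponents of its neighbourhood to be modules. -/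
theorem Ctx.isModule_anticomp (h : Ctx G n) {D : Set V} (hD : IsModule G D) {d d' y : V}
    (hd : d ∈ D) (hd' : d' ∈ D) (hdd : G.Adj d d') (hy : y ∉ D) (hyd : G.Adj y d) :
    IsModule G (comp Gᶜ {z | z ∉ D ∧ G.Adj z d} y) := by
  set N : Set V := {z | z ∉ D ∧ G.Adj z d} with hN
  have hyN : y ∈ N := ⟨hy, hyd⟩
  have hsub := comp_subset (G := Gᶜ) hyN
  intro w hw a ha b hb hwa
  by_contra hwb
  by_cases hwN : w ∈ N
  · exact hw (mem_comp_of_adj hyN hb hwN ⟨fun h => hw (h ▸ hb), fun h => hwb h.symm⟩)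
  have hb' := hsub hb
  by_cases hwD : w ∈ D
  · exact hwb (hD b hb'.1 d hd w hwD hb'.2).symm
  have hwd : ¬ G.Adj w d := fun h => hwN ⟨hwD, h⟩
  obtain ⟨p, hp, r, hr, hpr, hwp, hwr⟩ := exists_flip (fun z => G.Adj w z) ha hb hwa hwb
  have hp' := hsub hp
  have hr' := hsub hr
  exact hwr (h.kite d d' p r w hdd hp'.2 (hD p hp'.1 d hd d' hd' hp'.2) hr'.2
    (hD r hr'.1 d hd d' hd' hr'.2) hpr.2 hwd (fun h => hwd (hD w hwD d' hd' d hd h)) hwp)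

theorem Ctx.module_edge (h : Ctx G n) {D : Set V} (hD : IsModule G D) (hnt : D.Nontrivial) :
    ∃ d ∈ D, ∃ d' ∈ D, G.Adj d d' := by
  by_contra! hcon
  obtain ⟨a, ha, b, hb, hab⟩ := hnt
  obtain ⟨y, h1, h2⟩ := h.incomparable hab (hcon a ha b hb)
  by_cases hy : y ∈ D
  · exact hcon a ha y hy h1
  · exact h2 (hD y hy a ha b hb h1.symm).symm

theorem Ctx.prime [Finite V] (h : Ctx G n) {M : Set V} (hM : IsModule G M) (hne : M ≠ Set.univ)
    (hnt : M.Nontrivial) : False := by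
  let F := {M : Set V // IsModule G M ∧ M ≠ Set.univ ∧ M.Nontrivial}
  have : Nonempty F := ⟨⟨M, hM, hne, hnt⟩⟩
  obtain ⟨⟨M, hM, hne, hnt⟩, hmax⟩ := Finite.exists_max (fun M : F => M.1.ncard)
  have hmax' : ∀ M', IsModule G M' → M' ≠ Set.univ → M ⊆ M' → M' ⊆ M := by
    intro M' h1 h2 h3 x hx
    by_contra hxM
    have := hmax ⟨M', h1, h2, hnt.mono h3⟩
    have h4 := Set.ncard_lt_ncard (Set.ssubset_iff_subset_ne.2 ⟨h3, fun h => hxM (h ▸ hx)⟩)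
    exact absurd this (not_le.2 h4)
  obtain ⟨d, hd, d', hd', hdd⟩ := h.module_edge hM hnt
  obtain ⟨o, ho⟩ := (Set.ne_univ_iff_exists_notMem M).1 hne
  have hTc : ∀ t, t ∉ M → G.Adj t d → ∀ m ∈ M, G.Adj t m := fun t ht htd m hm =>
    hM t ht d hd m hm htd
  have hZc : ∀ t, t ∉ M → ¬ G.Adj t d → ∀ m ∈ M, ¬ G.Adj t m := fun t ht htd m hm h =>
    htd (hM t ht m hm d hd h)
  by_cases hZ : ∀ z, z ∉ M → G.Adj z d
  · exact h.no_join M ⟨d, hd⟩ ⟨o, ho⟩ fun x hx y hy => (hTc y hy (hZ y hy) x hx).symm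
  push Not at hZ
  obtain ⟨z0, hz0, hz0d⟩ := hZ
  set C : Set V := {t | (t ∉ M ∧ G.Adj t d) ∧ ∃ z, z ∉ M ∧ ¬ G.Adj z d ∧ G.Adj t z} with hCdef
  have hCT : ∀ t ∈ C, ∀ t', t' ∉ M → G.Adj t' d → t ≠ t' → G.Adj t t' := by
    rintro t ⟨⟨htM, htd⟩, z, hzM, hzd, htz⟩ t' ht'M ht'd hne
    by_contra hadj
    set N : Set V := {y | y ∉ M ∧ G.Adj y d} with hN
    have htN : t ∈ N := ⟨htM, htd⟩
    set D := comp Gᶜ N t with hDdef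
    have hDm : IsModule G D := h.isModule_anticomp hM hd hd' hdd htM htd
    have hDN : D ⊆ N := comp_subset htN
    have htD : t ∈ D := mem_comp_self
    have ht'D : t' ∈ D := mem_comp_of_adj htN htD ⟨ht'M, ht'd⟩ ⟨hne, hadj⟩
    have hdD : d ∉ D := fun h => (hDN h).1 hd
    obtain ⟨e, he, e', he', hee⟩ := h.module_edge hDm ⟨t, htD, t', ht'D, hne⟩
    have hde : G.Adj d e := (hDN he).2.symm
    set E := comp Gᶜ {y | y ∉ D ∧ G.Adj y e} d with hEdef
    have hEm : IsModule G E := h.isModule_anticomp hDm he he' hee hdD hde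
    have hdN : d ∈ {y | y ∉ D ∧ G.Adj y e} := ⟨hdD, hde⟩
    have hES := comp_subset (G := Gᶜ) hdN
    have hzD : z ∉ D := fun h => hzd (hDN h).2
    have hze : G.Adj z e := hDm z hzD t htD e he htz.symm
    have hzE : z ∈ E := mem_comp_of_adj hdN mem_comp_self ⟨hzD, hze⟩
      ⟨fun h => hzM (h ▸ hd), fun h => hzd h.symm⟩
    refine hzM (hmax' E hEm ?_ ?_ hzE)
    · exact fun h => (hES (h ▸ trivial : t ∈ E)).1 htD
    · intro m hm
      refine mem_comp_of_adj hdN hzE ⟨fun h => (hDN h).1 hm, (hTc e (hDN he).1 (hDN he).2 m hm).symm⟩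
        ⟨fun h => hzM (h ▸ hm), hZc z hzM hzd m hm⟩
  refine h.no_clique_cutset (a := d) (b := z0) (M ∪ {t | (t ∉ M ∧ G.Adj t d) ∧ t ∉ C}) C ?_
    (Or.inl hd) (fun h => h.1.1 hd) ?_ (fun h => hz0d h.1.2) ?_
  · exact fun t ht t' ht' hne => hCT t ht t' ht'.1.1 ht'.1.2 hne
  · rintro (h | h)
    exacts [hz0 h, hz0d h.1.2]
  · rintro x (hx | ⟨hx, hxC⟩) y hyA hyC hxy
    · have hyM : y ∉ M := fun h => hyA (Or.inl h)
      by_cases hyd : G.Adj y d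
      · exact hyA (Or.inr ⟨⟨hyM, hyd⟩, hyC⟩)
      · exact hZc y hyM hyd x hx hxy.symm
    · have hyM : y ∉ M := fun h => hyA (Or.inl h)
      by_cases hyd : G.Adj y d
      · exact hyA (Or.inr ⟨⟨hyM, hyd⟩, hyC⟩)
      · exact hxC ⟨hx, y, hyM, hyd, hxy⟩

end Reductions

section Dominating

variable {V : Type*} {G : SimpleGraph V} {n : ℕ}

/-- A maximal clique on at least three vertices is dominating. -/
theorem Ctx.dominating [Finite V] (h : Ctx G n) {Q : Set V} (hQ : G.IsClique Q)
    (hmax : ∀ w, ∃ q ∈ Q, ¬ G.Adj w q) (h3 : ∀ a b, ∃ c ∈ Q, c ≠ a ∧ c ≠ b) (u : V)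
    (huQ : u ∉ Q) : ∃ q ∈ Q, G.Adj u q := by
  by_contra! hu
  set U : Set V := {u | u ∉ Q ∧ ∀ q ∈ Q, ¬ G.Adj u q} with hU
  have huU : u ∈ U := ⟨huQ, hu⟩
  have ha : ∀ w, ∀ q1 ∈ Q, ∀ q2 ∈ Q, q1 ≠ q2 → G.Adj w q1 → G.Adj w q2 → ∀ x ∈ U,
      ¬ G.Adj w x := by
    intro w q1 h1 q2 h2 hne hw1 hw2 x hx hwx
    obtain ⟨q3, h3, hw3⟩ := hmax w
    have h13 : q1 ≠ q3 := fun h => hw3 (h ▸ hw1)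
    have h23 : q2 ≠ q3 := fun h => hw3 (h ▸ hw2)
    exact hx.2 q3 h3 (h.kite q1 q2 w q3 x (hQ h1 h2 hne) hw1 hw2 (hQ h1 h3 h13).symm
      (hQ h2 h3 h23).symm hw3 (hx.2 q1 h1) (hx.2 q2 h2) hwx.symm)
  have huniq : ∀ t, ∀ x ∈ U, G.Adj t x → ∀ a ∈ Q, G.Adj t a → ∀ b ∈ Q, b ≠ a → ¬ G.Adj t b :=
    fun t x hx htx a haQ hta b hbQ hba htb => ha t a haQ b hbQ hba.symm hta htb x hx htx
  have hUQ : ∀ x ∈ U, ∀ q ∈ Q, ¬ G.Adj q x := fun x hx q hq hqx => hx.2 q hq hqx.symm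
  have hstab : ∀ x ∈ U, ¬ G.Adj u x := by
    intro x hx hux
    refine h.prime (M := comp G U u) ?_ ?_ ⟨u, mem_comp_self, x,
      mem_comp_of_adj huU mem_comp_self hx hux, hux.ne⟩
    · intro t ht y hy z hz hty
      by_contra htz
      obtain ⟨u1, hu1, u2, hu2, h12, h1, h2⟩ := exists_flip (fun z => G.Adj t z) hy hz hty htz
      have hu1U := comp_subset huU hu1
      have hu2U := comp_subset huU hu2
      have htU : t ∉ U := fun h => ht (mem_comp_of_adj huU hu1 h h1.symm)
      have htQ : t ∉ Q := fun h => hUQ u1 hu1U t h h1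
      have : ∃ q ∈ Q, G.Adj t q := by
        by_contra! hcon
        exact htU ⟨htQ, hcon⟩
      obtain ⟨q, hq, htq⟩ := this
      obtain ⟨q', hq', hne, -⟩ := h3 q q
      exact h.p5 u2 u1 t q q' h12.symm h1.symm htq (hQ hq hq' hne.symm) (fun h => h2 h.symm)
        (hu2U.2 q hq) (hu2U.2 q' hq') (hu1U.2 q hq) (hu1U.2 q' hq')
        (huniq t u1 hu1U h1 q hq htq q' hq' hne)
    · intro heq
      obtain ⟨q, hq, -⟩ := h3 u u
      exact (comp_subset huU (heq ▸ trivial : q ∈ comp G U u)).1 hq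
  have hT : ∀ t, G.Adj u t → ∃ a ∈ Q, G.Adj t a ∧ ∀ b ∈ Q, b ≠ a → ¬ G.Adj t b := by
    intro t hut
    have htQ : t ∉ Q := fun h => hu t h hut
    have htU : t ∉ U := fun h => hstab t h hut
    have : ∃ q ∈ Q, G.Adj t q := by
      by_contra! hcon
      exact htU ⟨htQ, hcon⟩
    obtain ⟨q, hq, htq⟩ := this
    exact ⟨q, hq, htq, huniq t u huU hut.symm q hq htq⟩
  have hnc : ∃ x, G.Adj u x ∧ ∃ y, G.Adj u y ∧ x ≠ y ∧ ¬ G.Adj x y := by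
    by_contra! hcon
    obtain ⟨q, hq, -⟩ := h3 u u
    refine h.no_clique_cutset (a := u) (b := q) {u} {x | G.Adj u x} ?_ rfl ?_ ?_ ?_ ?_
    · exact fun x hx y hy hne => hcon x hx y hy hne
    · exact G.loopless.irrefl u
    · exact fun h => huQ (h ▸ hq)
    · exact hu q hq
    · rintro x rfl y _ hy
      exact hy
  obtain ⟨x, hux, y, huy, hxy, hnxy⟩ := hnc
  obtain ⟨a, haQ, hxa, hxa'⟩ := hT x hux
  have hua : ¬ G.Adj u a := hu a haQ
  set X := comp Gᶜ {z | G.Adj u z} x with hX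
  have hXu : X ⊆ {z | G.Adj u z} := comp_subset hux
  have hXa : ∀ z ∈ X, G.Adj z a := by
    intro z hz
    by_contra hza
    obtain ⟨p, hp, r, hr, hpr, hpa, hra⟩ := exists_flip (fun z => G.Adj z a)
      (mem_comp_self : x ∈ X) hz hxa hza
    obtain ⟨b, hbQ, hrb, hrb'⟩ := hT r (hXu hr)
    obtain ⟨c, hcQ, hca, hcb⟩ := h3 a b
    have hpu := huniq p u huU (hXu hp).symm a haQ hpa
    exact h.p5 c a p u r (hQ hcQ haQ hca) hpa.symm (hXu hp).symm (hXu hr)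
      (fun h => hpu c hcQ hca h.symm) (hUQ u huU c hcQ) (fun h => hrb' c hcQ hcb h.symm)
      (hUQ u huU a haQ) (fun h => hra h.symm) hpr.2
  obtain ⟨z, huz, haz⟩ := h.incomparable (fun hh : u = a => huQ (hh ▸ haQ)) hua
  have hzX : ∀ p ∈ X, G.Adj p z := by
    intro p hp
    by_contra hpz
    have hne : p ≠ z := fun h => haz (h ▸ hXa p hp).symm
    exact haz (hXa z (mem_comp_of_adj hux hp huz ⟨hne, hpz⟩)).symm
  obtain ⟨b, hbQ, hzb, hzb'⟩ := hT z huz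
  obtain ⟨c, hcQ, hca, hcb⟩ := h3 a b
  have hcX : ∀ p ∈ X, ¬ G.Adj c p := fun p hp hcp =>
    huniq p u huU (hXu hp).symm a haQ (hXa p hp) c hcQ hca hcp.symm
  have hcz : ¬ G.Adj c z := fun h => hzb' c hcQ hcb h.symm
  refine h.prime (M := X) ?_ (fun heq => G.loopless.irrefl u (hXu (heq ▸ trivial : u ∈ X)))
    ⟨x, mem_comp_self, y, mem_comp_of_adj hux mem_comp_self huy ⟨hxy, hnxy⟩, hxy⟩
  intro w hw p0 hp0 r0 hr0 hwp0
  by_contra hwr0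
  obtain ⟨p, hp, r, hr, hpr, hwp, hwr⟩ := exists_flip (fun z => G.Adj w z) hp0 hr0 hwp0 hwr0
  have hwu : ¬ G.Adj w u := fun hwu => hw (mem_comp_of_adj hux hr hwu.symm
    ⟨fun h => hw (h ▸ hr), fun h => hwr h.symm⟩)
  have hwz : G.Adj w z := by
    by_contra hwz
    exact hwr (h.kite u z p r w huz (hXu hp).symm (hzX p hp) (hXu hr).symm (hzX r hr) hpr.2
      hwu hwz hwp)
  have hcw : ¬ G.Adj c w := fun hcw => hUQ u huU c hcQ
    (h.kite p z w u c (hzX p hp) hwp hwz (hXu hp) huz hwu (hcX p hp) hcz hcw)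
  have hwa : G.Adj w a := by
    by_contra hwa
    exact h.p5 c a r z w (hQ hcQ haQ hca) (hXa r hr).symm (hzX r hr) hwz.symm (hcX r hr) hcz hcw
      haz (fun h => hwa h.symm) (fun h => hwr h.symm)
  exact hcz (h.kite w p a z c hwp hwa.symm (hXa p hp).symm hwz.symm (hzX p hp).symm haz hcw
    (hcX p hp) (hQ hcQ haQ hca))

/-- A criterion for the component of a clique `S` inside `M` to be a module. -/
theorem Ctx.component_module [Finite V] (h : Ctx G n) {M S : Set V} (hS : G.IsClique S)
    (hSM : S ⊆ M) (hnt : S.Nontrivial) (hMS : ∀ w ∈ M, ∃ s ∈ S, ¬ G.Adj w s)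
    (hM : ∀ y ∉ M, ∀ w ∈ M, G.Adj y w → (∃ s ∈ S, G.Adj w s) → ∀ x ∈ M, G.Adj y x)
    {o : V} (ho : o ∉ M) : False := by
  obtain ⟨s0, hs0, s1, hs1, h01⟩ := hnt
  have hs0M := hSM hs0
  have hin : ∀ N : Set V, S ⊆ N → S ⊆ comp G N s0 := by
    intro N hSN s hs
    by_cases hne : s0 = s
    · exact hne ▸ mem_comp_self
    · exact mem_comp_of_adj (hSN hs0) mem_comp_self (hSN hs) (hS hs0 hs hne)
  have hSC := hin M hSM
  refine h.prime (M := comp G M s0) ?_ (fun heq => ho (comp_subset hs0M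
    (heq ▸ trivial : o ∈ comp G M s0))) ⟨s0, hSC hs0, s1, hSC hs1, h01⟩
  intro y hy w0 hw0 w1 hw1 hyw0
  by_contra hyw1
  have hyM : y ∉ M := fun h => hy (mem_comp_of_adj hs0M hw0 h hyw0.symm)
  have hanti : ∀ w ∈ M, G.Adj y w → ∀ s ∈ S, ¬ G.Adj w s := fun w hw hyw s hs hws =>
    hyw1 (hM y hyM w hw hyw ⟨s, hs, hws⟩ w1 (comp_subset hs0M hw1))
  have hyS : ∀ s ∈ S, ¬ G.Adj y s := by
    intro s hs hys
    by_cases hne : s = s0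
    · exact hanti s (hSM hs) hys s1 hs1 (hS hs hs1 (hne ▸ h01))
    · exact hanti s (hSM hs) hys s0 hs0 (hS hs hs0 hne)
  have hs0D : s0 ∈ {x | x ∈ M ∧ ¬ G.Adj y x} := ⟨hs0M, hyS s0 hs0⟩
  set D := comp G {x | x ∈ M ∧ ¬ G.Adj y x} s0 with hD
  have hDM : D ⊆ {x | x ∈ M ∧ ¬ G.Adj y x} := comp_subset hs0D
  obtain ⟨u, -, w, hwC, huw, huD, hwD⟩ := exists_flip (fun x => x ∈ D)
    (mem_comp_self : s0 ∈ comp G M s0) hw0 mem_comp_self (fun h => (hDM h).2 hyw0)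
  have hwM := comp_subset hs0M hwC
  have hyw : G.Adj y w := by
    by_contra hyw
    exact hwD (mem_comp_of_adj hs0D huD ⟨hwM, hyw⟩ huw)
  have hwS := hanti w hwM hyw
  have hs0D' : s0 ∈ {x | (x ∈ M ∧ ¬ G.Adj y x) ∧ ¬ G.Adj w x} := ⟨hs0D, hwS s0 hs0⟩
  have hSD' := hin {x | (x ∈ M ∧ ¬ G.Adj y x) ∧ ¬ G.Adj w x} fun s hs =>
    ⟨⟨hSM hs, hyS s hs⟩, hwS s hs⟩
  set D' := comp G {x | (x ∈ M ∧ ¬ G.Adj y x) ∧ ¬ G.Adj w x} s0 with hD'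
  have hDM' : D' ⊆ {x | (x ∈ M ∧ ¬ G.Adj y x) ∧ ¬ G.Adj w x} := comp_subset hs0D'
  obtain ⟨e, -, e1, he1D, hee1, heD', he1D'⟩ := exists_flip (fun x => x ∈ D')
    (mem_comp_self : s0 ∈ D) huD mem_comp_self (fun h => (hDM' h).2 huw.symm)
  have he1 := hDM he1D
  have hwe1 : G.Adj w e1 := by
    by_contra hwe1
    exact he1D' (mem_comp_of_adj hs0D' heD' ⟨he1, hwe1⟩ hee1)
  obtain ⟨s, hs, hes⟩ := hMS e1 he1.1
  obtain ⟨e2, he2, e3, he3, h23, h12, h13⟩ := exists_flip (fun x => G.Adj e1 x) heD' (hSD' hs)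
    hee1.symm hes
  exact h.p5 y w e1 e2 e3 hyw hwe1 h12 h23 he1.2 (hDM' he2).1.2 (hDM' he3).1.2 (hDM' he2).2
    (hDM' he3).2 h13

end Dominating

section TriangleFree

variable {V : Type*} {G : SimpleGraph V} {n : ℕ}

open scoped Classical in
/-- The elements of `Q` that are not adjacent to `x`. -/
noncomputable def nonnbrs (G : SimpleGraph V) (Q : Finset V) (x : V) : Finset V :=
  Q.filter fun q => ¬ G.Adj x q

theorem mem_nonnbrs {Q : Finset V} {x q : V} : q ∈ nonnbrs G Q x ↔ q ∈ Q ∧ ¬ G.Adj x q := by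
  simp [nonnbrs]

theorem Ctx.adj_iff_of_two_nonadj (h : Ctx G n) {Q : Finset V} (hQ : G.IsClique (Q : Set V))
    {v w p p' s : V} (hp : p ∈ Q) (hp' : p' ∈ Q) (hne : p ≠ p') (hvp : G.Adj v p)
    (hvp' : G.Adj v p') (hwp : ¬ G.Adj w p) (hwp' : ¬ G.Adj w p') (hs : s ∈ Q)
    (hvs : ¬ G.Adj v s) : G.Adj w s ↔ G.Adj w v := by
  have hsp : G.Adj s p := hQ hs hp fun h => hvs (h ▸ hvp)
  have hsp' : G.Adj s p' := hQ hs hp' fun h => hvs (h ▸ hvp')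
  have hpp := hQ hp hp' hne
  exact ⟨h.kite p p' s v w hpp hsp hsp' hvp hvp' (fun h => hvs h.symm) hwp hwp',
    h.kite p p' v s w hpp hvp hvp' hsp hsp' hvs hwp hwp'⟩

theorem Ctx.nonnbrs_cases (h : Ctx G n) {Q : Finset V} (hQ : G.IsClique (Q : Set V))
    {v w p p' : V} (hne : p ≠ p') (hpw : p ∈ nonnbrs G Q w) (hpw' : p' ∈ nonnbrs G Q w)
    (hpv : p ∉ nonnbrs G Q v) (hpv' : p' ∉ nonnbrs G Q v) :
    (G.Adj w v → ∀ s ∈ nonnbrs G Q v, s ∉ nonnbrs G Q w) ∧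
      (¬ G.Adj w v → nonnbrs G Q v ⊆ nonnbrs G Q w) := by
  have key : ∀ s ∈ nonnbrs G Q v, (G.Adj w s ↔ G.Adj w v) := by
    intro s hs
    rw [mem_nonnbrs] at *
    exact h.adj_iff_of_two_nonadj hQ hpw.1 hpw'.1 hne (by_contra fun hh => hpv ⟨hpw.1, hh⟩)
      (by_contra fun hh => hpv' ⟨hpw'.1, hh⟩) hpw.2 hpw'.2 hs.1 hs.2
  refine ⟨fun hwv s hs hsw => (mem_nonnbrs.1 hsw).2 ((key s hs).2 hwv), fun hwv s hs => ?_⟩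
  exact mem_nonnbrs.2 ⟨(mem_nonnbrs.1 hs).1, fun hh => hwv ((key s hs).1 hh)⟩

theorem Ctx.adj_of_disjoint_nonnbrs (h : Ctx G n) {Q : Finset V} (hQ : G.IsClique (Q : Set V))
    (hne : ∀ w, (nonnbrs G Q w).Nonempty) {x z : V}
    (hd : ∀ q ∈ nonnbrs G Q x, q ∉ nonnbrs G Q z)
    (hsing : ∀ q ∈ nonnbrs G Q x, ∀ r ∈ nonnbrs G Q z, ∃ v, q ∈ nonnbrs G Q v ∧
      r ∉ nonnbrs G Q v ∧ 3 ≤ (nonnbrs G Q v).card) : G.Adj x z := by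
  classical
  by_contra hxz
  by_cases h1 : 1 < (nonnbrs G Q x).card
  · obtain ⟨p, hp, p', hp', hpp⟩ := Finset.one_lt_card.1 h1
    have := (h.nonnbrs_cases hQ hpp hp hp' (hd p hp) (hd p' hp')).2 hxz
    obtain ⟨r, hr⟩ := hne z
    exact hd r (this hr) hr
  by_cases h2 : 1 < (nonnbrs G Q z).card
  · obtain ⟨p, hp, p', hp', hpp⟩ := Finset.one_lt_card.1 h2
    have := (h.nonnbrs_cases hQ hpp hp hp' (fun hh => hd p hh hp) (fun hh => hd p' hh hp')).2
      fun h => hxz h.symm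
    obtain ⟨r, hr⟩ := hne x
    exact hd r hr (this hr)
  obtain ⟨q, hq⟩ := hne x
  obtain ⟨r, hr⟩ := hne z
  have hxu : ∀ p ∈ nonnbrs G Q x, p = q := fun p hp => Finset.card_le_one.1 (not_lt.1 h1) p hp q hq
  have hzu : ∀ p ∈ nonnbrs G Q z, p = r := fun p hp => Finset.card_le_one.1 (not_lt.1 h2) p hp r hr
  obtain ⟨v, hqv, hrv, hv3⟩ := hsing q hq r hr
  have h3 : 1 < ((nonnbrs G Q v).erase q).card := by
    rw [Finset.card_erase_of_mem hqv]; omega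
  obtain ⟨p, hp, p', hp', hpp⟩ := Finset.one_lt_card.1 h3
  obtain ⟨hpq, hpv⟩ := Finset.mem_erase.1 hp
  obtain ⟨hpq', hpv'⟩ := Finset.mem_erase.1 hp'
  rw [mem_nonnbrs] at hqv hpv hpv' hq hr
  have adjx : ∀ p ∈ Q, p ≠ q → G.Adj x p := fun p hp hne => by
    by_contra hh; exact hne (hxu p (mem_nonnbrs.2 ⟨hp, hh⟩))
  have adjz : ∀ p ∈ Q, p ≠ r → G.Adj z p := fun p hp hne => by
    by_contra hh; exact hne (hzu p (mem_nonnbrs.2 ⟨hp, hh⟩))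
  have hvr : G.Adj v r := by
    by_contra hh; exact hrv (mem_nonnbrs.2 ⟨hr.1, hh⟩)
  have hpr : p ≠ r := fun h => hpv.2 (h ▸ hvr)
  have hpr' : p' ≠ r := fun h => hpv'.2 (h ▸ hvr)
  have hpp2 := hQ hpv.1 hpv'.1 hpp
  have hvz : G.Adj v z := h.kite p p' r z v hpp2 (hQ hr.1 hpv.1 hpr.symm)
    (hQ hr.1 hpv'.1 hpr'.symm) (adjz p hpv.1 hpr) (adjz p' hpv'.1 hpr')
    (fun h => hr.2 h.symm) hpv.2 hpv'.2 hvr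
  have hvx : G.Adj v x := h.kite p p' z x v hpp2 (adjz p hpv.1 hpr) (adjz p' hpv'.1 hpr')
    (adjx p hpv.1 hpq) (adjx p' hpv'.1 hpq') (fun h => hxz h.symm) hpv.2 hpv'.2 hvz
  exact hqv.2 (h.kite p p' x q v hpp2 (adjx p hpv.1 hpq) (adjx p' hpv'.1 hpq')
    (hQ hq.1 hpv.1 hpq.symm) (hQ hq.1 hpv'.1 hpq'.symm) hq.2 hpv.2 hpv'.2 hvx)

theorem Ctx.no_closed_nonnbrs [Finite V] (h : Ctx G n) {Q : Finset V}
    (hQ : G.IsClique (Q : Set V)) (hne : ∀ w, (nonnbrs G Q w).Nonempty) {Y : Finset V}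
    (hY : Y.Nonempty) {q0 : V} (hq0 : q0 ∈ Q) (hq0Y : q0 ∉ Y)
    (hcl : ∀ z, (∃ q ∈ nonnbrs G Q z, q ∈ Y) → nonnbrs G Q z ⊆ Y)
    (hbig : ∀ q ∈ Y, ∃ v, q ∈ nonnbrs G Q v ∧ nonnbrs G Q v ⊆ Y ∧ 3 ≤ (nonnbrs G Q v).card) :
    False := by
  have hsing : ∀ q ∈ Q, ∀ r ∈ nonnbrs G Q q, r = q := fun q hq r hr => by
    by_contra hh
    exact (mem_nonnbrs.1 hr).2 (hQ hq (mem_nonnbrs.1 hr).1 (Ne.symm hh))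
  refine h.no_join {x | nonnbrs G Q x ⊆ Y} ?_ ⟨q0, ?_⟩ ?_
  · obtain ⟨q, hq⟩ := hY
    obtain ⟨v, hv, -⟩ := hbig q hq
    exact ⟨q, fun r hr => hsing q (mem_nonnbrs.1 hv).1 r hr ▸ hq⟩
  · intro hh
    exact hq0Y (hh (mem_nonnbrs.2 ⟨hq0, G.loopless.irrefl q0⟩))
  · intro x hx y hy
    have hyY : ∀ r ∈ nonnbrs G Q y, r ∉ Y := fun r hr hrY => hy (hcl y ⟨r, hr, hrY⟩)
    refine h.adj_of_disjoint_nonnbrs hQ hne (fun q hq hqy => hyY q hqy (hx hq)) ?_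
    intro q hq r hr
    obtain ⟨v, h1, h2, h3⟩ := hbig q (hx hq)
    exact ⟨v, h1, fun hh => hyY r hr (h2 hh), h3⟩

theorem Ctx.no_large_nonnbrs [Finite V] (h : Ctx G n) {Q : Finset V}
    (hQ : G.IsClique (Q : Set V)) (hne : ∀ w, (nonnbrs G Q w).Nonempty) {k : ℕ} (hk : 3 ≤ k)
    (hcard : k + 2 ≤ Q.card) (hle : ∀ y, (nonnbrs G Q y).card ≤ k) {v : V}
    (hv : (nonnbrs G Q v).card = k) : False := by
  classical
  have swap : ∀ y z, (nonnbrs G Q y).card = k → (∃ q ∈ nonnbrs G Q y, q ∈ nonnbrs G Q z) →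
      (∃ b ∈ nonnbrs G Q z, b ∉ nonnbrs G Q y) →
      (∀ a ∈ nonnbrs G Q y, a ∉ nonnbrs G Q z → ∀ b ∈ nonnbrs G Q y, b ∉ nonnbrs G Q z → a = b) ∧
      (∀ a ∈ nonnbrs G Q z, a ∉ nonnbrs G Q y → ∀ b ∈ nonnbrs G Q z, b ∉ nonnbrs G Q y →
        a = b) ∧ (nonnbrs G Q z).card = k ∧ ∃ a ∈ nonnbrs G Q y, a ∉ nonnbrs G Q z := by
    rintro y z hy ⟨q, hqy, hqz⟩ ⟨b, hbz, hby⟩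
    have h1 : ∀ a ∈ nonnbrs G Q y, a ∉ nonnbrs G Q z → ∀ b ∈ nonnbrs G Q y, b ∉ nonnbrs G Q z →
        a = b := by
      intro a ha haz c hc hcz
      by_contra hac
      have := h.nonnbrs_cases hQ hac ha hc haz hcz
      by_cases hyz : G.Adj y z
      · exact this.1 hyz q hqz hqy
      · exact hby (this.2 hyz hbz)
    have c1 := Finset.card_sdiff_add_card_inter (nonnbrs G Q y) (nonnbrs G Q z)
    have c2 := Finset.card_sdiff_add_card_inter (nonnbrs G Q z) (nonnbrs G Q y)
    have c3 : (nonnbrs G Q y \ nonnbrs G Q z).card ≤ 1 := Finset.card_le_one.2 fun a ha c hc =>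
      h1 a (Finset.mem_sdiff.1 ha).1 (Finset.mem_sdiff.1 ha).2 c (Finset.mem_sdiff.1 hc).1
        (Finset.mem_sdiff.1 hc).2
    have c4 : 0 < (nonnbrs G Q z \ nonnbrs G Q y).card :=
      Finset.card_pos.2 ⟨b, Finset.mem_sdiff.2 ⟨hbz, hby⟩⟩
    have c5 := hle z
    rw [Finset.inter_comm] at c2
    have c6 : (nonnbrs G Q z \ nonnbrs G Q y).card ≤ 1 := by omega
    have c7 : 0 < (nonnbrs G Q y \ nonnbrs G Q z).card := by omega
    refine ⟨h1, ?_, by omega, ?_⟩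
    · exact fun a ha hay c hc hcy => Finset.card_le_one.1 c6 a (Finset.mem_sdiff.2 ⟨ha, hay⟩) c
        (Finset.mem_sdiff.2 ⟨hc, hcy⟩)
    · obtain ⟨a, ha⟩ := Finset.card_pos.1 c7
      exact ⟨a, (Finset.mem_sdiff.1 ha).1, (Finset.mem_sdiff.1 ha).2⟩
  by_cases case1 : ∀ z, (∃ q ∈ nonnbrs G Q z, q ∈ nonnbrs G Q v) → nonnbrs G Q z ⊆ nonnbrs G Q v
  · obtain ⟨q0, hq0, hq0Y⟩ := Finset.exists_mem_notMem_of_card_lt_card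
      (show (nonnbrs G Q v).card < Q.card by omega)
    exact h.no_closed_nonnbrs hQ hne (hne v) hq0 hq0Y case1 fun q hq =>
      ⟨v, hq, Finset.Subset.refl _, by omega⟩
  push Not at case1
  obtain ⟨y, ⟨q, hqy, hqv⟩, hyv⟩ := case1
  obtain ⟨r, hry, hrv⟩ := Finset.not_subset.1 hyv
  obtain ⟨hy1, hy2, hyk, p, hpv, hpy⟩ := swap v y hv ⟨q, hqv, hqy⟩ ⟨r, hry, hrv⟩
  have hvy : ∀ a ∈ nonnbrs G Q v, a = p ∨ a ∈ nonnbrs G Q y := fun a ha => by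
    by_cases hay : a ∈ nonnbrs G Q y
    exacts [Or.inr hay, Or.inl (hy1 a ha hay p hpv hpy)]
  have hyv' : ∀ a ∈ nonnbrs G Q y, a = r ∨ a ∈ nonnbrs G Q v := fun a ha => by
    by_cases hay : a ∈ nonnbrs G Q v
    exacts [Or.inr hay, Or.inl (hy2 a ha hay r hry hrv)]
  by_cases case2 : ∃ y', r ∈ nonnbrs G Q y' ∧ ∃ p' ∈ nonnbrs G Q v, p' ∉ nonnbrs G Q y' ∧
      p' ≠ p ∧ ∃ q ∈ nonnbrs G Q v, q ∈ nonnbrs G Q y'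
  · obtain ⟨y', hry', p', hpv', hpy', hpp, q', hqv', hqy'⟩ := case2
    obtain ⟨hz1, hz2, hzk, -⟩ := swap v y' hv ⟨q', hqv', hqy'⟩ ⟨r, hry', hrv⟩
    have hvy2 : ∀ a ∈ nonnbrs G Q v, a = p' ∨ a ∈ nonnbrs G Q y' := fun a ha => by
      by_cases hay : a ∈ nonnbrs G Q y'
      exacts [Or.inr hay, Or.inl (hz1 a ha hay p' hpv' hpy')]
    obtain ⟨c, hc, hcp⟩ := Finset.exists_mem_notMem_of_card_lt_card
      (show ({p, p'} : Finset V).card < (nonnbrs G Q v).card from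
        (Finset.card_le_two).trans_lt (by omega))
    have hcp1 : c ≠ p := fun hh => hcp (by simp [hh])
    have hcp2 : c ≠ p' := fun hh => hcp (by simp [hh])
    have hcy : c ∈ nonnbrs G Q y := (hvy c hc).resolve_left hcp1
    have hcy' : c ∈ nonnbrs G Q y' := (hvy2 c hc).resolve_left hcp2
    have hpy2 : p' ∈ nonnbrs G Q y := (hvy p' hpv').resolve_left hpp
    have hpy3 : p ∈ nonnbrs G Q y' := (hvy2 p hpv).resolve_left hpp.symm
    obtain ⟨q0, hq0, hq0Y⟩ := Finset.exists_mem_notMem_of_card_lt_card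
      (show (insert r (nonnbrs G Q v)).card < Q.card by
        have := Finset.card_insert_le r (nonnbrs G Q v); omega)
    refine h.no_closed_nonnbrs hQ hne ⟨r, Finset.mem_insert_self _ _⟩ hq0 hq0Y ?_ ?_
    · rintro z ⟨s, hsz, hsY⟩ b0 hb0
      by_contra hb0Y
      rw [Finset.mem_insert, not_or] at hb0Y
      have hb0y : b0 ∉ nonnbrs G Q y := fun hh => (hyv' b0 hh).elim hb0Y.1 hb0Y.2
      have hb0y' : b0 ∉ nonnbrs G Q y' := fun hh =>
        hb0Y.1 (hz2 b0 hh hb0Y.2 r hry' hrv)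
      have hmv : ∃ s ∈ nonnbrs G Q v, s ∈ nonnbrs G Q z := by
        rcases Finset.mem_insert.1 hsY with rfl | hsv
        · have sy := (swap y z hyk ⟨s, hry, hsz⟩ ⟨b0, hb0, hb0y⟩).1
          by_contra! hcon
          exact hcp2 (sy c hcy (hcon c hc) p' hpy2 (hcon p' hpv'))
        · exact ⟨s, hsv, hsz⟩
      obtain ⟨sv1, sv2, -⟩ := swap v z hv hmv ⟨b0, hb0, hb0Y.2⟩
      have hrz : r ∉ nonnbrs G Q z := fun hh => hb0Y.1 (sv2 b0 hb0 hb0Y.2 r hh hrv)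
      have hmy : ∃ s ∈ nonnbrs G Q y, s ∈ nonnbrs G Q z := by
        by_contra! hcon
        exact hcp2 (sv1 c hc (hcon c hcy) p' hpv' (hcon p' hpy2))
      have hmy' : ∃ s ∈ nonnbrs G Q y', s ∈ nonnbrs G Q z := by
        by_contra! hcon
        exact hcp1 (sv1 c hc (hcon c hcy') p hpv (hcon p hpy3))
      obtain ⟨-, sy2, -⟩ := swap y z hyk hmy ⟨b0, hb0, hb0y⟩
      obtain ⟨-, sy2', -⟩ := swap y' z hzk hmy' ⟨b0, hb0, hb0y'⟩
      have hpz : p ∉ nonnbrs G Q z := fun hh => hb0Y.2 (sy2 b0 hb0 hb0y p hh hpy ▸ hpv)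
      have hpz' : p' ∉ nonnbrs G Q z := fun hh => hb0Y.2 (sy2' b0 hb0 hb0y' p' hh hpy' ▸ hpv')
      exact hpp (sv1 p' hpv' hpz' p hpv hpz)
    · intro s hs
      rcases Finset.mem_insert.1 hs with rfl | hsv
      · refine ⟨y, hry, fun a ha => ?_, by omega⟩
        rcases hyv' a ha with rfl | hh
        exacts [Finset.mem_insert_self _ _, Finset.mem_insert_of_mem hh]
      · exact ⟨v, hsv, Finset.subset_insert _ _, by omega⟩
  have star : ∀ z, (∃ s ∈ nonnbrs G Q z, s ∈ (nonnbrs G Q v).erase p) →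
      ¬ nonnbrs G Q z ⊆ (nonnbrs G Q v).erase p → (nonnbrs G Q v).erase p ⊆ nonnbrs G Q z := by
    rintro z ⟨s, hsz, hs⟩ hz a ha
    obtain ⟨hsp, hsv⟩ := Finset.mem_erase.1 hs
    obtain ⟨hap, hav⟩ := Finset.mem_erase.1 ha
    have hsy := (hvy s hsv).resolve_left hsp
    have hay := (hvy a hav).resolve_left hap
    by_contra haz
    have har : a ≠ r := fun hh => hrv (hh ▸ hav)
    by_cases hzv : nonnbrs G Q z ⊆ nonnbrs G Q v
    · obtain ⟨p1, hp1, hp1'⟩ := Finset.not_subset.1 hz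
      have hp1p : p1 = p := by
        by_contra hh
        exact hp1' (Finset.mem_erase.2 ⟨hh, hzv hp1⟩)
      subst hp1p
      exact har ((swap y z hyk ⟨s, hsy, hsz⟩ ⟨p1, hp1, hpy⟩).1 a hay haz r hry
        fun hh => hrv (hzv hh))
    · obtain ⟨b, hbz, hbv⟩ := Finset.not_subset.1 hzv
      by_cases hrz : r ∈ nonnbrs G Q z
      · exact case2 ⟨z, hrz, a, hav, haz, hap, s, hsv, hsz⟩
      · have hby : b ∉ nonnbrs G Q y := fun hh => (hyv' b hh).elim (fun hh => hrz (hh ▸ hbz)) hbv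
        exact har ((swap y z hyk ⟨s, hsy, hsz⟩ ⟨b, hbz, hby⟩).1 a hay haz r hry hrz)
  have hS0 : 1 < ((nonnbrs G Q v).erase p).card := by
    rw [Finset.card_erase_of_mem hpv]; omega
  have hS0Q : ∀ s ∈ (nonnbrs G Q v).erase p, s ∈ Q := fun s hs =>
    (mem_nonnbrs.1 (Finset.mem_of_mem_erase hs)).1
  refine h.component_module (M := {w | nonnbrs G Q w ⊆ (nonnbrs G Q v).erase p})
    (S := ((nonnbrs G Q v).erase p : Finset V)) (o := v) ?_ ?_ ?_ ?_ ?_ ?_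
  · exact fun a ha b hb hab => hQ (hS0Q a ha) (hS0Q b hb) hab
  · intro s hs a ha
    have : a = s := by
      by_contra hh
      exact (mem_nonnbrs.1 ha).2 (hQ (hS0Q s hs) (mem_nonnbrs.1 ha).1 (Ne.symm hh))
    exact this ▸ hs
  · exact Finset.one_lt_card_iff_nontrivial.1 hS0
  · intro w hw
    obtain ⟨s, hs⟩ := hne w
    exact ⟨s, hw hs, (mem_nonnbrs.1 hs).2⟩
  · rintro z hz w hw hzw ⟨s, hs, hws⟩ x hx
    by_cases hm : ∃ s ∈ nonnbrs G Q z, s ∈ (nonnbrs G Q v).erase p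
    · have hsub := star z hm hz
      obtain ⟨b, hbz, hb⟩ := Finset.not_subset.1 hz
      obtain ⟨a, ha⟩ := hne w
      exact absurd (hsub (hw ha)) ((h.nonnbrs_cases hQ (fun hh : s = b => hb (hh ▸ hs)) (hsub hs) hbz
        (fun hh => (mem_nonnbrs.1 hh).2 hws) fun hh => hb (hw hh)).1 hzw a ha)
    · push Not at hm
      refine (h.adj_of_disjoint_nonnbrs hQ hne (fun q hq hqz => hm q hqz (hx hq)) ?_).symm
      intro a ha b hb
      obtain ⟨hap, hav⟩ := Finset.mem_erase.1 (hx ha)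
      by_cases hbp : b = p
      · exact ⟨y, (hvy a hav).resolve_left hap, hbp ▸ hpy, by omega⟩
      · exact ⟨v, hav, fun hh => hm b hb (Finset.mem_erase.2 ⟨hbp, hh⟩), by omega⟩
  · exact fun hh => Finset.notMem_erase p _ (hh hpv)

end TriangleFree

section TwoEdges

variable {V : Type*} {G : SimpleGraph V} {n : ℕ}

theorem le_bound {m n : ℕ} (h : m ≤ n) (hn : n ≤ 6) : m ≤ bound n := by
  interval_cases n <;> simp [bound] <;> omega

theorem Ctx.no_private_clique [Finite V] (h : Ctx G n) {K : Finset V}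
    (hK : G.IsClique (K : Set V)) (h3 : 3 ≤ K.card) {v q : V} (hvK : ∀ x ∈ K, ¬ G.Adj v x)
    (hqK : ∀ x ∈ K, G.Adj q x) (huniq : ∀ c, (∀ x ∈ K, G.Adj c x) → c = q) (hvq : G.Adj v q) :
    False := by
  classical
  have hqnK : q ∉ K := fun hh => G.loopless.irrefl q (hqK q hh)
  obtain ⟨Q, hQdef⟩ : ∃ Q, Q = insert q K := ⟨_, rfl⟩
  have hqQ : q ∈ Q := by simp [hQdef]
  have hKQ : ∀ x ∈ K, x ∈ Q := fun x hx => by simp [hQdef, hx]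
  have hQK : ∀ x ∈ Q, x ≠ q → x ∈ K := fun x hx hne => by
    rw [hQdef] at hx; exact (Finset.mem_insert.1 hx).resolve_left hne
  have hcard : 4 ≤ Q.card := by rw [hQdef, Finset.card_insert_of_notMem hqnK]; omega
  have hQ : ∀ x ∈ Q, ∀ y ∈ Q, x ≠ y → G.Adj x y := by
    intro x hx y hy hxy
    by_cases hxq : x = q
    · exact hxq ▸ hqK y (hQK y hy fun hh => hxy (hxq.trans hh.symm))
    · by_cases hyq : y = q
      · exact hyq ▸ (hqK x (hQK x hx hxq)).symm
      · exact hK (hQK x hx hxq) (hQK y hy hyq) hxy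
  have hQc : G.IsClique (Q : Set V) := fun x hx y hy => hQ x hx y hy
  have hmax : ∀ w, ∃ s ∈ Q, ¬ G.Adj w s := by
    intro w
    by_contra! hcon
    have := huniq w fun x hx => hcon x (hKQ x hx)
    exact G.loopless.irrefl q (this ▸ hcon q hqQ)
  have ex4 : ∀ a b c, ∃ d ∈ Q, d ≠ a ∧ d ≠ b ∧ d ≠ c := by
    intro a b c
    obtain ⟨d, hd, hd'⟩ := Finset.exists_mem_notMem_of_card_lt_card
      (show ({a, b, c} : Finset V).card < Q.card from (Finset.card_le_three).trans_lt (by omega))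
    exact ⟨d, hd, fun hh => hd' (by simp [hh]), fun hh => hd' (by simp [hh]),
      fun hh => hd' (by simp [hh])⟩
  have dom : ∀ u ∉ Q, ∃ s ∈ Q, G.Adj u s := fun u hu =>
    h.dominating hQc hmax (fun a b => let ⟨c, h1, h2, h3, _⟩ := ex4 a b b; ⟨c, h1, h2, h3⟩) u hu
  obtain ⟨TT, hTT⟩ : ∃ TT : V → V → Prop, ∀ a t, TT a t ↔
      G.Adj t a ∧ ∀ b ∈ Q, b ≠ a → ¬ G.Adj t b := ⟨_, fun _ _ => Iff.rfl⟩
  have hTQ : ∀ a t, TT a t → t ∉ Q := by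
    intro a t ht htQ
    obtain ⟨d, hd, hda, hdt, -⟩ := ex4 a t t
    exact ((hTT a t).1 ht).2 d hd hda (hQ t htQ d hd hdt.symm)
  have F1 : ∀ a ∈ Q, ∀ t w, TT a t → ∀ p ∈ Q, ∀ p' ∈ Q, p ≠ p' → p ≠ a → p' ≠ a →
      G.Adj w p → G.Adj w p' → (G.Adj t w → ∀ s ∈ Q, ¬ G.Adj w s → s = a) ∧
        (¬ G.Adj t w → G.Adj w a) := by
    intro a ha t w ht p hp p' hp' hne hpa hpa' hwp hwp'
    rw [hTT] at ht
    have key := fun s hs hws => h.adj_iff_of_two_nonadj hQc hp hp' hne hwp hwp' (ht.2 p hp hpa)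
      (ht.2 p' hp' hpa') (s := s) hs hws
    refine ⟨fun htw s hs hws => ?_, fun htw => ?_⟩
    · by_contra hsa
      exact ht.2 s hs hsa ((key s hs hws).2 htw)
    · by_contra hwa
      exact htw ((key a ha hwa).1 ht.1)
  have F2 : ∀ a ∈ Q, ∀ t, TT a t → ∀ x, (∀ s ∈ Q, ¬ G.Adj x s → s = a) → x = a := by
    intro a ha t ht x hx
    by_contra hxa
    have hxs : ∀ s ∈ Q, s ≠ a → G.Adj x s := fun s hs hne => by
      by_contra hh; exact hne (hx s hs hh)
    obtain ⟨s, hs, hxs'⟩ := hmax x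
    have hxna : ¬ G.Adj x a := hx s hs hxs' ▸ hxs'
    obtain ⟨y, hay, hxy⟩ := h.incomparable (Ne.symm hxa) fun hh => hxna hh.symm
    obtain ⟨d1, hd1, hd1a, -⟩ := ex4 a a a
    obtain ⟨d2, hd2, hd2a, hd21, -⟩ := ex4 a d1 d1
    obtain ⟨d3, hd3, hd3a, hd31, hd32⟩ := ex4 a d1 d2
    have two : ∀ p ∈ Q, ∀ p' ∈ Q, p ≠ p' → p ≠ a → p' ≠ a → G.Adj y p → G.Adj y p' → False := by
      intro p hp p' hp' hne hpa hpa' hyp hyp'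
      have f1 := F1 a ha t y ht p hp p' hp' hne hpa hpa' hyp hyp'
      have f2 := F1 a ha t x ht p hp p' hp' hne hpa hpa' (hxs p hp hpa) (hxs p' hp' hpa')
      have hty : ¬ G.Adj t y := fun hty => by
        obtain ⟨s, hs, hys⟩ := hmax y
        exact hys (f1.1 hty s hs hys ▸ hay.symm)
      have htx : G.Adj t x := by_contra fun hh => hxna (f2.2 hh)
      exact hty (h.kite p p' x y t (hQ p hp p' hp' hne) (hxs p hp hpa) (hxs p' hp' hpa') hyp hyp'
        hxy (((hTT a t).1 ht).2 p hp hpa) (((hTT a t).1 ht).2 p' hp' hpa') htx)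
    have none : ∀ p ∈ Q, ∀ p' ∈ Q, p ≠ p' → p ≠ a → p' ≠ a → ¬ G.Adj y p → ¬ G.Adj y p' →
        False := by
      intro p hp p' hp' hne hpa hpa' hyp hyp'
      exact hxy (h.kite p p' a x y (hQ p hp p' hp' hne) (hQ a ha p hp hpa.symm)
        (hQ a ha p' hp' hpa'.symm) (hxs p hp hpa) (hxs p' hp' hpa') (fun hh => hxna hh.symm)
        hyp hyp' hay.symm).symm
    have e12 := hd21.symm
    have e13 := hd31.symm
    have e23 := hd32.symm
    by_cases y1 : G.Adj y d1 <;> by_cases y2 : G.Adj y d2 <;> by_cases y3 : G.Adj y d3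
    · exact two d1 hd1 d2 hd2 e12 hd1a hd2a y1 y2
    · exact two d1 hd1 d2 hd2 e12 hd1a hd2a y1 y2
    · exact two d1 hd1 d3 hd3 e13 hd1a hd3a y1 y3
    · exact none d2 hd2 d3 hd3 e23 hd2a hd3a y2 y3
    · exact two d2 hd2 d3 hd3 e23 hd2a hd3a y2 y3
    · exact none d1 hd1 d3 hd3 e13 hd1a hd3a y1 y3
    · exact none d1 hd1 d2 hd2 e12 hd1a hd2a y1 y2
    · exact none d1 hd1 d2 hd2 e12 hd1a hd2a y1 y2
  have F3 : ∀ a ∈ Q, ∀ t, TT a t → ∀ w, w ≠ a → ¬ G.Adj w a → ∃ p ∈ Q, p ≠ a ∧ TT p w := by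
    intro a ha t ht w hwa hnwa
    have hwQ : w ∉ Q := fun hh => hnwa (hQ w hh a ha hwa)
    obtain ⟨p, hp, hwp⟩ := dom w hwQ
    have hpa : p ≠ a := fun hh => hnwa (hh ▸ hwp)
    refine ⟨p, hp, hpa, (hTT p w).2 ⟨hwp, fun p' hp' hne hwp' => ?_⟩⟩
    have hpa' : p' ≠ a := fun hh => hnwa (hh ▸ hwp')
    have f1 := F1 a ha t w ht p hp p' hp' hne.symm hpa hpa' hwp hwp'
    exact hwa (F2 a ha t ht w (f1.1 (by_contra fun hh => hnwa (f1.2 hh))))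
  have hTv : TT q v := (hTT q v).2 ⟨hvq, fun b hb hbq => hvK b (hQK b hb hbq)⟩
  have hp : ∃ p ∈ Q, p ≠ q ∧ ∃ t, TT p t := by
    by_contra! hcon
    refine h.no_join {q} ⟨q, rfl⟩ ⟨v, fun hh => hvq.ne hh⟩ ?_
    rintro x rfl w hw
    by_contra hxw
    obtain ⟨p, hp, hpx, hT⟩ := F3 x hqQ v hTv w hw fun hh => hxw hh.symm
    exact hcon p hp hpx w hT
  obtain ⟨p, hpQ, hpq, tp, htp⟩ := hp
  by_cases hr : ∃ r ∈ Q, r ≠ p ∧ r ≠ q ∧ ∃ t, TT r t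
  swap
  · push Not at hr
    obtain ⟨d1, hd1, hd1p, hd1q, -⟩ := ex4 p q q
    obtain ⟨d2, hd2, hd2p, hd2q, hd21⟩ := ex4 p q d1
    have hanti : ∀ a ∈ Q, ∀ y, TT a y → ∀ b ∈ Q, b ≠ a → ∀ w, G.Adj w a → G.Adj w b →
        (∃ s ∈ Q, s ≠ a ∧ s ≠ b ∧ G.Adj w s) → ¬ G.Adj y w := by
      rintro a ha y hy b hb hba w hwa hwb ⟨s, hs, hsa, hsb, hws⟩ hyw
      obtain ⟨z, hz, hwz⟩ := hmax w
      exact hwz ((F1 a ha y w hy b hb s hs hsb.symm hba hsa hwb hws).1 hyw z hz hwz ▸ hwa)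
    refine h.component_module (M := {w | G.Adj w p ∧ G.Adj w q})
      (S := {s | s ∈ Q ∧ s ≠ p ∧ s ≠ q}) (o := p) ?_ ?_ ?_ ?_ ?_ ?_
    · exact fun x hx y hy hxy => hQ x hx.1 y hy.1 hxy
    · exact fun s hs => ⟨hQ s hs.1 p hpQ hs.2.1, hQ s hs.1 q hqQ hs.2.2⟩
    · exact ⟨d1, ⟨hd1, hd1p, hd1q⟩, d2, ⟨hd2, hd2p, hd2q⟩, hd21.symm⟩
    · intro w hw
      obtain ⟨s, hs, hws⟩ := hmax w
      exact ⟨s, ⟨hs, fun hh => hws (hh ▸ hw.1), fun hh => hws (hh ▸ hw.2)⟩, hws⟩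
    · rintro y hy w hw hyw ⟨s, hs, hws⟩ x hx
      by_cases hyp : y = p
      · exact hyp ▸ hx.1.symm
      by_cases hyq : y = q
      · exact hyq ▸ hx.2.symm
      exfalso
      by_cases hap : G.Adj y p
      · have haq : ¬ G.Adj y q := fun hh => hy ⟨hap, hh⟩
        obtain ⟨b, hb, hbq, hTb⟩ := F3 q hqQ v hTv y hyq haq
        have hbp : b = p := by_contra fun hh => hr b hb hh hbq y hTb
        exact hanti p hpQ y (hbp ▸ hTb) q hqQ hpq.symm w hw.1 hw.2
          ⟨s, hs.1, hs.2.1, hs.2.2, hws⟩ hyw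
      · obtain ⟨b, hb, hbp, hTb⟩ := F3 p hpQ tp htp y hyp hap
        have hbq : b = q := by_contra fun hh => hr b hb hbp hh y hTb
        exact hanti q hqQ y (hbq ▸ hTb) p hpQ hpq w hw.2 hw.1
          ⟨s, hs.1, hs.2.2, hs.2.1, hws⟩ hyw
    · exact fun hh => G.loopless.irrefl p hh.1
  obtain ⟨r, hrQ, hrp, hrq, tr, htr⟩ := hr
  have hcov : ∀ w, (∃ b ∈ Q, TT b w) ∨ (w ∈ Q ∧ ∃ t, TT w t) := by
    by_contra! hcon
    obtain ⟨w0, hw1, hw2⟩ := hcon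
    refine h.no_clique_cutset (a := v) (b := w0) {x | ∃ b ∈ Q, TT b x}
      {a | a ∈ Q ∧ ∃ t, TT a t} ?_ ⟨q, hqQ, hTv⟩ (fun hh => hTQ q v hTv hh.1) ?_ ?_ ?_
    · exact fun x hx y hy hxy => hQ x hx.1 y hy.1 hxy
    · rintro ⟨b, hb, hT⟩
      exact hw1 b hb hT
    · rintro ⟨hw, t, ht⟩
      exact hw2 hw t ht
    · rintro x ⟨b, hb, hTb⟩ y hyT hyA hxy
      have hadj : ∀ a ∈ Q, ∀ t, TT a t → G.Adj y a := by
        intro a ha t ht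
        by_contra hya
        by_cases hya' : y = a
        · exact hyA ⟨hya' ▸ ha, t, hya' ▸ ht⟩
        · obtain ⟨c, hc, -, hT⟩ := F3 a ha t ht y hya' hya
          exact hyT ⟨c, hc, hT⟩
      have hyp := hadj p hpQ tp htp
      have hyq := hadj q hqQ v hTv
      have hyr := hadj r hrQ tr htr
      obtain ⟨s, hs, hys⟩ := hmax y
      have hsb : s = b := by
        by_cases hbp : b = p
        · exact (F1 b hb x y hTb q hqQ r hrQ hrq.symm (hbp ▸ hpq.symm) (hbp ▸ hrp) hyq hyr).1
            hxy s hs hys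
        · by_cases hbq : b = q
          · exact (F1 b hb x y hTb p hpQ r hrQ hrp.symm (hbq ▸ hpq) (hbq ▸ hrq) hyp hyr).1
              hxy s hs hys
          · exact (F1 b hb x y hTb p hpQ q hqQ hpq (Ne.symm hbp) (Ne.symm hbq) hyp hyq).1
              hxy s hs hys
      exact hys (hsb ▸ hadj b hb x hTb)
  have F5 : ∀ a ∈ Q, ∀ t t', TT a t → TT a t' → ¬ G.Adj t t' := by
    intro a ha t t' ht ht' htt
    have htS : t ∈ {x | TT a x} := ht
    refine h.prime (M := comp G {x | TT a x} t) ?_ ?_ ⟨t, mem_comp_self, t',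
      mem_comp_of_adj htS mem_comp_self ht' htt, htt.ne⟩
    · intro y hy x hx z hz hyx
      by_contra hyz
      obtain ⟨t1, h1, t2, h2, h12, hy1, hy2⟩ := exists_flip (fun z => G.Adj y z) hx hz hyx hyz
      have hT1 : TT a t1 := comp_subset htS h1
      have hT2 : TT a t2 := comp_subset htS h2
      have hya : ¬ TT a y := fun hh => hy (mem_comp_of_adj htS h1 hh hy1.symm)
      rw [hTT] at hT1 hT2
      rcases hcov y with ⟨b, hb, hTb⟩ | ⟨hyQ, -⟩
      · have hba : b ≠ a := fun hh => hya (hh ▸ hTb)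
        obtain ⟨c, hc, hca, hcb, -⟩ := ex4 a b b
        rw [hTT] at hTb
        exact h.p5 t2 t1 y b c h12.symm hy1.symm hTb.1 (hQ b hb c hc hcb.symm)
          (fun hh => hy2 hh.symm) (hT2.2 b hb hba) (hT2.2 c hc hca) (hT1.2 b hb hba)
          (hT1.2 c hc hca) (hTb.2 c hc hcb)
      · by_cases hya' : y = a
        · exact hy2 (hya' ▸ hT2.1.symm)
        · exact hT1.2 y hyQ hya' hy1.symm
    · intro heq
      exact hTQ a q (comp_subset htS (heq ▸ trivial : q ∈ comp G {x | TT a x} t)) hqQ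
  obtain ⟨m, hm⟩ : ∃ m, Q.card = m + 2 := ⟨Q.card - 2, by omega⟩
  have hcn : m + 2 ≤ n := hm ▸ h.omega Q (Set.subset_univ _) hQc
  let e := Q.equivFinOfCardEq hm
  have hcol := col_biUnion (G := G) (Finset.univ : Finset (Fin (m + 2)))
    (fun i => {x | x = (e.symm i : V) ∨ TT (e.symm (i + 1)) x}) (by
      intro i _ x hx y hy hxy
      have hne : (e.symm i : V) ≠ e.symm (i + 1) := fun hh => by
        have := e.symm.injective (Subtype.ext hh)
        simp at this
      rcases hx with hx | hx <;> rcases hy with hy | hy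
      · exact hxy.ne (hx.trans hy.symm)
      · exact ((hTT _ _).1 hy).2 _ (e.symm i).2 hne (hx ▸ hxy.symm)
      · exact ((hTT _ _).1 hx).2 _ (e.symm i).2 hne (hy ▸ hxy)
      · exact F5 _ (e.symm (i + 1)).2 x y hx hy hxy)
  refine h.hard (hcol.mono (fun w _ => ?_) (by
    rw [Finset.card_univ, Fintype.card_fin]; exact le_bound hcn h.le6))
  rw [Set.mem_iUnion₂]
  rcases hcov w with ⟨b, hb, hTb⟩ | ⟨hw, -⟩
  · exact ⟨e ⟨b, hb⟩ - 1, Finset.mem_univ _, Or.inr (by simpa using hTb)⟩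
  · exact ⟨e ⟨w, hw⟩, Finset.mem_univ _, Or.inl (by simp)⟩

theorem exists_maximal_clique [Finite V] {K : Finset V} (hK : G.IsClique (K : Set V)) :
    ∃ Q : Finset V, K ⊆ Q ∧ G.IsClique (Q : Set V) ∧ ∀ w, ∃ q ∈ Q, ¬ G.Adj w q := by
  classical
  let F := {Q : Finset V // K ⊆ Q ∧ G.IsClique (Q : Set V)}
  have : Nonempty F := ⟨⟨K, Finset.Subset.refl K, hK⟩⟩
  obtain ⟨⟨Q, hKQ, hQ⟩, hmax⟩ := Finite.exists_max (fun Q : F => Q.1.card)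
  refine ⟨Q, hKQ, hQ, fun w => ?_⟩
  by_contra! hcon
  have hwQ : w ∉ Q := fun hh => G.loopless.irrefl w (hcon w hh)
  have := hmax ⟨insert w Q, hKQ.trans (Finset.subset_insert _ _), by
    rw [Finset.coe_insert]; exact hQ.insert fun b hb _ => hcon b hb⟩
  simp [Finset.card_insert_of_notMem hwQ] at this

/-- In a minimal counterexample, the non-neighbours of a vertex contain no triangle. -/
theorem Ctx.no_triangle [Finite V] (h : Ctx G n) {v a b c : V} (hab : G.Adj a b)
    (hac : G.Adj a c) (hbc : G.Adj b c) (hva : ¬ G.Adj v a) (hvb : ¬ G.Adj v b)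
    (hvc : ¬ G.Adj v c) : False := by
  classical
  let F := {p : V × Finset V // G.IsClique (p.2 : Set V) ∧ 3 ≤ p.2.card ∧
    ∀ x ∈ p.2, ¬ G.Adj p.1 x}
  have hne : Nonempty F := by
    refine ⟨⟨(v, {a, b, c}), ?_, ?_, ?_⟩⟩
    · simp [Set.pairwise_insert, IsClique, hab, hac, hbc, hab.symm, hac.symm, hbc.symm]
    · rw [Finset.card_eq_three.2 ⟨a, b, c, hab.ne, hac.ne, hbc.ne, rfl⟩]
    · simp [hva, hvb, hvc]
  obtain ⟨⟨⟨v, K⟩, hK, hK3, hvK⟩, hmax⟩ := Finite.exists_max (fun p : F => p.1.2.card)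
  have hmax' : ∀ w, ∀ L : Finset V, G.IsClique (L : Set V) → (∀ x ∈ L, ¬ G.Adj w x) →
      L.card ≤ K.card := by
    intro w L hL hwL
    by_cases h3 : 3 ≤ L.card
    · exact hmax ⟨(w, L), hL, h3, hwL⟩
    · have : 3 ≤ K.card := hK3
      omega
  replace hK : G.IsClique (K : Set V) := hK
  replace hK3 : 3 ≤ K.card := hK3
  replace hvK : ∀ x ∈ K, ¬ G.Adj v x := hvK
  clear hmax
  have hex : ∀ a b, ∃ d ∈ K, d ≠ a ∧ d ≠ b := by
    intro a b
    obtain ⟨d, hd, hd'⟩ := Finset.exists_mem_notMem_of_card_lt_card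
      (show ({a, b} : Finset V).card < K.card from (Finset.card_le_two).trans_lt (by omega))
    exact ⟨d, hd, fun hh => hd' (by simp [hh]), fun hh => hd' (by simp [hh])⟩
  have hvnK : v ∉ K := fun hh => by
    obtain ⟨d, hd, hdv, -⟩ := hex v v
    exact hvK d hd (hK hh hd hdv.symm)
  have hins : ∀ c, (∀ x ∈ K, G.Adj c x) → G.IsClique ((insert c K : Finset V) : Set V) := by
    intro c hc
    rw [Finset.coe_insert]
    exact hK.insert fun b hb _ => hc b hb
  have hnot : ∀ c, (∀ x ∈ K, G.Adj c x) → c ∉ K := fun c hc hh => G.loopless.irrefl c (hc c hh)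
  by_cases hedge : ∃ c, (∀ x ∈ K, G.Adj c x) ∧ ∃ d, (∀ x ∈ K, G.Adj d x) ∧ G.Adj c d
  · obtain ⟨c, hc, d, hd, hcd⟩ := hedge
    have hcl : G.IsClique ((insert d (insert c K) : Finset V) : Set V) := by
      rw [Finset.coe_insert]
      refine (hins c hc).insert fun b hb _ => ?_
      rcases Finset.mem_insert.1 hb with rfl | hb
      exacts [hcd.symm, hd b hb]
    obtain ⟨Q, hKQ, hQ, hQmax⟩ := exists_maximal_clique hcl
    have hcardQ := Finset.card_le_card hKQ
    rw [Finset.card_insert_of_notMem, Finset.card_insert_of_notMem (hnot c hc)] at hcardQ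
    swap
    · rw [Finset.mem_insert, not_or]
      exact ⟨hcd.ne', hnot d hd⟩
    have hle : ∀ y, (nonnbrs G Q y).card ≤ K.card := fun y => hmax' y _
      (fun x hx z hz hxz => hQ (mem_nonnbrs.1 hx).1 (mem_nonnbrs.1 hz).1 hxz)
      fun x hx => (mem_nonnbrs.1 hx).2
    have hKsub : K ⊆ nonnbrs G Q v := fun x hx => mem_nonnbrs.2
      ⟨hKQ (Finset.mem_insert_of_mem (Finset.mem_insert_of_mem hx)), hvK x hx⟩
    refine h.no_large_nonnbrs hQ (fun w => ?_) hK3 (by omega) hle (v := v)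
      (le_antisymm (hle v) (Finset.card_le_card hKsub))
    obtain ⟨q, hq⟩ := hQmax w
    exact ⟨q, mem_nonnbrs.2 hq⟩
  push Not at hedge
  have hvc : ∀ c, (∀ x ∈ K, G.Adj c x) → G.Adj v c := by
    intro c hc
    by_contra hh
    have := hmax' v (insert c K) (hins c hc) (by
      intro x hx
      rcases Finset.mem_insert.1 hx with rfl | hx
      exacts [hh, hvK x hx])
    rw [Finset.card_insert_of_notMem (hnot c hc)] at this
    omega
  have hq : ∃ q, ∀ x ∈ K, G.Adj q x := by
    by_contra! hcon
    obtain ⟨x, hx, hvx⟩ := h.dominating hK hcon hex v hvnK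
    exact hvK x hx hvx
  obtain ⟨q, hq⟩ := hq
  refine h.no_private_clique hK hK3 hvK hq (fun c hc => ?_) (hvc q hq)
  by_contra hcq
  refine h.prime (M := {c | ∀ x ∈ K, G.Adj c x}) ?_ ?_ ⟨c, hc, q, hq, hcq⟩
  · intro y hy c1 hc1 c2 hc2 hy1
    by_contra hy2
    have hc12 := hedge c1 hc1 c2 hc2
    simp only [Set.mem_ofPred_eq, not_forall] at hy
    obtain ⟨p, hp, hyp⟩ := hy
    have honly : ∀ x ∈ K, x ≠ p → G.Adj y x := by
      intro x hx hxp
      by_contra hyx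
      exact hy2 (h.kite x p c1 c2 y (hK hx hp hxp) (hc1 x hx) (hc1 p hp) (hc2 x hx) (hc2 p hp)
        hc12 hyx hyp hy1)
    obtain ⟨p1, hp1, hp1p, -⟩ := hex p p
    obtain ⟨p2, hp2, hp2p, hp21⟩ := hex p p1
    have hpp := hK hp1 hp2 hp21.symm
    have hvy : G.Adj v y := h.kite p1 p2 c2 y v hpp (hc2 p1 hp1) (hc2 p2 hp2)
      (honly p1 hp1 hp1p) (honly p2 hp2 hp2p) (fun hh => hy2 hh.symm) (hvK p1 hp1) (hvK p2 hp2)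
      (hvc c2 hc2)
    exact hvK p hp (h.kite p1 p2 y p v hpp (honly p1 hp1 hp1p) (honly p2 hp2 hp2p)
      (hK hp hp1 hp1p.symm) (hK hp hp2 hp2p.symm) hyp (hvK p1 hp1) (hvK p2 hp2) hvy)
  · intro heq
    obtain ⟨x, hx, -⟩ := hex v v
    exact hvK x hx ((heq ▸ trivial : v ∈ {c | ∀ x ∈ K, G.Adj c x}) x hx)

end TwoEdges

section Complement

variable {V : Type*} {G H : SimpleGraph V} {n : ℕ}

theorem Ctx.exists_triangle (h : Ctx G n) (hn : 3 ≤ n) :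
    ∃ a b c, G.Adj a b ∧ G.Adj a c ∧ G.Adj b c := by
  obtain ⟨s, hs, hsn⟩ := h.top
  obtain ⟨a, ha, b, hb, c, hc, hab, hac, hbc⟩ := Finset.two_lt_card.1 (show 2 < s.card by omega)
  exact ⟨a, b, c, hs ha hb hab, hs ha hc hac, hs hb hc hbc⟩

/-- In a minimal counterexample with a triangle there is no induced `2K₂`. -/
theorem Ctx.no_two_edges [Finite V] (h : Ctx G n) (hn : 3 ≤ n) {a b c d : V} (hac : G.Adj a c)
    (hbd : G.Adj b d) (hab : ¬ G.Adj a b) (had : ¬ G.Adj a d) (hcb : ¬ G.Adj c b)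
    (hcd : ¬ G.Adj c d) : False := by
  have hx1 : ∀ x, G.Adj x a → G.Adj x c → G.Adj x b ∧ G.Adj x d := by
    intro x hxa hxc
    constructor
    · by_contra hxb
      exact h.no_triangle hxa hxc hac (fun hh => hxb hh.symm) (fun hh => hab hh.symm)
        fun hh => hcb hh.symm
    · by_contra hxd
      exact h.no_triangle hxa hxc hac (fun hh => hxd hh.symm) (fun hh => had hh.symm)
        fun hh => hcd hh.symm
  have hx2 : ∀ x, G.Adj x b → G.Adj x d → G.Adj x a ∧ G.Adj x c := by
    intro x hxb hxd
    constructor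
    · by_contra hxa
      exact h.no_triangle hxb hxd hbd (fun hh => hxa hh.symm) hab had
    · by_contra hxc
      exact h.no_triangle hxb hxd hbd (fun hh => hxc hh.symm) hcb hcd
  have p1 := fun x (hxa : G.Adj x a) hxb hxc => h.p5 c a x b d hac.symm hxa.symm hxb hbd hxc hcb hcd hab had
  have p2 := fun x (hxa : G.Adj x a) hxd hxc => h.p5 c a x d b hac.symm hxa.symm hxd hbd.symm hxc hcd hcb
    had hab
  have p3 := fun x (hxc : G.Adj x c) hxb hxa => h.p5 a c x b d hac hxc.symm hxb hbd hxa hab had hcb hcd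
  have p4 := fun x (hxc : G.Adj x c) hxd hxa => h.p5 a c x d b hac hxc.symm hxd hbd.symm hxa had hab hcd hcb
  have hadj := G.adj_comm
  have hjoin : ∀ x, G.Adj x a → G.Adj x b → G.Adj x c → G.Adj x d → False := by
    intro x hxa hxb hxc hxd
    refine h.no_join {x | G.Adj x a ∧ G.Adj x b ∧ G.Adj x c ∧ G.Adj x d} ⟨x, hxa, hxb, hxc, hxd⟩
      ⟨a, fun hh => G.loopless.irrefl a hh.1⟩ ?_
    rintro x ⟨hxa, hxb, hxc, hxd⟩ y hy
    by_contra hxy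
    have t1 := fun h1 h2 => h.no_triangle (v := y) hxa hxc hac (fun hh => hxy hh.symm) h1 h2
    have t2 := fun h1 h2 => h.no_triangle (v := y) hxb hxd hbd (fun hh => hxy hh.symm) h1 h2
    simp only [Set.mem_ofPred_eq] at hy
    grind
  have hone : ∀ x, (G.Adj x a → ¬ G.Adj x b) ∧ (G.Adj x a → ¬ G.Adj x c) ∧
      (G.Adj x a → ¬ G.Adj x d) ∧ (G.Adj x b → ¬ G.Adj x c) ∧ (G.Adj x b → ¬ G.Adj x d) ∧
      (G.Adj x c → ¬ G.Adj x d) := by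
    intro x
    have := hjoin x; have := hx1 x; have := hx2 x
    have := p1 x; have := p2 x; have := p3 x; have := p4 x
    grind
  obtain ⟨x, y, z, hxy, hxz, hyz⟩ := h.exists_triangle hn
  have ta := fun h1 h2 h3 => h.no_triangle (v := a) hxy hxz hyz h1 h2 h3
  have tb := fun h1 h2 h3 => h.no_triangle (v := b) hxy hxz hyz h1 h2 h3
  have tc := fun h1 h2 h3 => h.no_triangle (v := c) hxy hxz hyz h1 h2 h3
  have td := fun h1 h2 h3 => h.no_triangle (v := d) hxy hxz hyz h1 h2 h3
  have := hone x; have := hone y; have := hone z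
  grind

/-- The vertices of `S` can be covered by `k` cliques of `H`. -/
def Cov (H : SimpleGraph V) (S : Set V) (k : ℕ) : Prop := Col Hᶜ S k

theorem Cov.mono {S T : Set V} {k l : ℕ} (h : Cov H T l) (hST : S ⊆ T) (hkl : l ≤ k) :
    Cov H S k := Col.mono h hST hkl

theorem Cov.union {S T : Set V} {k l : ℕ} (hS : Cov H S k) (hT : Cov H T l) :
    Cov H (S ∪ T) (k + l) := Col.union hS hT

theorem cov_of_isClique {S : Set V} (h : H.IsClique S) : Cov H S 1 :=
  col_one fun _ hx _ hy hxy => hxy.2 (h hx hy hxy.1)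

theorem cov_biUnion {ι : Type*} (s : Finset ι) (B : ι → Set V)
    (h : ∀ i ∈ s, H.IsClique (B i)) : Cov H (⋃ i ∈ s, B i) s.card :=
  col_biUnion s B fun i hi _ hx _ hy hxy => hxy.2 (h i hi hx hy hxy.1)

/-- Every independent set of `H` inside `S` has at most `m` vertices. -/
def AlphaLE (H : SimpleGraph V) (S : Set V) (m : ℕ) : Prop :=
  ∀ s : Finset V, (s : Set V) ⊆ S → (∀ x ∈ s, ∀ y ∈ s, ¬ H.Adj x y) → s.card ≤ m

/-- The complement of a minimal counterexample of clique number at least three. -/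
structure CoCtx (H : SimpleGraph V) (n : ℕ) : Prop where
  claw : ∀ v a b c, H.Adj v a → H.Adj v b → H.Adj v c → a ≠ b → a ≠ c → b ≠ c →
    H.Adj a b ∨ H.Adj a c ∨ H.Adj b c
  c4 : ∀ a b c d, H.Adj a b → H.Adj b c → H.Adj c d → H.Adj d a → a ≠ c → b ≠ d →
    H.Adj a c ∨ H.Adj b d
  nondom : ∀ u v, H.Adj u v → ∃ y, H.Adj y u ∧ ¬ H.Adj y v ∧ y ≠ v
  three_le : 3 ≤ n
  le6 : n ≤ 6
  alpha : AlphaLE H Set.univ n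
  top : ∃ s : Finset V, (∀ x ∈ s, ∀ y ∈ s, ¬ H.Adj x y) ∧ s.card = n
  ih : ∀ S : Set V, S ≠ Set.univ → ∀ m ≤ 6, AlphaLE H S m → Cov H S (bound m)
  hard : ¬ Cov H Set.univ (bound n)

theorem Ctx.compl [Finite V] (h : Ctx G n) (hn : 3 ≤ n) : CoCtx Gᶜ n where
  claw := by
    intro v a b c hva hvb hvc hab hac hbc
    by_contra! hcon
    simp only [compl_adj, not_and, not_not] at hcon
    exact h.no_triangle (hcon.1 hab) (hcon.2.1 hac) (hcon.2.2 hbc) hva.2 hvb.2 hvc.2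
  c4 := by
    intro a b c d hab hbc hcd hda hac hbd
    by_contra! hcon
    simp only [compl_adj, not_and, not_not] at hcon
    exact h.no_two_edges hn (hcon.1 hac) (hcon.2 hbd) hab.2 (fun hh => hda.2 hh.symm)
      (fun hh => hbc.2 hh.symm) hcd.2
  nondom := by
    intro u v huv
    obtain ⟨y, hvy, huy⟩ := h.incomparable huv.1.symm fun hh => huv.2 hh.symm
    exact ⟨y, ⟨fun hh => huv.2 (hh ▸ hvy.symm), fun hh => huy hh.symm⟩,
      fun hh => hh.2 hvy.symm, hvy.ne'⟩
  three_le := hn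
  le6 := h.le6
  alpha := fun s hs hc => h.omega s hs fun x hx y hy hne => by
    by_contra hh; exact hc x hx y hy ⟨hne, hh⟩
  top := by
    obtain ⟨s, hs, hc⟩ := h.top
    exact ⟨s, fun x hx y hy hxy => hxy.2 (hs hx hy hxy.1), hc⟩
  ih := by
    intro S hS m hm ha
    rw [Cov, compl_compl]
    exact h.ih S hS m hm fun s hs hc => ha s hs fun x hx y hy hxy => hxy.2 (hc hx hy hxy.1)
  hard := by
    rw [Cov, compl_compl]
    exact h.hard

theorem CoCtx.alpha_sub (h : CoCtx H n) {S : Set V} (T : Finset V)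
    (hT : ∀ x ∈ T, ∀ y ∈ T, ¬ H.Adj x y) (hST : ∀ x ∈ S, ∀ t ∈ T, x ≠ t ∧ ¬ H.Adj x t) :
    AlphaLE H S (n - T.card) := by
  classical
  intro s hs hind
  have hdis : Disjoint s T := Finset.disjoint_left.2 fun x hx hxT => (hST x (hs hx) x hxT).1 rfl
  have := h.alpha (s ∪ T) (Set.subset_univ _) (by
    intro x hx y hy
    rcases Finset.mem_union.1 hx with hx | hx <;> rcases Finset.mem_union.1 hy with hy | hy
    · exact hind x hx y hy
    · exact (hST x (hs hx) y hy).2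
    · exact fun hh => (hST y (hs hy) x hx).2 hh.symm
    · exact hT x hx y hy)
  rw [Finset.card_union_of_disjoint hdis] at this
  omega

/-- A set anticomplete to a nonempty independent set `T` is covered inductively. -/
theorem CoCtx.cov_sub (h : CoCtx H n) {S : Set V} (T : Finset V) (hne : T.Nonempty)
    (hT : ∀ x ∈ T, ∀ y ∈ T, ¬ H.Adj x y) (hST : ∀ x ∈ S, ∀ t ∈ T, x ≠ t ∧ ¬ H.Adj x t) :
    Cov H S (bound (n - T.card)) := by
  obtain ⟨t, ht⟩ := hne
  have := h.le6
  exact h.ih S (fun hh => (hST t (hh ▸ trivial) t ht).1 rfl) _ (by omega) (h.alpha_sub T hT hST)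

end Complement

section Near

variable {V : Type*} {H : SimpleGraph V} {n : ℕ}

/-- Two vertices are near if they are equal or adjacent. -/
def Near (H : SimpleGraph V) (x y : V) : Prop := x = y ∨ H.Adj x y

theorem near_refl (x : V) : Near H x x := Or.inl rfl

theorem Near.symm {x y : V} (h : Near H x y) : Near H y x := h.imp Eq.symm fun hh => SimpleGraph.Adj.symm hh

theorem near_comm (x y : V) : Near H x y ↔ Near H y x := ⟨Near.symm, Near.symm⟩

theorem cov_of_near {S : Set V} (h : ∀ x ∈ S, ∀ y ∈ S, Near H x y) : Cov H S 1 :=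
  cov_of_isClique fun x hx y hy hne => (h x hx y hy).resolve_left hne

theorem cov_biUnion_near {ι : Type*} (s : Finset ι) (B : ι → Set V)
    (h : ∀ i ∈ s, ∀ x ∈ B i, ∀ y ∈ B i, Near H x y) : Cov H (⋃ i ∈ s, B i) s.card :=
  cov_biUnion s B fun i hi x hx y hy hne => (h i hi x hx y hy).resolve_left hne

theorem CoCtx.near_claw (h : CoCtx H n) (v a b c : V) (ha : Near H v a) (hb : Near H v b)
    (hc : Near H v c) : Near H a b ∨ Near H a c ∨ Near H b c := by
  by_contra! hn
  simp only [Near, not_or] at hn ha hb hc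
  obtain ⟨⟨hab, hab'⟩, ⟨hac, hac'⟩, hbc, hbc'⟩ := hn
  have := h.claw v a b c
  have := H.adj_comm
  grind

theorem CoCtx.near_c4 (h : CoCtx H n) (a b c d : V) (hab : Near H a b) (hbc : Near H b c)
    (hcd : Near H c d) (hda : Near H d a) : Near H a c ∨ Near H b d := by
  by_contra! hn
  simp only [Near, not_or] at hn hab hbc hcd hda
  obtain ⟨⟨hac, hac'⟩, hbd, hbd'⟩ := hn
  have := h.c4 a b c d
  have := H.adj_comm
  grind

theorem CoCtx.near_nondom (h : CoCtx H n) {u v : V} (hne : u ≠ v) (huv : Near H u v) :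
    ∃ y, Near H y u ∧ ¬ Near H y v := by
  obtain ⟨y, h1, h2, h3⟩ := h.nondom u v (huv.resolve_left hne)
  exact ⟨y, Or.inr h1, fun hh => hh.elim h3 h2⟩

theorem CoCtx.cov_far (h : CoCtx H n) {S : Set V} (T : Finset V) (hne : T.Nonempty)
    (hT : ∀ x ∈ T, ∀ y ∈ T, x ≠ y → ¬ Near H x y) (hST : ∀ x ∈ S, ∀ t ∈ T, ¬ Near H x t) :
    Cov H S (bound (n - T.card)) := by
  refine h.cov_sub T hne (fun x hx y hy hxy => hT x hx y hy hxy.ne (Or.inr hxy)) fun x hx t ht =>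
    ⟨fun hh => hST x hx t ht (Or.inl hh), fun hh => hST x hx t ht (Or.inr hh)⟩

theorem CoCtx.no_wheel_aux (h : CoCtx H n) {v a b c d e x y : V} (hva : Near H v a)
    (hvb : Near H v b) (hvc : Near H v c) (hvd : Near H v d) (hve : Near H v e)
    (hab : Near H a b) (hbc : Near H b c) (hcd : Near H c d) (hde : Near H d e)
    (hea : Near H e a) (hac : ¬ Near H a c) (hbd : ¬ Near H b d) (hce : ¬ Near H c e)
    (hda : ¬ Near H d a) (heb : ¬ Near H e b) (hxv : ¬ Near H x v) (hxa : Near H x a)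
    (hxb : Near H x b) (hyv : ¬ Near H y v) (hyb : Near H y b) (hyc : Near H y c) : False := by
  classical
  have hs := near_comm (H := H)
  have hxc : ¬ Near H x c := by have := h.near_c4 x a v c; grind
  have hxd : ¬ Near H x d := by have := h.near_c4 x a v d; grind
  have hxe : ¬ Near H x e := by have := h.near_c4 x b v e; grind
  have hya : ¬ Near H y a := by have := h.near_c4 y c v a; grind
  have hyd : ¬ Near H y d := by have := h.near_c4 y b v d; grind
  have hye : ¬ Near H y e := by have := h.near_c4 y b v e; grind
  let K1 : Set V := {z | Near H z v ∧ Near H z a ∧ Near H z b}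
  let K2 : Set V := {z | Near H z c ∧ Near H z d ∧ ¬ Near H z a}
  let K3 : Set V := {z | Near H z e ∧ ¬ Near H z b ∧ ¬ Near H z c}
  let K4 : Set V := {z | ¬ Near H z v ∧ (Near H z b ∨ (Near H z x ∧ ¬ Near H z a ∧ ¬ Near H z b ∧
    ¬ Near H z c ∧ ¬ Near H z d ∧ ¬ Near H z e))}
  let K5 : Set V := {z | ¬ Near H z v ∧ ¬ Near H z x ∧ ¬ Near H z a ∧ ¬ Near H z b ∧
    ¬ Near H z c ∧ ¬ Near H z d ∧ ¬ Near H z e}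
  have tin : ∀ z, Near H z v → (Near H z a ∧ Near H z b ∧ Near H z c ∧ Near H z d ∧ Near H z e) ∨
      (Near H z e ∧ Near H z a ∧ Near H z b ∧ ¬ Near H z c ∧ ¬ Near H z d) ∨
      (Near H z a ∧ Near H z b ∧ Near H z c ∧ ¬ Near H z d ∧ ¬ Near H z e) ∨
      (Near H z b ∧ Near H z c ∧ Near H z d ∧ ¬ Near H z e ∧ ¬ Near H z a) ∨
      (Near H z c ∧ Near H z d ∧ Near H z e ∧ ¬ Near H z a ∧ ¬ Near H z b) ∨
      (Near H z d ∧ Near H z e ∧ Near H z a ∧ ¬ Near H z b ∧ ¬ Near H z c) := by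
    intro z hz
    have := h.near_claw v z a c; have := h.near_claw v z b d; have := h.near_claw v z c e
    have := h.near_claw v z d a; have := h.near_claw v z e b
    have := h.near_c4 z a b c; have := h.near_c4 z b c d; have := h.near_c4 z c d e
    have := h.near_c4 z d e a; have := h.near_c4 z e a b
    grind (splits := 40)
  have tout : ∀ z, ¬ Near H z v →
      (¬ Near H z a ∧ ¬ Near H z b ∧ ¬ Near H z c ∧ ¬ Near H z d ∧ ¬ Near H z e) ∨
      (Near H z a ∧ Near H z b ∧ ¬ Near H z c ∧ ¬ Near H z d ∧ ¬ Near H z e) ∨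
      (¬ Near H z a ∧ Near H z b ∧ Near H z c ∧ ¬ Near H z d ∧ ¬ Near H z e) ∨
      (¬ Near H z a ∧ ¬ Near H z b ∧ Near H z c ∧ Near H z d ∧ ¬ Near H z e) ∨
      (¬ Near H z a ∧ ¬ Near H z b ∧ ¬ Near H z c ∧ Near H z d ∧ Near H z e) ∨
      (Near H z a ∧ ¬ Near H z b ∧ ¬ Near H z c ∧ ¬ Near H z d ∧ Near H z e) := by
    intro z hz
    have := h.near_c4 z a v c; have := h.near_c4 z b v d; have := h.near_c4 z c v e
    have := h.near_c4 z d v a; have := h.near_c4 z e v b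
    have := h.near_claw a z v a; have := h.near_claw a b e z; have := h.near_claw b a c z
    have := h.near_claw c b d z; have := h.near_claw d c e z; have := h.near_claw e d a z
    grind (splits := 40)
  have h1 : Cov H K1 1 := by
    apply cov_of_near
    have key : ∀ p q, p ∈ K1 → q ∈ K1 → ¬ Near H p q → ¬ Near H q x → False := by
      rintro p q ⟨hpv, hpa, hpb⟩ ⟨hqv, hqa, hqb⟩ hpq hqx
      have := h.near_claw a p q x
      have hpx : Near H p x := by grind
      have := h.near_claw a e x q
      have := h.near_claw b c x q
      have := h.near_claw v p c e
      have := h.near_c4 p e q b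
      have := h.near_c4 p c q a
      grind
    intro p hp q hq
    by_contra hpq
    by_cases hqx : Near H q x
    · refine key q p hq hp (fun hh => hpq hh.symm) fun hpx => ?_
      have := h.near_c4 p x q v
      have := hp.1; have := hq.1
      grind
    · exact key p q hp hq hpq hqx
  have h2 : Cov H K2 1 := by
    apply cov_of_near
    rintro p ⟨hpc, hpd, hpa⟩ q ⟨hqc, hqd, hqa⟩
    by_contra hpq
    have := tin p; have := tin q; have := tout p; have := tout q
    have := h.near_c4 p b q d; have := h.near_c4 p c q e; have := h.near_claw v p q a
    have := h.near_claw d e p q; have := h.near_claw c b p q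
    grind
  have h3 : Cov H K3 1 := by
    apply cov_of_near
    rintro p ⟨hpc, hpd, hpa⟩ q ⟨hqc, hqd, hqa⟩
    by_contra hpq
    have := tin p; have := tin q; have := tout p; have := tout q
    have := h.near_c4 p d q a; have := h.near_claw d c p q
    have := h.near_claw a b p q; have := h.near_claw e p q v
    grind
  have h4 : Cov H K4 1 := by
    apply cov_of_near
    have kx : ∀ z, ¬ Near H z v → Near H z a → Near H z b → Near H z x := by
      intro z hzv hza hzb
      have := tout z; have := h.near_claw a e z x
      grind
    have k11 : ∀ p q, ¬ Near H p v → Near H p a → Near H p b → ¬ Near H q v → Near H q a →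
        Near H q b → Near H p q := by
      intro p q _ _ _ _ _ _
      have := tout p; have := tout q; have := h.near_claw a e p q
      grind
    have k22 : ∀ p q, ¬ Near H p v → Near H p b → Near H p c → ¬ Near H q v → Near H q b →
        Near H q c → Near H p q := by
      intro p q _ _ _ _ _ _
      have := tout p; have := tout q; have := h.near_claw c d p q
      grind
    have k12 : ∀ p q, ¬ Near H p v → Near H p a → Near H p b → ¬ Near H q v → Near H q b →
        Near H q c → Near H p q := by
      intro p q _ _ _ _ _ _
      have := tout p; have := tout q; have := h.near_claw b v p q
      grind
    have k02 : ∀ z q, ¬ Near H z v → Near H z x → ¬ Near H z a → ¬ Near H z b → ¬ Near H z c →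
        ¬ Near H q v → Near H q b → Near H q c → Near H z q := by
      intro z q _ _ _ _ _ _ _ _
      have := tout q; have := k12 x q; have := h.near_claw x a z q
      grind
    have k01 : ∀ z q, ¬ Near H z v → Near H z x → ¬ Near H z a → ¬ Near H z b → ¬ Near H z c →
        ¬ Near H q v → Near H q a → Near H q b → Near H z q := by
      intro z q _ _ _ _ _ _ _ _
      have := tout q; have := k12 q y; have := k02 z y; have := h.near_claw y c z q
      grind
    have k00 : ∀ z q, Near H z x → ¬ Near H z a → Near H q x → ¬ Near H q a → Near H z q := by
      intro z q _ _ _ _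
      have := h.near_claw x z q a
      grind
    rintro p ⟨hpv, hp⟩ q ⟨hqv, hq⟩
    have := tout p hpv; have := tout q hqv
    have := k11 p q; have := k22 p q; have := k12 p q; have := k12 q p
    have := k00 p q; have := k01 p q; have := k01 q p; have := k02 p q; have := k02 q p
    grind
  have h5 : Cov H K5 (bound (n - 3)) := by
    have hc3 : ({x, c, e} : Finset V).card = 3 := by
      rw [Finset.card_eq_three]
      refine ⟨x, c, e, ?_, ?_, ?_, rfl⟩
      · rintro rfl; exact hxc (near_refl _)
      · rintro rfl; exact hxe (near_refl _)
      · rintro rfl; exact hce (near_refl _)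
    have := h.cov_far (S := K5) {x, c, e} ⟨x, by simp⟩ (by
        simp only [Finset.mem_insert, Finset.mem_singleton]
        grind) (by
        simp only [Finset.mem_insert, Finset.mem_singleton]
        rintro z ⟨-, h1, -, -, h3, -, h5⟩ t (rfl | rfl | rfl) <;> assumption)
    rwa [hc3] at this
  have hcov := (((h1.union h2).union h3).union h4).union h5
  refine h.hard (hcov.mono ?_ ?_)
  · intro z _
    simp only [Set.mem_union, K1, K2, K3, K4, K5, Set.mem_ofPred_eq]
    by_cases hz : Near H z v
    · have := tin z hz
      grind
    · have := tout z hz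
      grind
  · have := h.le6; have := h.three_le
    interval_cases n <;> simp [bound]

/-- `H` has no vertex whose neighbourhood contains an induced cycle of length five. -/
theorem CoCtx.no_wheel (h : CoCtx H n) {v a b c d e : V} (hva : Near H v a)
    (hvb : Near H v b) (hvc : Near H v c) (hvd : Near H v d) (hve : Near H v e)
    (hab : Near H a b) (hbc : Near H b c) (hcd : Near H c d) (hde : Near H d e)
    (hea : Near H e a) (hac : ¬ Near H a c) (hbd : ¬ Near H b d) (hce : ¬ Near H c e)
    (hda : ¬ Near H d a) (heb : ¬ Near H e b) : False := by
  have hs := near_comm (H := H)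
  have key : ∀ p q r, Near H v p → Near H v q → Near H v r → Near H q p → Near H q r → ¬ Near H p r →
      q ≠ v → ∃ y, ¬ Near H y v ∧ Near H y q ∧ (Near H y p ∨ Near H y r) := by
    intro p q r hp hq hr hqp hqr hpr hqv
    obtain ⟨y, hyq, hyv⟩ := h.near_nondom hqv hq.symm
    have := h.near_claw q y p r hyq.symm hqp hqr
    exact ⟨y, hyv, hyq, by grind⟩
  obtain ⟨ya, h1, h1', h1''⟩ := key e a b (by grind) (by grind) (by grind) (by grind) (by grind)
    (by grind) (by rintro rfl; grind)
  obtain ⟨yb, h2, h2', h2''⟩ := key a b c (by grind) (by grind) (by grind) (by grind) (by grind)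
    (by grind) (by rintro rfl; grind)
  obtain ⟨yc, h3, h3', h3''⟩ := key b c d (by grind) (by grind) (by grind) (by grind) (by grind)
    (by grind) (by rintro rfl; grind)
  obtain ⟨yd, h4, h4', h4''⟩ := key c d e (by grind) (by grind) (by grind) (by grind) (by grind)
    (by grind) (by rintro rfl; grind)
  obtain ⟨ye, h5, h5', h5''⟩ := key d e a (by grind) (by grind) (by grind) (by grind) (by grind)
    (by grind) (by rintro rfl; grind)
  have B1 : ∀ x y, ¬ Near H x v → Near H x a → Near H x b → ¬ Near H y v →
      Near H y b → Near H y c → False := fun x y h1 h2 h3 h4 h5 h6 =>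
    h.no_wheel_aux hva hvb hvc hvd hve hab hbc hcd hde hea hac hbd hce hda heb
      h1 h2 h3 h4 h5 h6
  have B2 : ∀ x y, ¬ Near H x v → Near H x b → Near H x c → ¬ Near H y v →
      Near H y c → Near H y d → False := fun x y h1 h2 h3 h4 h5 h6 =>
    h.no_wheel_aux hvb hvc hvd hve hva hbc hcd hde hea hab hbd hce hda heb hac
      h1 h2 h3 h4 h5 h6
  have B3 : ∀ x y, ¬ Near H x v → Near H x c → Near H x d → ¬ Near H y v →
      Near H y d → Near H y e → False := fun x y h1 h2 h3 h4 h5 h6 =>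
    h.no_wheel_aux hvc hvd hve hva hvb hcd hde hea hab hbc hce hda heb hac hbd
      h1 h2 h3 h4 h5 h6
  have B4 : ∀ x y, ¬ Near H x v → Near H x d → Near H x e → ¬ Near H y v →
      Near H y e → Near H y a → False := fun x y h1 h2 h3 h4 h5 h6 =>
    h.no_wheel_aux hvd hve hva hvb hvc hde hea hab hbc hcd hda heb hac hbd hce
      h1 h2 h3 h4 h5 h6
  have B5 : ∀ x y, ¬ Near H x v → Near H x e → Near H x a → ¬ Near H y v →
      Near H y a → Near H y b → False := fun x y h1 h2 h3 h4 h5 h6 =>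
    h.no_wheel_aux hve hva hvb hvc hvd hea hab hbc hcd hde heb hac hbd hce hda
      h1 h2 h3 h4 h5 h6
  clear key hs
  grind (splits := 40)

end Near

section Neighbourhoods

variable {V : Type*} {H : SimpleGraph V} {n : ℕ}

/-- Every neighbourhood is covered by two cliques. -/
theorem CoCtx.nbhd_two (h : CoCtx H n) (q : V) : ∃ L R : Set V,
    (∀ x ∈ L, ∀ y ∈ L, Near H x y) ∧ (∀ x ∈ R, ∀ y ∈ R, Near H x y) ∧
    (∀ x ∈ L, Near H x q) ∧ (∀ x ∈ R, Near H x q) ∧ ∀ x, Near H x q → x ∈ L ∨ x ∈ R := by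
  by_cases hq : ∀ x y, Near H x q → Near H y q → Near H x y
  · exact ⟨{x | Near H x q}, ∅, fun x hx y hy => hq x y hx hy, by simp, fun x hx => hx, by simp,
      fun x hx => Or.inl hx⟩
  push Not at hq
  obtain ⟨x, y, hx, hy, hxy⟩ := hq
  have hs := near_comm (H := H)
  let X : Set V := {z | Near H z q ∧ ¬ Near H z x}
  let Y : Set V := {z | Near H z q ∧ ¬ Near H z y}
  have hXY : ∀ z, Near H z q → Near H z x ∨ Near H z y := by
    intro z hz
    have := h.near_claw q x y z
    grind
  have hX : ∀ z ∈ X, ∀ w ∈ X, Near H z w := by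
    rintro z ⟨hz, hz'⟩ w ⟨hw, hw'⟩
    have := h.near_claw q x z w
    grind
  have hY : ∀ z ∈ Y, ∀ w ∈ Y, Near H z w := by
    rintro z ⟨hz, hz'⟩ w ⟨hw, hw'⟩
    have := h.near_claw q y z w
    grind
  have hM : ∀ z w, Near H z x → Near H z y → Near H w x → Near H w y → Near H z w := by
    intro z w _ _ _ _
    have := h.near_c4 z x w y
    grind
  have hMc : ∀ m, Near H m q → Near H m x → Near H m y → (∀ z ∈ X, Near H m z) ∨
      ∀ z ∈ Y, Near H m z := by
    intro m hmq hmx hmy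
    by_contra! hcon
    obtain ⟨⟨x', ⟨hx'q, hx'x⟩, hmx'⟩, y', ⟨hy'q, hy'y⟩, hmy'⟩ := hcon
    have := h.near_claw q m x' y'
    have := hXY x'; have := hXY y'
    exact h.no_wheel (v := q) (a := x) (b := m) (c := y) (d := x') (e := y') (by grind) (by grind)
      (by grind) (by grind) (by grind) (by grind) (by grind) (by grind) (by grind) (by grind)
      (by grind) (by grind) (by grind) (by grind) (by grind)
  refine ⟨X ∪ {m | Near H m q ∧ Near H m x ∧ Near H m y ∧ ∀ z ∈ X, Near H m z},
    Y ∪ {m | Near H m q ∧ Near H m x ∧ Near H m y ∧ ¬ ∀ z ∈ X, Near H m z}, ?_, ?_, ?_, ?_, ?_⟩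
  · rintro z (hz | ⟨hz, hzx, hzy, hzX⟩) w (hw | ⟨hw, hwx, hwy, hwX⟩)
    · exact hX z hz w hw
    · exact (hwX z hz).symm
    · exact hzX w hw
    · exact hM z w hzx hzy hwx hwy
  · rintro z (hz | ⟨hz, hzx, hzy, hzX⟩) w (hw | ⟨hw, hwx, hwy, hwX⟩)
    · exact hY z hz w hw
    · exact ((hMc w hw hwx hwy).resolve_left hwX z hz).symm
    · exact (hMc z hz hzx hzy).resolve_left hzX w hw
    · exact hM z w hzx hzy hwx hwy
  · rintro z (hz | hz)
    exacts [hz.1, hz.1]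
  · rintro z (hz | hz)
    exacts [hz.1, hz.1]
  · intro z hz
    simp only [Set.mem_union, Set.mem_ofPred_eq, X, Y]
    have := hXY z hz
    grind

theorem CoCtx.eq_three_or_six (h : CoCtx H n) : n = 3 ∨ n = 6 := by
  classical
  obtain ⟨s, -, hc⟩ := h.top
  have h3 := h.three_le; have h6 := h.le6
  obtain ⟨q, -⟩ : s.Nonempty := Finset.card_pos.1 (by omega)
  obtain ⟨L, R, hL, hR, -, -, hLR⟩ := h.nbhd_two q
  have hcov := ((cov_of_near hL).union (cov_of_near hR)).union
    (h.cov_far (S := {x | ¬ Near H x q}) {q} ⟨q, by simp⟩ (by simp) (by simp))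
  have hu : Set.univ ⊆ L ∪ R ∪ {x | ¬ Near H x q} := fun x _ => by
    by_cases hx : Near H x q
    · exact Or.inl (hLR x hx)
    · exact Or.inr hx
  have hh := fun hk => h.hard (hcov.mono hu hk)
  rw [Finset.card_singleton] at hh
  interval_cases n <;> simp_all [bound]

/-- The two middle vertices of an induced path in a neighbourhood have a common neighbour outside. -/
theorem CoCtx.exists_common [Finite V] (h : CoCtx H n) {q e a b r₀ : V} (heq : Near H e q)
    (haq : Near H a q) (hbq : Near H b q) (hr₀q : Near H r₀ q) (hea : Near H e a)
    (hab : Near H a b) (hbr₀ : Near H b r₀) (heb : ¬ Near H e b)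
    (har₀ : ¬ Near H a r₀) : ∃ u, ¬ Near H u q ∧ Near H u a ∧ Near H u b := by
  classical
  by_contra! hno
  have hs := near_comm (H := H)
  obtain ⟨r, ⟨hrq, har⟩, hmax⟩ := (Set.toFinite {x | Near H x q ∧ ¬ Near H a x}).exists_maximalFor
    (fun x => {z | Near H z x ∧ Near H z q}.ncard) _ ⟨r₀, hr₀q, har₀⟩
  have hnest : ∀ x z, Near H x q → ¬ Near H x a → Near H z q → Near H z x → Near H z r := by
    intro x z hxq hxa hzq hzx
    by_contra hzr
    obtain ⟨w, ⟨hwr, hwq⟩, hwx⟩ : ∃ w ∈ {z | Near H z r ∧ Near H z q},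
        w ∉ {z | Near H z x ∧ Near H z q} := by
      by_contra! hsub
      have hlt := Set.ncard_lt_ncard (Set.ssubset_iff_subset_ne.2
        ⟨hsub, fun hh => hzr ((Set.ext_iff.1 hh z).2 ⟨hzx, hzq⟩).1⟩) (Set.toFinite _)
      exact absurd (hmax (j := x) ⟨hxq, fun hh => hxa hh.symm⟩ hlt.le) (not_le.2 hlt)
    have hwx' : ¬ Near H w x := fun hh => hwx ⟨hh, hwq⟩
    have := h.near_claw q x r a; have := h.near_claw q z r a; have := h.near_claw q w x a
    have := h.near_c4 z x r w
    exact h.no_wheel (v := q) (a := x) (b := r) (c := w) (d := a) (e := z) (by grind) (by grind)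
      (by grind) (by grind) (by grind) (by grind) (by grind) (by grind) (by grind) (by grind)
      (by grind) (by grind) (by grind) (by grind) (by grind)
  have hbr : Near H b r := hnest r₀ b hr₀q (fun hh => har₀ hh.symm) hbq hbr₀
  have her : ¬ Near H e r := by have := h.near_c4 a b r e; grind
  obtain ⟨L, R, hL, hR, hLq, hRq, hLR, haL⟩ : ∃ L R : Set V,
      (∀ x ∈ L, ∀ y ∈ L, Near H x y) ∧ (∀ x ∈ R, ∀ y ∈ R, Near H x y) ∧
      (∀ x ∈ L, Near H x q) ∧ (∀ x ∈ R, Near H x q) ∧ (∀ x, Near H x q → x ∈ L ∨ x ∈ R) ∧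
      a ∈ L := by
    obtain ⟨L, R, h1, h2, h3, h4, h5⟩ := h.nbhd_two q
    rcases h5 a haq with ha | ha
    · exact ⟨L, R, h1, h2, h3, h4, h5, ha⟩
    · exact ⟨R, L, h2, h1, h4, h3, fun x hx => (h5 x hx).symm, ha⟩
  have hrR : r ∈ R := (hLR r hrq).resolve_left fun hh => har (hL a haL r hh)
  have heL : e ∈ L := (hLR e heq).resolve_right fun hh => her (hR e hh r hrR)
  have hbR : b ∈ R := (hLR b hbq).resolve_left fun hh => heb (hL e heL b hh)
  have hbq' : b ≠ q := by rintro rfl; exact heb heq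
  have right : ∀ p p', Near H p r → ¬ Near H p a → Near H p' r → ¬ Near H p' a → ¬ Near H p p' →
      Near H p q → False := by
    intro p p' hpr hpa hp'r hp'a hpp' hpq
    have hp'q : ¬ Near H p' q := by have := h.near_claw q p p' a; grind
    have hpR : p ∈ R := (hLR p hpq).resolve_left fun hh => hpa (hL p hh a haL)
    have hpb := hR p hpR b hbR
    obtain ⟨u, hub, huq⟩ := h.near_nondom hbq' hbq
    have hua : ¬ Near H u a := fun hh => hno u huq hh hub
    obtain ⟨y, hyp, hyr⟩ := h.near_nondom (u := p) (v := r) (by rintro rfl; exact hpp' hp'r.symm) hpr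
    have := h.near_claw b u a p; have := h.near_claw b u a r; have := h.near_claw r p' u q
    have := h.near_claw b p' a p; have := hnest p y; have := h.near_claw p y u q
    have := h.near_claw b y a r; have := hno y; have := h.near_c4 p' r p y
    have := h.near_claw u p' y b
    clear hnest hL hR hLR hmax hno
    grind
  have left : ∀ p p', Near H p a → ¬ Near H p r → Near H p' a → ¬ Near H p' r → ¬ Near H p p' →
      Near H p q → False := by
    intro p p' hpa hpr hp'a hp'r hpp' hpq
    have hp'q : ¬ Near H p' q := by have := h.near_claw q p p' r; grind
    have hpL : p ∈ L := (hLR p hpq).resolve_right fun hh => hpr (hR p hh r hrR)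
    have hpe := hL p hpL e heL
    obtain ⟨y, hyp, hya⟩ := h.near_nondom (u := p) (v := a) (by rintro rfl; exact hpp' hp'a.symm) hpa
    have hyq : ¬ Near H y q := fun hh => hpr (hnest y p hh hya hpq hyp.symm)
    have := hno p'
    have := h.near_claw a p' b e; have := h.near_claw a p' b p; have := h.near_claw p y b e
    have := h.near_claw e y p' q; have := h.near_c4 p y p' a; have := h.near_claw b y a r
    have := h.near_c4 p y r q
    clear hnest hL hR hLR hmax hno
    grind
  have h1 : Cov H {x | Near H x a ∧ ¬ Near H x r} 1 := by
    apply cov_of_near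
    rintro p ⟨hpa, hpr⟩ p' ⟨hp'a, hp'r⟩
    by_contra hpp'
    have := h.near_claw a p p' q; have := left p p'; have := left p' p
    grind
  have h2 : Cov H {x | Near H x a ∧ Near H x r} 1 := by
    apply cov_of_near
    rintro p ⟨hpa, hpr⟩ p' ⟨hp'a, hp'r⟩
    have := h.near_c4 p a p' r
    grind
  have h3 : Cov H {x | Near H x r ∧ ¬ Near H x a} 1 := by
    apply cov_of_near
    rintro p ⟨hpr, hpa⟩ p' ⟨hp'r, hp'a⟩
    by_contra hpp'
    have := h.near_claw r p p' q; have := right p p'; have := right p' p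
    grind
  have h4 : Cov H {x | ¬ Near H x a ∧ ¬ Near H x r} (bound (n - 2)) := by
    have hne : a ≠ r := by rintro rfl; exact har (near_refl _)
    have := h.cov_far (S := {x | ¬ Near H x a ∧ ¬ Near H x r}) {a, r} ⟨a, by simp⟩ (by
        simp only [Finset.mem_insert, Finset.mem_singleton]
        grind) (by
        simp only [Finset.mem_insert, Finset.mem_singleton]
        rintro z ⟨h1, h2⟩ t (rfl | rfl) <;> assumption)
    rwa [Finset.card_pair hne] at this
  refine h.hard ((((h1.union h2).union h3).union h4).mono ?_ ?_)
  · intro z _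
    simp only [Set.mem_union, Set.mem_ofPred_eq]
    grind
  · rcases h.eq_three_or_six with rfl | rfl <;> simp [bound]

/-- The two middle vertices of an induced path in a neighbourhood have the same outer neighbours. -/
theorem CoCtx.outer_eq [Finite V] (h : CoCtx H n) {q e a b r u : V} (heq : Near H e q)
    (haq : Near H a q) (hbq : Near H b q) (hrq : Near H r q) (hea : Near H e a)
    (hab : Near H a b) (hbr : Near H b r) (heb : ¬ Near H e b)
    (har : ¬ Near H a r) (huq : ¬ Near H u q) (hua : Near H u a) : Near H u b := by
  by_contra hub
  have hs := near_comm (H := H)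
  obtain ⟨w, hwq, hwa, hwb⟩ := h.exists_common heq haq hbq hrq hea hab hbr heb har
  have := h.near_claw a u b e
  have := h.near_c4 u w b a; have := h.near_c4 w e q b
  have := h.near_claw b r w a; have := h.near_claw a u w q; have := h.near_claw a u w e
  have := h.near_c4 w b q e
  exact h.no_wheel (v := a) (a := u) (b := w) (c := b) (d := q) (e := e) (by grind) (by grind)
      (by grind) (by grind) (by grind) (by grind) (by grind) (by grind) (by grind) (by grind)
      (by grind) (by grind) (by grind) (by grind) (by grind)

end Neighbourhoods

section Splits

variable {V : Type*} {H : SimpleGraph V} {n : ℕ}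

/-- The neighbourhood of `q` is linked through the adjacent vertices `a` and `b`: the common
neighbours form a clique, and the vertices missing `a` are separated from those missing `b`. -/
structure Split (H : SimpleGraph V) (q a b : V) : Prop where
  aq : Near H a q
  bq : Near H b q
  ab : Near H a b
  clique : ∀ x y, Near H x q → Near H x a → Near H x b → Near H y q → Near H y a → Near H y b →
    Near H x y
  near_or : ∀ x, Near H x q → Near H x a ∨ Near H x b
  outer : ∀ u, ¬ Near H u q → (Near H u a ↔ Near H u b)
  left : ∃ e, Near H e q ∧ ¬ Near H e b
  right : ∃ r, Near H r q ∧ ¬ Near H r a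

theorem Split.symm {q a b : V} (h : Split H q a b) : Split H q b a where
  aq := h.bq
  bq := h.aq
  ab := h.ab.symm
  clique x y h1 h2 h3 h4 h5 h6 := h.clique x y h1 h3 h2 h4 h6 h5
  near_or x hx := (h.near_or x hx).symm
  outer u hu := (h.outer u hu).symm
  left := h.right
  right := h.left

/-- Two cliques covering the neighbourhood of `q`, the first of which contains `P`. -/
structure Halves (H : SimpleGraph V) (q : V) (P B F : Set V) : Prop where
  sub : P ⊆ B
  left : ∀ x ∈ B, ∀ y ∈ B, Near H x y
  right : ∀ x ∈ F, ∀ y ∈ F, Near H x y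
  near_left : ∀ x ∈ B, Near H x q
  near_right : ∀ x ∈ F, Near H x q
  cover : ∀ x, Near H x q → x ∈ B ∨ x ∈ F

theorem CoCtx.halves_or_split [Finite V] (h : CoCtx H n) {q : V} {P : Set V}
    (hPq : ∀ x ∈ P, Near H x q) (hP : ∀ x ∈ P, ∀ y ∈ P, Near H x y) :
    (∃ B F, Halves H q P B F) ∨ ∃ a ∈ P, ∃ b ∈ P, Split H q a b := by
  have hs := near_comm (H := H)
  obtain ⟨L, R, hL, hR, hLq, hRq, hLR⟩ := h.nbhd_two q
  by_cases h1 : ∀ x ∈ P, x ∈ L ∨ ∀ y ∈ L, Near H x y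
  · refine Or.inl ⟨L ∪ {x | x ∈ P ∧ ∀ y ∈ L, Near H x y}, R, ⟨?_, ?_, hR, ?_, hRq, ?_⟩⟩
    · intro x hx
      rcases h1 x hx with hxL | hxL
      exacts [Or.inl hxL, Or.inr ⟨hx, hxL⟩]
    · rintro x (hx | ⟨hx, hx'⟩) y (hy | ⟨hy, hy'⟩)
      exacts [hL x hx y hy, (hy' x hx).symm, hx' y hy, hP x hx y hy]
    · rintro x (hx | ⟨hx, hx'⟩)
      exacts [hLq x hx, hPq x hx]
    · intro x hx
      rcases hLR x hx with hxL | hxR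
      exacts [Or.inl (Or.inl hxL), Or.inr hxR]
  by_cases h2 : ∀ x ∈ P, x ∈ R ∨ ∀ y ∈ R, Near H x y
  · refine Or.inl ⟨R ∪ {x | x ∈ P ∧ ∀ y ∈ R, Near H x y}, L, ⟨?_, ?_, hL, ?_, hLq, ?_⟩⟩
    · intro x hx
      rcases h2 x hx with hxR | hxR
      exacts [Or.inl hxR, Or.inr ⟨hx, hxR⟩]
    · rintro x (hx | ⟨hx, hx'⟩) y (hy | ⟨hy, hy'⟩)
      exacts [hR x hx y hy, (hy' x hx).symm, hx' y hy, hP x hx y hy]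
    · rintro x (hx | ⟨hx, hx'⟩)
      exacts [hRq x hx, hPq x hx]
    · intro x hx
      rcases hLR x hx with hxL | hxR
      exacts [Or.inr hxL, Or.inl (Or.inl hxR)]
  push Not at h1 h2
  obtain ⟨b, hbP, hbL, e, heL, hbe⟩ := h1
  obtain ⟨a, haP, haR, r, hrR, har⟩ := h2
  have haq := hPq a haP
  have hbq := hPq b hbP
  have haL := (hLR a haq).resolve_right haR
  have hbR := (hLR b hbq).resolve_left hbL
  have heq := hLq e heL
  have hrq := hRq r hrR
  have hab := hP a haP b hbP
  have hea := hL e heL a haL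
  have hbr := hR b hbR r hrR
  obtain ⟨u, huq, hua, hub⟩ := h.exists_common heq haq hbq hrq hea hab hbr
    (fun hh => hbe hh.symm) har
  have mixed : ∀ x y, x ∈ L → y ∈ R → Near H x a → Near H x b → Near H y a → Near H y b →
      Near H x y := by
    intro x y hx hy hxa hxb hya hyb
    by_contra hxy
    have := hL x hx e heL; have := hR y hy r hrR; have := hLq x hx; have := hRq y hy
    have := h.near_c4 x e y b; have := h.near_c4 x r y a
    have := h.near_c4 u e q b; have := h.near_c4 u r q a
    have := h.near_claw a u y e; have := h.near_claw b u x r; have := h.near_c4 u x q y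
    clear hL hR hLq hRq hLR
    grind
  refine Or.inr ⟨a, haP, b, hbP, ⟨haq, hbq, hab, ?_, ?_, ?_, ?_, ?_⟩⟩
  · intro x y hxq hxa hxb hyq hya hyb
    rcases hLR x hxq with hx | hx <;> rcases hLR y hyq with hy | hy
    · exact hL x hx y hy
    · exact mixed x y hx hy hxa hxb hya hyb
    · exact (mixed y x hy hx hya hyb hxa hxb).symm
    · exact hR x hx y hy
  · intro x hx
    rcases hLR x hx with hx | hx
    exacts [Or.inl (hL x hx a haL), Or.inr (hR x hx b hbR)]
  · intro w hwq
    exact ⟨fun hw => h.outer_eq heq haq hbq hrq hea hab hbr (fun hh => hbe hh.symm) har hwq hw,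
      fun hw => h.outer_eq hrq hbq haq heq hbr.symm hab.symm hea.symm (fun hh => har hh.symm) hbe
        hwq hw⟩
  · exact ⟨e, heq, fun hh => hbe hh.symm⟩
  · exact ⟨r, hrq, fun hh => har hh.symm⟩

/-- The vertex `x` is near `q` and no other element of `Q`. -/
def Priv (H : SimpleGraph V) (Q : Finset V) (q x : V) : Prop :=
  Near H x q ∧ ∀ s ∈ Q, Near H x s → s = q

/-- `Q` is a maximum independent set. -/
structure MaxInd (H : SimpleGraph V) (n : ℕ) (Q : Finset V) : Prop where
  ind : ∀ x ∈ Q, ∀ y ∈ Q, Near H x y → x = y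
  card : Q.card = n

variable {Q : Finset V}

theorem CoCtx.exists_maxInd (h : CoCtx H n) : ∃ Q, MaxInd H n Q := by
  obtain ⟨s, hs, hc⟩ := h.top
  exact ⟨s, fun x hx y hy hxy => hxy.resolve_right (hs x hx y hy), hc⟩

theorem CoCtx.card_le (h : CoCtx H n) (s : Finset V)
    (hs : ∀ x ∈ s, ∀ y ∈ s, Near H x y → x = y) : s.card ≤ n :=
  h.alpha s (Set.subset_univ _) fun x hx y hy hxy => hxy.ne (hs x hx y hy (Or.inr hxy))

theorem CoCtx.exists_near (h : CoCtx H n) (hQ : MaxInd H n Q) (x : V) : ∃ q ∈ Q, Near H x q := by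
  classical
  by_contra! hx
  have hxQ : x ∉ Q := fun hh => hx x hh (near_refl x)
  have := h.card_le (insert x Q) (by
    have := hQ.ind; have := near_comm (H := H)
    simp only [Finset.mem_insert]
    grind)
  rw [Finset.card_insert_of_notMem hxQ, hQ.card] at this
  omega

theorem CoCtx.near_three (h : CoCtx H n) (hQ : MaxInd H n Q) {x q s t : V} (hq : q ∈ Q)
    (hs : s ∈ Q) (ht : t ∈ Q) (hxq : Near H x q) (hxs : Near H x s) (hxt : Near H x t) :
    q = s ∨ q = t ∨ s = t := by
  have := h.near_claw x q s t hxq hxs hxt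
  have := hQ.ind q hq s hs; have := hQ.ind q hq t ht; have := hQ.ind s hs t ht
  grind

theorem CoCtx.near_pair (h : CoCtx H n) (hQ : MaxInd H n Q) {x y q s : V} (hq : q ∈ Q)
    (hs : s ∈ Q) (hqs : q ≠ s) (hxq : Near H x q) (hxs : Near H x s) (hxy : Near H x y) :
    Near H y q ∨ Near H y s := by
  have := h.near_claw x q s y hxq hxs hxy
  have := hQ.ind q hq s hs; have := near_comm (H := H)
  grind

theorem CoCtx.pair_clique (h : CoCtx H n) (hQ : MaxInd H n Q) {x y q s : V} (hq : q ∈ Q)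
    (hs : s ∈ Q) (hqs : q ≠ s) (hxq : Near H x q) (hxs : Near H x s) (hyq : Near H y q)
    (hys : Near H y s) : Near H x y := by
  have := h.near_c4 x q y s hxq hyq.symm hys hxs.symm
  have := hQ.ind q hq s hs
  grind

theorem CoCtx.priv_clique (h : CoCtx H n) (hQ : MaxInd H n Q) {x y q : V} (hq : q ∈ Q)
    (hx : Priv H Q q x) (hy : Priv H Q q y) : Near H x y := by
  classical
  by_contra hxy
  have hxQ : x ∉ Q.erase q := fun hh => (Finset.mem_erase.1 hh).1
    (hx.2 x (Finset.mem_erase.1 hh).2 (near_refl x))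
  have hyQ : y ∉ insert x (Q.erase q) := by
    simp only [Finset.mem_insert]
    rintro (rfl | hh)
    · exact hxy (near_refl _)
    · exact (Finset.mem_erase.1 hh).1 (hy.2 y (Finset.mem_erase.1 hh).2 (near_refl y))
  have := h.card_le (insert y (insert x (Q.erase q))) (by
    have := hQ.ind; have := near_comm (H := H); have := hx.2; have := hy.2
    simp only [Finset.mem_insert, Finset.mem_erase]
    grind)
  rw [Finset.card_insert_of_notMem hyQ, Finset.card_insert_of_notMem hxQ,
    Finset.card_erase_add_one hq, hQ.card] at this
  omega

theorem CoCtx.no_exchange (h : CoCtx H n) (hQ : MaxInd H n Q) {x b c q s : V} (hq : q ∈ Q)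
    (hs : s ∈ Q) (hqs : q ≠ s) (hxq : Near H x q) (hxs : Near H x s) (hb : Priv H Q q b)
    (hc : Priv H Q s c) (hxb : ¬ Near H x b) (hxc : ¬ Near H x c) : Near H b c := by
  classical
  by_contra hbc
  have hs' := near_comm (H := H)
  have hxQ : ∀ t ∈ Q, Near H x t → t = q ∨ t = s := by
    intro t ht hxt
    have := h.near_three hQ hq hs ht hxq hxs hxt
    grind
  have hsq : s ∈ Q.erase q := Finset.mem_erase.2 ⟨hqs.symm, hs⟩
  have h1 : x ∉ (Q.erase q).erase s := fun hh => by
    simp only [Finset.mem_erase] at hh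
    have := hxQ x hh.2.2 (near_refl x)
    grind
  have h2 : b ∉ insert x ((Q.erase q).erase s) := fun hh => by
    simp only [Finset.mem_insert, Finset.mem_erase] at hh
    rcases hh with rfl | hh
    · exact hxb (near_refl _)
    · exact hh.2.1 (hb.2 b hh.2.2 (near_refl b))
  have h3 : c ∉ insert b (insert x ((Q.erase q).erase s)) := fun hh => by
    simp only [Finset.mem_insert, Finset.mem_erase] at hh
    rcases hh with rfl | rfl | hh
    · exact hbc (near_refl _)
    · exact hxc (near_refl _)
    · exact hh.1 (hc.2 c hh.2.2 (near_refl c))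
  have := h.card_le (insert c (insert b (insert x ((Q.erase q).erase s)))) (by
    have := hQ.ind; have := hb.2; have := hc.2
    simp only [Finset.mem_insert, Finset.mem_erase]
    grind)
  rw [Finset.card_insert_of_notMem h3, Finset.card_insert_of_notMem h2,
    Finset.card_insert_of_notMem h1, Finset.card_erase_add_one hsq,
    Finset.card_erase_of_mem hq, hQ.card] at this
  have := h.three_le
  omega

theorem CoCtx.split_cross_aux (h : CoCtx H n) (hQ : MaxInd H n Q) {q s a b c d x : V}
    (hq : q ∈ Q) (hs : s ∈ Q) (hqs : q ≠ s) (h1 : Split H q a b) (h2 : Split H s c d)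
    (hb : Priv H Q q b) (hc : Priv H Q s c) (hd : Priv H Q s d)
    (hxq : Near H x q) (hxs : Near H x s) (hxb : ¬ Near H x b) (hxd : ¬ Near H x d) : False := by
  have hs' := near_comm (H := H)
  have hbd := h.no_exchange hQ hq hs hqs hxq hxs hb hd hxb hxd
  obtain ⟨r, hrs, hrc⟩ := h2.right
  have hrd : Near H r d := (h2.near_or r hrs).resolve_left hrc
  have hxc : Near H x c := (h2.near_or x hxs).resolve_right hxd
  have hcq : ¬ Near H c q := fun hh => hqs (hc.2 q hq hh)
  have hbs : ¬ Near H b s := fun hh => hqs (hb.2 s hs hh).symm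
  have hbr : ¬ Near H b r := by
    intro hbr
    obtain ⟨t, ht, hts, hrt⟩ : ∃ t ∈ Q, t ≠ s ∧ Near H r t := by
      by_contra! hcon
      exact hrc (h.priv_clique hQ hs ⟨hrs, fun t ht hrt => by
        by_contra hne; exact hcon t ht hne hrt⟩ hc)
    have htq : t = q := hb.2 t ht ((h.near_pair hQ hs ht hts.symm hrs hrt hbr.symm).resolve_left hbs)
    subst htq
    have hxr := h.pair_clique hQ hq hs hqs hxq hxs hrt hrs
    have := h.near_c4 x c d r hxc h2.ab hrd.symm hxr.symm
    grind
  have := h.near_claw d b c r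
  have := h2.ab
  have := h.near_c4 c x q b
  have := h1.bq
  grind

/-- A vertex near two split vertices is a common neighbour for at least one of them. -/
theorem CoCtx.split_cross (h : CoCtx H n) (hQ : MaxInd H n Q) {q s a b c d x : V}
    (hq : q ∈ Q) (hs : s ∈ Q) (hqs : q ≠ s) (h1 : Split H q a b) (h2 : Split H s c d)
    (ha : Priv H Q q a) (hb : Priv H Q q b) (hc : Priv H Q s c) (hd : Priv H Q s d)
    (hxq : Near H x q) (hxs : Near H x s) :
    (Near H x a ∧ Near H x b) ∨ (Near H x c ∧ Near H x d) := by
  have e1 := fun u v => h.split_cross_aux hQ hq hs hqs h1 h2 hb hc hd hxq hxs u v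
  have e2 := fun u v => h.split_cross_aux hQ hq hs hqs h1.symm h2 ha hc hd hxq hxs u v
  have e3 := fun u v => h.split_cross_aux hQ hq hs hqs h1 h2.symm hb hd hc hxq hxs u v
  have e4 := fun u v => h.split_cross_aux hQ hq hs hqs h1.symm h2.symm ha hd hc hxq hxs u v
  grind

theorem CoCtx.priv_near_of_split (h : CoCtx H n) (hQ : MaxInd H n Q) {q s a b x c : V}
    (hq : q ∈ Q) (hs : s ∈ Q) (hqs : q ≠ s) (h1 : Split H q a b)
    (ha : Priv H Q q a) (hb : Priv H Q q b) (hc : Priv H Q s c)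
    (hxq : Near H x q) (hxs : Near H x s) (hx : ¬ (Near H x a ∧ Near H x b)) : Near H c x := by
  have key : ∀ a b, Split H q a b → Priv H Q q a → Priv H Q q b → ¬ Near H x b → Near H c x := by
    intro a b h1 ha hb hxb
    by_contra hcx
    have hbc := h.no_exchange hQ hq hs hqs hxq hxs hb hc hxb fun hh => hcx hh.symm
    have hca := (h1.outer c fun hh => hqs (hc.2 q hq hh)).2 hbc.symm
    have hxa := (h1.near_or x hxq).resolve_right hxb
    rcases h.near_c4 a x s c hxa.symm hxs hc.1.symm hca with hh | hh
    exacts [hqs (ha.2 s hs hh).symm, hcx hh.symm]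
  by_cases hxb : Near H x b
  · exact key b a h1.symm hb ha fun hh => hx ⟨hh, hxb⟩
  · exact key a b h1 ha hb hxb

/-- The halves at `s` can be chosen to avoid a conflict with one of two split vertices. -/
theorem CoCtx.exists_halves (h : CoCtx H n) (hQ : MaxInd H n Q) {q q' s a b c d : V}
    (hq : q ∈ Q) (hq' : q' ∈ Q) (hs : s ∈ Q) (hqs : q ≠ s) (hq's : q' ≠ s) (hqq : q ≠ q')
    (h1 : Split H q a b) (h2 : Split H q' c d)
    (ha : Priv H Q q a) (hb : Priv H Q q b) (hc : Priv H Q q' c) (hd : Priv H Q q' d)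
    (hN : ∃ B F, Halves H s {x | Priv H Q s x} B F) :
    ∃ B F, Halves H s {x | Priv H Q s x} B F ∧
      ((∀ x, Near H x q → Near H x s → x ∉ B → Near H x a ∧ Near H x b) ∨
        ∀ x, Near H x q' → Near H x s → x ∉ B → Near H x c ∧ Near H x d) := by
  obtain ⟨B, F, hBF⟩ := hN
  by_contra! hcon
  have hs' := near_comm (H := H)
  obtain ⟨⟨x, hxq, hxs, hxB, hx⟩, x', hh_xq, hx's, hx'B, hx'⟩ := hcon B F hBF
  have hxF := (hBF.cover x hxs).resolve_left hxB
  have hx'F := (hBF.cover x' hx's).resolve_left hx'B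
  have hxx' := hBF.right x hxF x' hx'F
  have hPF : ∀ c, Priv H Q s c → ∀ y ∈ F, Near H c y := by
    intro e he y hyF
    by_contra hey
    have e1 := h.priv_near_of_split hQ hq hs hqs h1 ha hb he hxq hxs (by tauto)
    have e2 := h.priv_near_of_split hQ hq' hs hq's h2 hc hd he hh_xq hx's (by tauto)
    have := h.near_claw x q e y; have := h.near_claw x' q' e y
    have := he.2 q hq; have := he.2 q' hq'
    have := hBF.right x hxF y hyF; have := hBF.right x' hx'F y hyF
    have := hBF.near_right y hyF
    have := fun u v w => h.near_three hQ (x := y) hq hq' hs u v w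
    grind
  have hB' : Halves H s {x | Priv H Q s x}
      (F ∪ {y | Priv H Q s y ∨ (y ∈ B ∧ ∀ z ∈ F, Near H y z)}) B := by
    refine ⟨fun y hy => Or.inr (Or.inl hy), ?_, hBF.left, ?_, hBF.near_left, ?_⟩
    · have hin : ∀ y, (Priv H Q s y ∨ (y ∈ B ∧ ∀ z ∈ F, Near H y z)) →
          y ∈ B ∧ ∀ z ∈ F, Near H y z := by
        rintro y (hy | hy)
        exacts [⟨hBF.sub hy, hPF y hy⟩, hy]
      rintro y (hy | hy) z (hz | hz)
      · exact hBF.right y hy z hz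
      · exact ((hin z hz).2 y hy).symm
      · exact (hin y hy).2 z hz
      · exact hBF.left y (hin y hy).1 z (hin z hz).1
    · rintro y (hy | hy | hy)
      exacts [hBF.near_right y hy, hy.1, hBF.near_left y hy.1]
    · intro y hy
      rcases hBF.cover y hy with hy | hy
      exacts [Or.inr hy, Or.inl (Or.inl hy)]
  obtain ⟨⟨y, hyq, hys, hyB, -⟩, y', hh_yq, hy's, hy'B, -⟩ := hcon _ _ hB'
  simp only [Set.mem_union, Set.mem_ofPred_eq, not_or, not_and, not_forall] at hyB hy'B
  have hyL := (hBF.cover y hys).resolve_right hyB.1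
  have hy'L := (hBF.cover y' hy's).resolve_right hy'B.1
  obtain ⟨r, hrF, hyr⟩ := hyB.2.2 hyL
  obtain ⟨r', hr'F, hh_yr⟩ := hy'B.2.2 hy'L
  have hyq' : ¬ Near H y q' := fun hh => by
    have := h.near_three hQ hq hq' hs hyq hh hys
    grind
  have hy'q : ¬ Near H y' q := fun hh => by
    have := h.near_three hQ hq hq' hs hh hh_yq hy's
    grind
  obtain ⟨z, hzF, hzq, hzy'⟩ : ∃ z ∈ F, Near H z q ∧ ¬ Near H z y' := by
    by_cases hh : Near H x y'
    · refine ⟨r', hr'F, ?_, fun hh => hh_yr hh.symm⟩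
      have := h.near_claw x q y' r' hxq hh (hBF.right x hxF r' hr'F)
      grind
    · exact ⟨x, hxF, hxq, hh⟩
  obtain ⟨z', hz'F, hh_zq, hz'y⟩ : ∃ z ∈ F, Near H z q' ∧ ¬ Near H z y := by
    by_cases hh : Near H x' y
    · refine ⟨r, hrF, ?_, fun hh => hyr hh.symm⟩
      have := h.near_claw x' q' y r hh_xq hh (hBF.right x' hx'F r hrF)
      grind
    · exact ⟨x', hx'F, hh_xq, hh⟩
  have := h.near_c4 z z' y' y (hBF.right z hzF z' hz'F)
    (h.pair_clique hQ hq' hs hq's hh_zq (hBF.near_right z' hz'F) hh_yq hy's)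
    (hBF.left y' hy'L y hyL)
    (h.pair_clique hQ hq hs hqs hyq hys hzq (hBF.near_right z hzF))
  grind

end Splits

section Frame

variable {V : Type*} {H : SimpleGraph V} {n : ℕ} {Q D : Finset V} {B : V → Set V}

/-- The vertices outside the chosen bases. -/
def rest (Q : Finset V) (B : V → Set V) : Set V := {x | ∀ q ∈ Q, x ∉ B q}

/-- A choice of a clique `B q` in the neighbourhood of every vertex `q` of a maximum independent
set, such that the remaining vertices are well organised. -/
structure Frame (H : SimpleGraph V) (Q D : Finset V) (B : V → Set V) : Prop where
  sub : D ⊆ Q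
  near_base : ∀ q ∈ Q, ∀ x ∈ B q, Near H x q
  clique : ∀ q ∈ Q, ∀ x ∈ B q, ∀ y ∈ B q, Near H x y
  priv : ∀ q ∈ Q, ∀ x, Priv H Q q x → x ∈ B q
  star : ∀ q ∈ Q, q ∉ D → ∀ x ∈ rest Q B, ∀ y ∈ rest Q B, Near H x q → Near H y q → Near H x y
  trans : ∀ q ∈ Q, ∀ x ∈ rest Q B, ∀ y ∈ rest Q B, ∀ z ∈ rest Q B, Near H x q → Near H y q →
    Near H z q → Near H x y → Near H y z → Near H x z
  cross : ∀ q ∈ D, ∀ r ∈ D, q ≠ r → ∀ x ∈ rest Q B, Near H x q → ¬ Near H x r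
  sep : D.card ≤ 2 → ∀ q ∈ D, ∀ r ∈ D, q ≠ r → ∀ s ∈ Q, ∀ x ∈ rest Q B, ∀ y ∈ rest Q B,
    Near H x q → Near H x s → Near H y r → Near H y s → False

theorem CoCtx.split_trans (h : CoCtx H n) {q a b x y z : V} (hS : Split H q a b)
    (hx : Near H x q) (hy : Near H y q) (hz : Near H z q) (hxa : ¬ (Near H x a ∧ Near H x b))
    (hya : ¬ (Near H y a ∧ Near H y b)) (hza : ¬ (Near H z a ∧ Near H z b))
    (hxy : Near H x y) (hyz : Near H y z) : Near H x z := by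
  have hs := near_comm (H := H)
  have := hS.near_or x hx; have := hS.near_or y hy; have := hS.near_or z hz
  have haq := hS.aq; have hbq := hS.bq; have hab := hS.ab
  clear hS
  have := h.near_claw q x z a hx.symm hz.symm haq.symm
  have := h.near_claw q x z b hx.symm hz.symm hbq.symm
  have := h.near_c4 x a b y; have := h.near_c4 x b a y
  have := h.near_c4 z a b y; have := h.near_c4 z b a y
  grind

theorem CoCtx.exists_frame [Finite V] (h : CoCtx H n) (hQ : MaxInd H n Q) :
    ∃ D B, Frame H Q D B := by
  classical
  let D := Q.filter fun q => ¬ ∃ B F, Halves H q {x | Priv H Q q x} B F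
  have hDQ : ∀ q ∈ D, q ∈ Q := fun q hq => (Finset.mem_filter.1 hq).1
  have hsplit : ∀ q, ∃ a b, q ∈ D → Priv H Q q a ∧ Priv H Q q b ∧ Split H q a b := by
    intro q
    by_cases hq : q ∈ D
    · obtain ⟨hqQ, hqD⟩ := Finset.mem_filter.1 hq
      rcases h.halves_or_split (q := q) (P := {x | Priv H Q q x}) (fun x hx => hx.1)
        (fun x hx y hy => h.priv_clique hQ hqQ hx hy) with hh | ⟨a, ha, b, hb, hab⟩
      · exact absurd hh hqD
      · exact ⟨a, b, fun _ => ⟨ha, hb, hab⟩⟩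
    · exact ⟨q, q, fun hh => absurd hh hq⟩
  choose a b hab using hsplit
  have hnormal : ∀ s, ∃ B F, s ∈ Q → s ∉ D → Halves H s {x | Priv H Q s x} B F ∧
      (D.card ≤ 2 → ∀ q ∈ D, ∀ r ∈ D, q ≠ r →
        (∀ x, Near H x q → Near H x s → x ∉ B → Near H x (a q) ∧ Near H x (b q)) ∨
        ∀ x, Near H x r → Near H x s → x ∉ B → Near H x (a r) ∧ Near H x (b r)) := by
    intro s
    by_cases hs : s ∈ Q ∧ s ∉ D
    swap
    · exact ⟨∅, ∅, fun h1 h2 => absurd ⟨h1, h2⟩ hs⟩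
    obtain ⟨hsQ, hsD⟩ := hs
    have hN : ∃ B F, Halves H s {x | Priv H Q s x} B F := by
      by_contra hcon
      exact hsD (Finset.mem_filter.2 ⟨hsQ, hcon⟩)
    by_cases hD : D.card ≤ 2 ∧ ∃ q ∈ D, ∃ r ∈ D, q ≠ r
    swap
    · obtain ⟨B, F, hBF⟩ := hN
      exact ⟨B, F, fun _ _ => ⟨hBF, fun hc q hq r hr hqr => absurd ⟨hc, q, hq, r, hr, hqr⟩ hD⟩⟩
    obtain ⟨hc, q, hq, r, hr, hqr⟩ := hD
    have hD2 : ({q, r} : Finset V) = D := Finset.eq_of_subset_of_card_le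
      (by intro t; simp only [Finset.mem_insert, Finset.mem_singleton]; grind)
      (by rw [Finset.card_pair hqr]; exact hc)
    have hmem : ∀ t ∈ D, t = q ∨ t = r := by
      intro t ht
      rw [← hD2] at ht
      simpa using ht
    obtain ⟨hqa, hqb, hqs⟩ := hab q hq
    obtain ⟨hra, hrb, hrs⟩ := hab r hr
    obtain ⟨B, F, hBF, hor⟩ := h.exists_halves hQ (hDQ q hq) (hDQ r hr) hsQ
      (fun hh => hsD (hh ▸ hq)) (fun hh => hsD (hh ▸ hr)) hqr hqs hrs hqa hqb hra hrb hN
    refine ⟨B, F, fun _ _ => ⟨hBF, fun _ t ht t' ht' htt => ?_⟩⟩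
    rcases hmem t ht with rfl | rfl <;> rcases hmem t' ht' with rfl | rfl
    exacts [absurd rfl htt, hor, hor.symm, absurd rfl htt]
  choose N F hNF using hnormal
  let B : V → Set V := fun q =>
    if q ∈ D then {x | Near H x q ∧ Near H x (a q) ∧ Near H x (b q)} else N q
  have hBD : ∀ q ∈ D, B q = {x | Near H x q ∧ Near H x (a q) ∧ Near H x (b q)} :=
    fun q hq => if_pos hq
  have hBN : ∀ q ∉ D, B q = N q := fun q hq => if_neg hq
  have hrest : ∀ q ∈ D, ∀ x ∈ rest Q B, Near H x q → ¬ (Near H x (a q) ∧ Near H x (b q)) := by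
    intro q hq x hx hxq hh
    exact hx q (hDQ q hq) (by rw [hBD q hq]; exact ⟨hxq, hh⟩)
  have hrestN : ∀ q ∈ Q, q ∉ D → ∀ x ∈ rest Q B, x ∉ N q := by
    intro q hq hqD x hx hh
    exact hx q hq (by rw [hBN q hqD]; exact hh)
  have hstar : ∀ q ∈ Q, q ∉ D → ∀ x ∈ rest Q B, ∀ y ∈ rest Q B, Near H x q → Near H y q →
      Near H x y := by
    intro q hq hqD x hx y hy hxq hyq
    have hh := (hNF q hq hqD).1
    exact hh.right x ((hh.cover x hxq).resolve_left (hrestN q hq hqD x hx)) y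
      ((hh.cover y hyq).resolve_left (hrestN q hq hqD y hy))
  have hcross : ∀ q ∈ D, ∀ r ∈ D, q ≠ r → ∀ x ∈ rest Q B, Near H x q → ¬ Near H x r := by
    intro q hq r hr hqr x hx hxq hxr
    obtain ⟨hqa, hqb, hqs⟩ := hab q hq
    obtain ⟨hra, hrb, hrs⟩ := hab r hr
    rcases h.split_cross hQ (hDQ q hq) (hDQ r hr) hqr hqs hrs hqa hqb hra hrb hxq hxr with hh | hh
    exacts [hrest q hq x hx hxq hh, hrest r hr x hx hxr hh]
  refine ⟨D, B, ⟨hDQ, ?_, ?_, ?_, hstar, ?_, hcross, ?_⟩⟩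
  · intro q hq x hx
    by_cases hqD : q ∈ D
    · rw [hBD q hqD] at hx
      exact hx.1
    · rw [hBN q hqD] at hx
      exact (hNF q hq hqD).1.near_left x hx
  · intro q hq x hx y hy
    by_cases hqD : q ∈ D
    · rw [hBD q hqD] at hx hy
      exact (hab q hqD).2.2.clique x y hx.1 hx.2.1 hx.2.2 hy.1 hy.2.1 hy.2.2
    · rw [hBN q hqD] at hx hy
      exact (hNF q hq hqD).1.left x hx y hy
  · intro q hq x hx
    by_cases hqD : q ∈ D
    · rw [hBD q hqD]
      exact ⟨hx.1, h.priv_clique hQ hq hx (hab q hqD).1, h.priv_clique hQ hq hx (hab q hqD).2.1⟩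
    · rw [hBN q hqD]
      exact (hNF q hq hqD).1.sub hx
  · intro q hq x hx y hy z hz hxq hyq hzq hxy hyz
    by_cases hqD : q ∈ D
    · exact h.split_trans (hab q hqD).2.2 hxq hyq hzq (hrest q hqD x hx hxq)
        (hrest q hqD y hy hyq) (hrest q hqD z hz hzq) hxy hyz
    · exact hstar q hq hqD x hx z hz hxq hzq
  · intro hc q hq r hr hqr s hs x hx y hy hxq hxs hyr hys
    by_cases hsD : s ∈ D
    · by_cases hqs : q = s
      · subst hqs
        exact hcross r hr q hq hqr.symm y hy hyr hys
      · exact hcross q hq s hsD hqs x hx hxq hxs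
    · rcases (hNF s hs hsD).2 hc q hq r hr hqr with hh | hh
      · exact hrest q hq x hx hxq (hh x hxq hxs (hrestN s hs hsD x hx))
      · exact hrest r hr y hy hyr (hh y hyr hys (hrestN s hs hsD y hy))

theorem CoCtx.bound_lt (h : CoCtx H n) (hQ : MaxInd H n Q) (hF : Frame H Q D B) {S : Finset V}
    (hS : S ⊆ Q) {k : ℕ} (hk : Cov H {x | x ∈ rest Q B ∧ ∀ s ∈ S, ¬ Near H x s} k) :
    bound n < n + S.card + k := by
  classical
  by_contra! hle
  choose L R hL hR _ _ hLR using h.nbhd_two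
  have h1 := cov_biUnion_near (H := H) S L fun q _ => hL q
  have h2 := cov_biUnion_near (H := H) S R fun q _ => hR q
  have h3 := cov_biUnion_near (H := H) (Q \ S) B fun q hq => hF.clique q (Finset.mem_sdiff.1 hq).1
  refine h.hard (((h1.union h2).union (h3.union hk)).mono ?_ ?_)
  · intro x _
    by_cases hxS : ∃ s ∈ S, Near H x s
    · obtain ⟨s, hs, hxs⟩ := hxS
      rcases hLR s x hxs with hh | hh
      · exact Or.inl (Or.inl (Set.mem_biUnion hs hh))
      · exact Or.inl (Or.inr (Set.mem_biUnion hs hh))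
    · push Not at hxS
      by_cases hxB : ∃ q ∈ Q, x ∈ B q
      · obtain ⟨q, hq, hxq⟩ := hxB
        exact Or.inr (Or.inl (Set.mem_biUnion (Finset.mem_coe.2 (Finset.mem_sdiff.2
          ⟨hq, fun hh => hxS q hh (hF.near_base q hq x hxq)⟩)) hxq))
      · push Not at hxB
        exact Or.inr (Or.inr ⟨hxB, hxS⟩)
  · have := Finset.card_sdiff_add_card_eq_card hS
    rw [hQ.card] at this
    omega

/-- Some remaining vertex is near both `i` and `j`. -/
def Conflict (H : SimpleGraph V) (Q : Finset V) (B : V → Set V) (i j : V) : Prop :=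
  ∃ x ∈ rest Q B, Near H x i ∧ Near H x j

theorem conflict_comm (i j : V) : Conflict H Q B i j ↔ Conflict H Q B j i := by
  simp only [Conflict, and_comm]

theorem CoCtx.two_owners (h : CoCtx H n) (hQ : MaxInd H n Q) (hF : Frame H Q D B) {x : V}
    (hx : x ∈ rest Q B) : ∃ i ∈ Q, ∃ j ∈ Q, i ≠ j ∧ Near H x i ∧ Near H x j := by
  obtain ⟨i, hi, hxi⟩ := h.exists_near hQ x
  by_contra! hcon
  refine hx i hi (hF.priv i hi x ⟨hxi, fun s hs hxs => ?_⟩)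
  by_contra hne
  exact hcon i hi s hs (Ne.symm hne) hxi hxs

theorem CoCtx.triangle_near (h : CoCtx H n) (hQ : MaxInd H n Q) (hF : Frame H Q D B)
    {i j k x y z : V} (hi : i ∈ Q) (hj : j ∈ Q) (hk : k ∈ Q) (hij : i ≠ j) (hik : i ≠ k)
    (hjk : j ≠ k) (hx : x ∈ rest Q B) (hy : y ∈ rest Q B) (hz : z ∈ rest Q B)
    (hxi : Near H x i) (hxj : Near H x j) (hyi : Near H y i) (hyk : Near H y k)
    (hzj : Near H z j) (hzk : Near H z k) : Near H x y := by
  by_cases hiD : i ∈ D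
  · have hjD : j ∉ D := fun hh => hF.cross i hiD j hh hij x hx hxi hxj
    have hkD : k ∉ D := fun hh => hF.cross i hiD k hh hik y hy hyi hyk
    have h1 := hF.star j hj hjD x hx z hz hxj hzj
    have h2 := hF.star k hk hkD z hz y hy hzk hyk
    rcases h.near_c4 x z y i h1 h2 hyi hxi.symm with hh | hh
    · exact hh
    · have := h.near_three hQ hi hj hk hh hzj hzk
      grind
  · exact hF.star i hi hiD x hx y hy hxi hyi

theorem CoCtx.cov_triangle (h : CoCtx H n) (hQ : MaxInd H n Q) (hF : Frame H Q D B)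
    {i j k : V} (hi : i ∈ Q) (hj : j ∈ Q) (hk : k ∈ Q) (hij : i ≠ j) (hik : i ≠ k)
    (hjk : j ≠ k) (h1 : Conflict H Q B i j) (h2 : Conflict H Q B i k) (h3 : Conflict H Q B j k) :
    Cov H {x | x ∈ rest Q B ∧ ((Near H x i ∧ Near H x j) ∨ (Near H x i ∧ Near H x k) ∨
      (Near H x j ∧ Near H x k))} 1 := by
  obtain ⟨z, hz, hz1, hz2⟩ := h1
  obtain ⟨y, hy, hy1, hy2⟩ := h2
  obtain ⟨x, hx, hx1, hx2⟩ := h3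
  refine cov_of_near ?_
  rintro u ⟨hu, ⟨u1, u2⟩ | ⟨u1, u2⟩ | ⟨u1, u2⟩⟩ v ⟨hv, ⟨v1, v2⟩ | ⟨v1, v2⟩ | ⟨v1, v2⟩⟩
  · exact h.pair_clique hQ hi hj hij u1 u2 v1 v2
  · exact h.triangle_near hQ hF hi hj hk hij hik hjk hu hv hx u1 u2 v1 v2 hx1 hx2
  · exact h.triangle_near hQ hF hj hi hk hij.symm hjk hik hu hv hy u2 u1 v1 v2 hy1 hy2
  · exact h.triangle_near hQ hF hi hk hj hik hij hjk.symm hu hv hx u1 u2 v1 v2 hx2 hx1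
  · exact h.pair_clique hQ hi hk hik u1 u2 v1 v2
  · exact h.triangle_near hQ hF hk hi hj hik.symm hjk.symm hij hu hv hz u2 u1 v2 v1 hz1 hz2
  · exact h.triangle_near hQ hF hj hk hi hjk hij.symm hik.symm hu hv hy u1 u2 v2 v1 hy2 hy1
  · exact h.triangle_near hQ hF hk hj hi hjk.symm hik.symm hij.symm hu hv hz u2 u1 v2 v1 hz2 hz1
  · exact h.pair_clique hQ hj hk hjk u1 u2 v1 v2

theorem CoCtx.no_square (h : CoCtx H n) (hQ : MaxInd H n Q) {i j k l x y z w : V}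
    (hi : i ∈ Q) (hj : j ∈ Q) (hk : k ∈ Q) (hl : l ∈ Q) (hij : i ≠ j) (hik : i ≠ k) (hil : i ≠ l)
    (hjk : j ≠ k) (hjl : j ≠ l) (hkl : k ≠ l) (hxi : Near H x i) (hxj : Near H x j)
    (hyj : Near H y j) (hyk : Near H y k) (hzk : Near H z k) (hzl : Near H z l)
    (hwl : Near H w l) (hwi : Near H w i) (hxy : Near H x y) (hyz : Near H y z)
    (hzw : Near H z w) (hwx : Near H w x) : False := by
  rcases h.near_c4 x y z w hxy hyz hzw hwx with hh | hh
  · have := h.near_pair hQ hi hj hij hxi hxj hh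
    have := h.near_three hQ hk hl hi hzk hzl
    have := h.near_three hQ hk hl hj hzk hzl
    grind
  · have := h.near_pair hQ hj hk hjk hyj hyk hh
    have := h.near_three hQ hl hi hj hwl hwi
    have := h.near_three hQ hl hi hk hwl hwi
    grind

theorem CoCtx.no_diamond (h : CoCtx H n) (hQ : MaxInd H n Q) (hF : Frame H Q D B) {i j k l : V}
    (hi : i ∈ Q) (hj : j ∈ Q) (hk : k ∈ Q) (hl : l ∈ Q) (hij : i ≠ j) (hik : i ≠ k) (hil : i ≠ l)
    (hjk : j ≠ k) (hjl : j ≠ l) (hkl : k ≠ l) (h1 : Conflict H Q B i j) (h2 : Conflict H Q B j k)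
    (h3 : Conflict H Q B k l) (h4 : Conflict H Q B l i) (h5 : Conflict H Q B i k) : False := by
  obtain ⟨x, hx, hxi, hxj⟩ := h1
  obtain ⟨y, hy, hyj, hyk⟩ := h2
  obtain ⟨z, hz, hzk, hzl⟩ := h3
  obtain ⟨w, hw, hwl, hwi⟩ := h4
  obtain ⟨u, hu, hui, huk⟩ := h5
  have hxy := h.triangle_near hQ hF hj hi hk hij.symm hjk hik hx hy hu hxj hxi hyj hyk hui huk
  have hxu := h.triangle_near hQ hF hi hj hk hij hik hjk hx hu hy hxi hxj hui huk hyj hyk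
  have hyu := h.triangle_near hQ hF hk hj hi hjk.symm hik.symm hij.symm hy hu hx hyk hyj huk hui
    hxj hxi
  have hzw := h.triangle_near hQ hF hl hk hi hkl.symm hil.symm hik.symm hz hw hu hzl hzk hwl hwi
    huk hui
  have hzu := h.triangle_near hQ hF hk hl hi hkl hik.symm hil.symm hz hu hw hzk hzl huk hui hwl hwi
  have hwu := h.triangle_near hQ hF hi hl hk hil hik hkl.symm hw hu hz hwi hwl hui huk hzl hzk
  exact h.no_square hQ hi hj hk hl hij hik hil hjk hjl hkl hxi hxj hyj hyk hzk hzl hwl hwi hxy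
    (hF.trans k hk y hy u hu z hz hyk huk hzk hyu hzu.symm) hzw
    (hF.trans i hi w hw u hu x hx hwi hui hxi hwu hxu.symm)

theorem CoCtx.square_mem (h : CoCtx H n) (hQ : MaxInd H n Q) (hF : Frame H Q D B) {i j k l : V}
    (hi : i ∈ Q) (hj : j ∈ Q) (hk : k ∈ Q) (hl : l ∈ Q) (hij : i ≠ j) (hik : i ≠ k) (hil : i ≠ l)
    (hjk : j ≠ k) (hjl : j ≠ l) (hkl : k ≠ l) (h1 : Conflict H Q B i j) (h2 : Conflict H Q B j k)
    (h3 : Conflict H Q B k l) (h4 : Conflict H Q B l i) : i ∈ D ∨ j ∈ D ∨ k ∈ D ∨ l ∈ D := by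
  obtain ⟨x, hx, hxi, hxj⟩ := h1
  obtain ⟨y, hy, hyj, hyk⟩ := h2
  obtain ⟨z, hz, hzk, hzl⟩ := h3
  obtain ⟨w, hw, hwl, hwi⟩ := h4
  by_contra! hD
  exact h.no_square hQ hi hj hk hl hij hik hil hjk hjl hkl hxi hxj hyj hyk hzk hzl hwl hwi
    (hF.star j hj hD.2.1 x hx y hy hxj hyj) (hF.star k hk hD.2.2.1 y hy z hz hyk hzk)
    (hF.star l hl hD.2.2.2 z hz w hw hzl hwl) (hF.star i hi hD.1 w hw x hx hwi hxi)

theorem Frame.no_common (hF : Frame H Q D B) (hD : D.card ≤ 2) {q r s : V} (hs : s ∈ Q)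
    (hqr : q ≠ r) (h1 : Conflict H Q B q s) (h2 : Conflict H Q B r s) (hq : q ∈ D) : r ∉ D := by
  obtain ⟨x, hx, h3, h4⟩ := h1
  obtain ⟨y, hy, h5, h6⟩ := h2
  exact fun hr => hF.sep hD q hq r hr hqr s hs x hx y hy h3 h4 h5 h6

theorem Frame.not_both (hF : Frame H Q D B) {q r : V} (hqr : q ≠ r) (h1 : Conflict H Q B q r)
    (hq : q ∈ D) : r ∉ D := by
  obtain ⟨x, hx, h3, h4⟩ := h1
  exact fun hr => hF.cross q hq r hr hqr x hx h3 h4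

theorem CoCtx.no_prism (h : CoCtx H n) (hQ : MaxInd H n Q) (hF : Frame H Q D B) (hD : D.card ≤ 2)
    {i j k u v w : V} (hi : i ∈ Q) (hj : j ∈ Q) (hk : k ∈ Q) (hu : u ∈ Q) (hv : v ∈ Q) (hw : w ∈ Q)
    (hne : [i, j, k, u, v, w].Nodup)
    (h1 : Conflict H Q B i j) (h2 : Conflict H Q B i k) (h3 : Conflict H Q B j k)
    (h4 : Conflict H Q B u v) (h5 : Conflict H Q B u w) (h6 : Conflict H Q B v w)
    (h7 : Conflict H Q B i u) (h8 : Conflict H Q B j v) (h9 : Conflict H Q B k w) : False := by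
  have hs := conflict_comm (H := H) (Q := Q) (B := B)
  simp only [List.nodup_cons, List.mem_cons, List.not_mem_nil, not_or, or_false] at hne
  have e1 := h.square_mem hQ hF hi hu hv hj
  have e2 := h.square_mem hQ hF hi hu hw hk
  have e3 := h.square_mem hQ hF hj hv hw hk
  have n1 := hF.not_both (q := i) (r := j)
  have n2 := hF.not_both (q := i) (r := k)
  have n3 := hF.not_both (q := i) (r := u)
  have n4 := hF.no_common hD (q := i) (r := v) hj
  have n5 := hF.no_common hD (q := i) (r := w) hk
  have m1 := hF.not_both (q := j) (r := k)
  have m2 := hF.not_both (q := j) (r := v)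
  have m3 := hF.no_common hD (q := j) (r := u) hi
  have m4 := hF.no_common hD (q := j) (r := w) hk
  have l1 := hF.not_both (q := k) (r := w)
  have l2 := hF.no_common hD (q := k) (r := u) hi
  have l3 := hF.no_common hD (q := k) (r := v) hj
  have o1 := hF.not_both (q := u) (r := v)
  have o2 := hF.not_both (q := u) (r := w)
  have o3 := hF.not_both (q := v) (r := w)
  grind

end Frame

section Final

variable {V : Type*} {H : SimpleGraph V} {n : ℕ} {Q D : Finset V} {B : V → Set V}

theorem CoCtx.bound_lt_of_forall (h : CoCtx H n) (hQ : MaxInd H n Q) (hF : Frame H Q D B)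
    {S : Finset V} (hS : S ⊆ Q) (hX : ∀ x ∈ rest Q B, ∃ s ∈ S, Near H x s) :
    bound n < n + S.card := by
  refine h.bound_lt hQ hF hS (k := 0) ?_
  have : {x | x ∈ rest Q B ∧ ∀ s ∈ S, ¬ Near H x s} = ∅ := by
    ext x
    simp only [Set.mem_ofPred_eq, Set.mem_empty_iff_false, iff_false, not_and, not_forall, not_not]
    intro hx
    obtain ⟨s, hs, hxs⟩ := hX x hx
    exact ⟨s, hs, hxs⟩
  rw [this]
  exact col_empty

theorem CoCtx.ne_three [Finite V] (h : CoCtx H 3) : False := by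
  classical
  obtain ⟨Q, hQ⟩ := h.exists_maxInd
  obtain ⟨D, B, hF⟩ := h.exists_frame hQ
  have hs := conflict_comm (H := H) (Q := Q) (B := B)
  obtain ⟨i, j, k, hij, hik, hjk, hQ3⟩ := Finset.card_eq_three.1 hQ.card
  have hmem : ∀ q, q ∈ Q ↔ q = i ∨ q = j ∨ q = k := by
    intro q
    simp [hQ3]
  have hi : i ∈ Q := by simp [hmem]
  have hj : j ∈ Q := by simp [hmem]
  have hk : k ∈ Q := by simp [hmem]
  have key : ∀ i j k, i ∈ Q → j ∈ Q → k ∈ Q → (∀ q ∈ Q, q = i ∨ q = j ∨ q = k) →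
      Conflict H Q B i j := by
    intro i j k hi hj hk hq
    by_contra hij
    have := h.bound_lt_of_forall hQ hF (S := {k}) (by simpa using hk) (by
      intro x hx
      obtain ⟨p, hp, r, hr, hpr, hxp, hxr⟩ := h.two_owners hQ hF hx
      have e1 : ¬ (Near H x i ∧ Near H x j) := fun hh => hij ⟨x, hx, hh⟩
      have := hq p hp; have := hq r hr
      refine ⟨k, Finset.mem_singleton_self k, ?_⟩
      grind)
    simp [bound] at this
  have h1 := key i j k hi hj hk (by grind)
  have h2 := key i k j hi hk hj (by grind)
  have h3 := key j k i hj hk hi (by grind)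
  have := h.bound_lt hQ hF (S := ∅) (k := 1) (by simp)
    ((h.cov_triangle hQ hF hi hj hk hij hik hjk h1 h2 h3).mono (by
      intro x hx
      obtain ⟨p, hp, r, hr, hpr, hxp, hxr⟩ := h.two_owners hQ hF hx.1
      refine ⟨hx.1, ?_⟩
      rw [hmem] at hp hr
      clear hmem hx hs
      grind) le_rfl)
  simp [bound] at this

theorem CoCtx.conflict_of_three (h : CoCtx H 6) (hQ : MaxInd H 6 Q) (hF : Frame H Q D B)
    {i j k : V} (hi : i ∈ Q) (hj : j ∈ Q) (hk : k ∈ Q) (hij : i ≠ j) (hik : i ≠ k) (hjk : j ≠ k) :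
    Conflict H Q B i j ∨ Conflict H Q B i k ∨ Conflict H Q B j k := by
  classical
  by_contra! hcon
  obtain ⟨h1, h2, h3⟩ := hcon
  have hsub : {i, j, k} ⊆ Q := by
    intro x
    simp only [Finset.mem_insert, Finset.mem_singleton]
    grind
  have hc := Finset.card_sdiff_of_subset hsub
  rw [Finset.card_eq_three.2 ⟨i, j, k, hij, hik, hjk, rfl⟩, hQ.card] at hc
  have := h.bound_lt_of_forall hQ hF (S := Q \ {i, j, k}) Finset.sdiff_subset (by
    intro x hx
    obtain ⟨p, hp, r, hr, hpr, hxp, hxr⟩ := h.two_owners hQ hF hx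
    have e1 : ¬ (Near H x i ∧ Near H x j) := fun hh => h1 ⟨x, hx, hh⟩
    have e2 : ¬ (Near H x i ∧ Near H x k) := fun hh => h2 ⟨x, hx, hh⟩
    have e3 : ¬ (Near H x j ∧ Near H x k) := fun hh => h3 ⟨x, hx, hh⟩
    by_contra! hcon
    have a1 := fun hh => hcon p hh hxp
    have a2 := fun hh => hcon r hh hxr
    simp only [Finset.mem_sdiff, Finset.mem_insert, Finset.mem_singleton] at a1 a2
    clear hcon
    grind)
  rw [hc] at this
  simp [bound] at this

theorem CoCtx.exists_conflict_triangle (h : CoCtx H 6) (hQ : MaxInd H 6 Q) (hF : Frame H Q D B) :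
    ∃ i ∈ Q, ∃ j ∈ Q, ∃ k ∈ Q, i ≠ j ∧ i ≠ k ∧ j ≠ k ∧ Conflict H Q B i j ∧
      Conflict H Q B i k ∧ Conflict H Q B j k := by
  classical
  have hne : Q.Nonempty := Finset.card_pos.1 (by rw [hQ.card]; omega)
  obtain ⟨a, ha⟩ := hne
  have hc := Finset.card_filter_add_card_filter_not (s := Q.erase a) (fun x => Conflict H Q B a x)
  rw [Finset.card_erase_of_mem ha, hQ.card] at hc
  have hor : 2 < ((Q.erase a).filter fun x => Conflict H Q B a x).card ∨
      2 < ((Q.erase a).filter fun x => ¬ Conflict H Q B a x).card := by omega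
  by_contra! hcon
  rcases hor with hlt | hlt
  all_goals
    obtain ⟨x, y, z, hx, hy, hz, hxy, hxz, hyz⟩ := Finset.two_lt_card_iff.1 hlt
    simp only [Finset.mem_filter, Finset.mem_erase] at hx hy hz
    obtain ⟨⟨hxa, hxQ⟩, hx⟩ := hx
    obtain ⟨⟨hya, hyQ⟩, hy⟩ := hy
    obtain ⟨⟨hza, hzQ⟩, hz⟩ := hz
  · rcases h.conflict_of_three hQ hF hxQ hyQ hzQ hxy hxz hyz with hh | hh | hh
    · exact hcon a ha x hxQ y hyQ hxa.symm hya.symm hxy hx hy hh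
    · exact hcon a ha x hxQ z hzQ hxa.symm hza.symm hxz hx hz hh
    · exact hcon a ha y hyQ z hzQ hya.symm hza.symm hyz hy hz hh
  · have e1 := h.conflict_of_three hQ hF ha hxQ hyQ hxa.symm hya.symm hxy
    have e2 := h.conflict_of_three hQ hF ha hxQ hzQ hxa.symm hza.symm hxz
    have e3 := h.conflict_of_three hQ hF ha hyQ hzQ hya.symm hza.symm hyz
    exact hcon x hxQ y hyQ z hzQ hxy hxz hyz ((e1.resolve_left hx).resolve_left hy)
      ((e2.resolve_left hx).resolve_left hz) ((e3.resolve_left hy).resolve_left hz)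

theorem CoCtx.card_split_le (h : CoCtx H 6) (hQ : MaxInd H 6 Q) (hF : Frame H Q D B)
    (hDQ : D ⊆ Q) : D.card ≤ 2 := by
  by_contra! hlt
  obtain ⟨x, y, z, hx, hy, hz, hxy, hxz, hyz⟩ := Finset.two_lt_card_iff.1 hlt
  rcases h.conflict_of_three hQ hF (hDQ hx) (hDQ hy) (hDQ hz) hxy hxz hyz with hh | hh | hh
  exacts [hF.not_both hxy hh hx hy, hF.not_both hxz hh hx hz, hF.not_both hyz hh hy hz]

theorem CoCtx.no_triangle_pair (h : CoCtx H 6) (hQ : MaxInd H 6 Q) (hF : Frame H Q D B)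
    {i j k u v w : V} (hi : i ∈ Q) (hj : j ∈ Q) (hu : u ∈ Q) (hv : v ∈ Q) (hw : w ∈ Q)
    (hq : ∀ q ∈ Q, q = i ∨ q = j ∨ q = k ∨ q = u ∨ q = v ∨ q = w) (hij : i ≠ j)
    (huv : u ≠ v) (huw : u ≠ w) (hvw : v ≠ w)
    (h4 : Conflict H Q B u v) (h5 : Conflict H Q B u w) (h6 : Conflict H Q B v w) :
    Conflict H Q B k u ∨ Conflict H Q B k v ∨ Conflict H Q B k w := by
  classical
  by_contra! hcon
  obtain ⟨h1, h2, h3⟩ := hcon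
  have := h.bound_lt hQ hF (S := {i, j}) (k := 1)
    (by intro x; simp only [Finset.mem_insert, Finset.mem_singleton]; grind)
    ((h.cov_triangle hQ hF hu hv hw huv huw hvw h4 h5 h6).mono (by
      rintro x ⟨hx, hxS⟩
      obtain ⟨p, hp, r, hr, hpr, hxp, hxr⟩ := h.two_owners hQ hF hx
      have e1 : ¬ (Near H x k ∧ Near H x u) := fun hh => h1 ⟨x, hx, hh⟩
      have e2 : ¬ (Near H x k ∧ Near H x v) := fun hh => h2 ⟨x, hx, hh⟩
      have e3 : ¬ (Near H x k ∧ Near H x w) := fun hh => h3 ⟨x, hx, hh⟩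
      have e4 := hxS i (by simp)
      have e5 := hxS j (by simp)
      have := hq p hp
      have := hq r hr
      refine ⟨hx, ?_⟩
      clear hxS hq
      grind) le_rfl)
  rw [Finset.card_pair hij] at this
  simp [bound] at this

theorem CoCtx.ne_six [Finite V] (h : CoCtx H 6) : False := by
  classical
  obtain ⟨Q, hQ⟩ := h.exists_maxInd
  obtain ⟨D, B, hF⟩ := h.exists_frame hQ
  have hs := conflict_comm (H := H) (Q := Q) (B := B)
  have hD : D.card ≤ 2 := h.card_split_le hQ hF hF.sub
  obtain ⟨i, hi, j, hj, k, hk, hij, hik, hjk, t1, t2, t3⟩ := h.exists_conflict_triangle hQ hF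
  have hsub : {i, j, k} ⊆ Q := by
    intro x
    simp only [Finset.mem_insert, Finset.mem_singleton]
    grind
  have hc := Finset.card_sdiff_of_subset hsub
  rw [Finset.card_eq_three.2 ⟨i, j, k, hij, hik, hjk, rfl⟩, hQ.card] at hc
  obtain ⟨u, v, w, huv, huw, hvw, hQ3⟩ := Finset.card_eq_three.1 hc
  have hmem : ∀ q, (q ∈ Q ∧ ¬ (q = i ∨ q = j ∨ q = k)) ↔ q = u ∨ q = v ∨ q = w := by
    intro q
    have := Finset.ext_iff.1 hQ3 q
    simpa only [Finset.mem_sdiff, Finset.mem_insert, Finset.mem_singleton] using this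
  obtain ⟨hu, hu'⟩ := (hmem u).2 (Or.inl rfl)
  obtain ⟨hv, hv'⟩ := (hmem v).2 (Or.inr (Or.inl rfl))
  obtain ⟨hw, hw'⟩ := (hmem w).2 (Or.inr (Or.inr rfl))
  have hq : ∀ q ∈ Q, q = i ∨ q = j ∨ q = k ∨ q = u ∨ q = v ∨ q = w := by
    intro q hq
    have := (hmem q).1
    tauto
  clear hmem hQ3 hc hsub
  simp only [not_or] at hu' hv' hw'
  have one : ∀ {a b c d}, a ∈ Q → b ∈ Q → c ∈ Q → d ∈ Q → a ≠ b → a ≠ c → a ≠ d → b ≠ c → b ≠ d →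
      c ≠ d → Conflict H Q B a b → Conflict H Q B a c → Conflict H Q B b c →
      Conflict H Q B d a → ¬ Conflict H Q B d b := by
    intro a b c d ha hb hc hd hab hac had hbc hbd hcd e1 e2 e3 e4 e5
    exact h.no_diamond hQ hF ha hc hb hd hac hab had hbc.symm hcd hbd e2 ((hs _ _).1 e3)
      ((hs _ _).1 e5) e4 e1
  have link : ∀ d ∈ Q, d ≠ i → d ≠ j → d ≠ k → ¬ (Conflict H Q B d i ∧ Conflict H Q B d j) ∧
      ¬ (Conflict H Q B d i ∧ Conflict H Q B d k) ∧
      ¬ (Conflict H Q B d j ∧ Conflict H Q B d k) := by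
    intro d hd h1 h2 h3
    refine ⟨fun hh => ?_, fun hh => ?_, fun hh => ?_⟩
    · exact one hi hj hk hd hij hik h1.symm hjk h2.symm h3.symm t1 t2 t3 hh.1 hh.2
    · exact one hi hk hj hd hik hij h1.symm hjk.symm h3.symm h2.symm t2 t1 ((hs _ _).1 t3) hh.1 hh.2
    · exact one hj hk hi hd hjk hij.symm h2.symm hik.symm h3.symm h1.symm t3 ((hs _ _).1 t1)
        ((hs _ _).1 t2) hh.1 hh.2
  have side : ∀ d ∈ Q, ∀ e ∈ Q, d ≠ e → d ≠ i → d ≠ j → d ≠ k → e ≠ i → e ≠ j → e ≠ k →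
      Conflict H Q B d e := by
    intro d hd e he hde d1 d2 d3 e1 e2 e3
    have := link d hd d1 d2 d3
    have := link e he e1 e2 e3
    have := h.conflict_of_three hQ hF hd he hi hde d1 e1
    have := h.conflict_of_three hQ hF hd he hj hde d2 e2
    have := h.conflict_of_three hQ hF hd he hk hde d3 e3
    clear hs one link t1 t2 t3 hq hF h hQ
    grind
  have l1 := link u hu hu'.1 hu'.2.1 hu'.2.2
  have l2 := link v hv hv'.1 hv'.2.1 hv'.2.2
  have l3 := link w hw hw'.1 hw'.2.1 hw'.2.2
  have s1 := side u hu v hv huv hu'.1 hu'.2.1 hu'.2.2 hv'.1 hv'.2.1 hv'.2.2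
  have s2 := side u hu w hw huw hu'.1 hu'.2.1 hu'.2.2 hw'.1 hw'.2.1 hw'.2.2
  have s3 := side v hv w hw hvw hv'.1 hv'.2.1 hv'.2.2 hw'.1 hw'.2.1 hw'.2.2
  have c1 := h.no_triangle_pair (k := i) hQ hF hj hk hu hv hw (by grind) hjk huv huw hvw s1 s2 s3
  have c2 := h.no_triangle_pair (k := j) hQ hF hi hk hu hv hw (by grind) hik huv huw hvw s1 s2 s3
  have c3 := h.no_triangle_pair (k := k) hQ hF hi hj hu hv hw (by grind) hij huv huw hvw s1 s2 s3
  have prism : ∀ {u v w}, u ∈ Q → v ∈ Q → w ∈ Q → u ≠ i ∧ u ≠ j ∧ u ≠ k → v ≠ i ∧ v ≠ j ∧ v ≠ k →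
      w ≠ i ∧ w ≠ j ∧ w ≠ k → u ≠ v → u ≠ w → v ≠ w → Conflict H Q B u v → Conflict H Q B u w →
      Conflict H Q B v w → ¬ (Conflict H Q B i u ∧ Conflict H Q B j v ∧ Conflict H Q B k w) := by
    rintro u v w hu hv hw hu' hv' hw' huv huw hvw e1 e2 e3 ⟨e4, e5, e6⟩
    refine h.no_prism hQ hF hD hi hj hk hu hv hw ?_ t1 t2 t3 e1 e2 e3 e4 e5 e6
    simp [hij, hik, hjk, huv, huw, hvw, hu'.1.symm, hu'.2.1.symm, hu'.2.2.symm, hv'.1.symm,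
      hv'.2.1.symm, hv'.2.2.symm, hw'.1.symm, hw'.2.1.symm, hw'.2.2.symm]
  have r1 := (hs u v).1 s1
  have r2 := (hs u w).1 s2
  have r3 := (hs v w).1 s3
  have p1 := prism hu hv hw hu' hv' hw' huv huw hvw s1 s2 s3
  have p2 := prism hu hw hv hu' hw' hv' huw huv hvw.symm s2 s1 r3
  have p3 := prism hv hu hw hv' hu' hw' huv.symm hvw huw r1 s3 s2
  have p4 := prism hv hw hu hv' hw' hu' hvw huv.symm huw.symm s3 r1 r2
  have p5 := prism hw hu hv hw' hu' hv' huw.symm hvw.symm huv r2 r3 s1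
  have p6 := prism hw hv hu hw' hv' hu' hvw.symm huw.symm huv.symm r3 r2 r1
  rw [hs u i, hs u j, hs u k] at l1
  rw [hs v i, hs v j, hs v k] at l2
  rw [hs w i, hs w j, hs w k] at l3
  clear hs one link side prism hq hF h hQ
  grind

theorem CoCtx.false [Finite V] (h : CoCtx H n) : False := by
  rcases h.eq_three_or_six with rfl | rfl
  exacts [h.ne_three, h.ne_six]

end Final

section Assembly

variable {V : Type*} {G : SimpleGraph V} {n : ℕ}

theorem comp_eq_of_adj {S : Set V} {x y : V} (hx : x ∈ S) (hy : y ∈ S) (hxy : G.Adj x y) :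
    comp G S x = comp G S y := by
  ext z
  exact ⟨fun hz => Relation.ReflTransGen.head ⟨hxy.symm, hy, hx⟩ hz,
    fun hz => Relation.ReflTransGen.head ⟨hxy, hx, hy⟩ hz⟩

theorem Ctx.ne_two (h : Ctx G 2) : False := by
  classical
  have tri : ∀ x y z, G.Adj x y → G.Adj y z → ¬ G.Adj x z := by
    intro x y z hxy hyz hxz
    have := h.omega {x, y, z} (Set.subset_univ _) (by
      simp [SimpleGraph.isClique_iff, Set.Pairwise, hxy, hyz, hxz, hxy.symm, hyz.symm, hxz.symm])
    rw [Finset.card_eq_three.2 ⟨x, y, z, hxy.ne, hxz.ne, hyz.ne, rfl⟩] at this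
    omega
  rcases isEmpty_or_nonempty V with hV | ⟨⟨v⟩⟩
  · exact h.hard (col_empty.mono (fun x _ => (hV.false x).elim) (Nat.zero_le _))
  let M : Set V := {x | x ≠ v ∧ ¬ G.Adj v x}
  have attach : ∀ x ∈ M, ∃ t, G.Adj v t ∧ ∃ c ∈ comp G M x, G.Adj c t := by
    intro x hx
    by_contra! hcon
    refine h.no_clique_cutset (comp G M x) ∅ (by simp) (a := x) (b := v) mem_comp_self
      (fun hh => hh) (fun hh => (comp_subset hx hh).1 rfl) (fun hh => hh) fun z hz y hy _ hzy => ?_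
    by_cases hyM : y ∈ M
    · exact hy (mem_comp_of_adj hx hz hyM hzy)
    · by_cases hyv : y = v
      · subst hyv
        exact (comp_subset hx hz).2 hzy.symm
      · have : G.Adj v y := by
          by_contra hh
          exact hyM ⟨hyv, hh⟩
        exact hcon y this z hz hzy
  have choice : ∀ C : Set V, ∃ t, ∀ x ∈ M, comp G M x = C → G.Adj v t ∧ ∃ c ∈ C, G.Adj c t := by
    intro C
    by_cases hC : ∃ x ∈ M, comp G M x = C
    · obtain ⟨x, hx, rfl⟩ := hC
      obtain ⟨t, ht⟩ := attach x hx
      exact ⟨t, fun _ _ _ => ht⟩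
    · exact ⟨v, fun x hx hxC => absurd ⟨x, hx, hxC⟩ hC⟩
  choose f hf using choice
  have hN : Col G {x | G.Adj v x} 1 := col_one fun x hx y hy hxy => tri v x y hx hxy hy
  have hA : Col G {x | x ∈ M ∧ G.Adj x (f (comp G M x))} 1 := by
    refine col_one ?_
    rintro x ⟨hx, hxf⟩ y ⟨hy, hyf⟩ hxy
    rw [← comp_eq_of_adj hx hy hxy] at hyf
    exact tri x y _ hxy hyf hxf
  have hB : Col G {x | x = v ∨ x ∈ M ∧ ¬ G.Adj x (f (comp G M x))} 1 := by
    refine col_one ?_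
    rintro x (rfl | ⟨hx, hxf⟩) y (rfl | ⟨hy, hyf⟩) hxy
    · exact hxy.ne rfl
    · exact hy.2 hxy
    · exact hx.2 hxy.symm
    rw [← comp_eq_of_adj hx hy hxy] at hyf
    obtain ⟨hvt, c, hc, hct⟩ := hf _ x hx rfl
    set t := f (comp G M x)
    obtain ⟨u, hu, w, hw, huw, ⟨hut, u', hu'M, huu', hu't⟩, hw'⟩ := exists_flip (x := x) (y := c)
      (fun z => ¬ G.Adj z t ∧ ∃ z' ∈ M, G.Adj z z' ∧ ¬ G.Adj z' t) mem_comp_self hc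
      ⟨hxf, y, hy, hxy, hyf⟩ (fun hh => hh.1 hct)
    have huM := comp_subset hx hu
    have hwM := comp_subset hx hw
    have hwt : G.Adj w t := by
      by_contra hwt
      exact hw' ⟨hwt, u, huM, huw.symm, hut⟩
    exact h.p5 v t w u u' hvt hwt.symm huw.symm huu' hwM.2 huM.2 hu'M.2 (fun hh => hut hh.symm)
      (fun hh => hu't hh.symm) (tri w u u' huw.symm huu')
  refine h.hard (((hN.union hA).union hB).mono ?_ le_rfl)
  intro x _
  by_cases h1 : G.Adj v x
  · exact Or.inl (Or.inl h1)
  by_cases h2 : x = v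
  · exact Or.inr (Or.inl h2)
  by_cases h3 : G.Adj x (f (comp G M x))
  · exact Or.inl (Or.inr ⟨⟨h2, h1⟩, h3⟩)
  · exact Or.inr (Or.inr ⟨⟨h2, h1⟩, h3⟩)

theorem Ctx.false [Finite V] (h : Ctx G n) : False := by
  classical
  by_cases h3 : 3 ≤ n
  · exact (h.compl h3).false
  have : n = 0 ∨ n = 1 ∨ n = 2 := by omega
  rcases this with rfl | rfl | rfl
  · refine h.hard (col_empty.mono (fun x _ => ?_) le_rfl)
    have := h.omega {x} (Set.subset_univ _) (by simp)
    simp at this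
  · refine h.hard (col_one fun x _ y _ hxy => ?_)
    have := h.omega {x, y} (Set.subset_univ _) (by
      simp [SimpleGraph.isClique_iff, Set.Pairwise, hxy, hxy.symm])
    rw [Finset.card_pair hxy.ne] at this
    omega
  · exact h.ne_two

theorem bound_mono {i j : ℕ} (h : i ≤ j) (hj : j ≤ 6) : bound i ≤ bound j := by
  interval_cases j <;> interval_cases i <;> simp [bound]

theorem Col.of_induce {S : Set V} {T : Set S} {k : ℕ} (h : Col (G.induce S) T k) :
    Col G (Subtype.val '' T) k := by
  obtain ⟨c, h1, h2⟩ := h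
  have hc : ∀ x : S, Function.extend Subtype.val c 0 x.1 = c x :=
    fun x => Subtype.val_injective.extend_apply c 0 x
  refine ⟨Function.extend Subtype.val c 0, ?_, ?_⟩
  · rintro _ ⟨x, hx, rfl⟩
    rw [hc]
    exact h1 x hx
  · rintro _ ⟨x, hx, rfl⟩ _ ⟨y, hy, rfl⟩ hxy
    rw [hc, hc]
    exact h2 x hx y hy hxy

theorem Col.induce {S : Set V} {T : Set S} {k : ℕ} (h : Col G (Subtype.val '' T) k) :
    Col (G.induce S) T k := by
  obtain ⟨c, h1, h2⟩ := h
  exact ⟨fun x => c x, fun x hx => h1 x ⟨x, hx, rfl⟩,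
    fun x hx y hy hxy => h2 x ⟨x, hx, rfl⟩ y ⟨y, hy, rfl⟩ hxy⟩

theorem OmegaLE.induce {S : Set V} {T : Set S} {m : ℕ} (h : OmegaLE G (Subtype.val '' T) m) :
    OmegaLE (G.induce S) T m := by
  intro s hs hc
  have := h (s.map (Function.Embedding.subtype _)) (by
    rw [Finset.coe_map]
    exact Set.image_mono hs) (by
    rw [Finset.coe_map]
    rintro _ ⟨x, hx, rfl⟩ _ ⟨y, hy, rfl⟩ hne
    exact hc hx hy fun hh => hne (hh ▸ rfl))
  simpa using this

theorem OmegaLE.of_induce {S : Set V} {T : Set S} {m : ℕ} (h : OmegaLE (G.induce S) T m) :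
    OmegaLE G (Subtype.val '' T) m := by
  classical
  intro s hs hc
  have hsS : ∀ x ∈ s, x ∈ S := by
    intro x hx
    obtain ⟨y, -, rfl⟩ := hs hx
    exact y.2
  have := h (s.subtype (· ∈ S)) (by
    intro x hx
    obtain ⟨y, hy, hyx⟩ := hs (Finset.mem_subtype.1 hx)
    rwa [← Subtype.val_injective hyx]) (by
    intro x hx y hy hne
    exact hc (Finset.mem_subtype.1 hx) (Finset.mem_subtype.1 hy) fun hh =>
      hne (Subtype.val_injective hh))
  rwa [Finset.card_subtype, Finset.filter_true_of_mem hsS] at this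

theorem col_of_finite
    (p5 : ∀ a b c d e, G.Adj a b → G.Adj b c → G.Adj c d → G.Adj d e → ¬ G.Adj a c →
      ¬ G.Adj a d → ¬ G.Adj a e → ¬ G.Adj b d → ¬ G.Adj b e → ¬ G.Adj c e → False)
    (kite : ∀ x y p r w, G.Adj x y → G.Adj p x → G.Adj p y → G.Adj r x → G.Adj r y →
      ¬ G.Adj p r → ¬ G.Adj w x → ¬ G.Adj w y → G.Adj w p → G.Adj w r)
    {S : Set V} (hS : S.Finite) : ∀ m ≤ 6, OmegaLE G S m → Col G S (bound m) := by
  induction hk : S.ncard using Nat.strong_induction_on generalizing S with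
  | _ k ih =>
  intro m hm hω
  by_contra hcol
  have : Finite S := hS
  have huniv : Subtype.val '' (Set.univ : Set S) = S := by simp
  obtain ⟨n, hn, s, -, hs, hsn⟩ := exists_omega (G := G.induce S) Set.univ
  have hω' : OmegaLE (G.induce S) Set.univ m := OmegaLE.induce (by rwa [huniv])
  have hnm : n ≤ m := hsn ▸ hω' s (Set.subset_univ _) hs
  have hctx : Ctx (G.induce S) n :=
    { p5 := fun a b c d e => p5 a b c d e
      kite := fun x y p r w => kite x y p r w
      ih := by
        intro T hT m hm hTω
        have hlt : Subtype.val '' T ⊂ S := by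
          refine (Set.ssubset_iff_subset_ne).2 ⟨Subtype.coe_image_subset S T, fun hh => hT ?_⟩
          exact Set.image_injective.2 Subtype.val_injective (hh.trans huniv.symm)
        exact (ih _ (hk ▸ Set.ncard_lt_ncard hlt hS) (hS.subset hlt.subset) rfl m hm
          hTω.of_induce).induce
      le6 := hnm.trans hm
      omega := hn
      top := ⟨s, hs, hsn⟩
      hard := fun hc => hcol (by
        have := hc.of_induce
        rw [huniv] at this
        exact this.mono subset_rfl (bound_mono hnm hm)) }
  exact hctx.false

theorem no_p5 (hP5 : IsEmpty (SimpleGraph.pathGraph 5 ↪g G)) (a b c d e : V) (hab : G.Adj a b)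
    (hbc : G.Adj b c) (hcd : G.Adj c d) (hde : G.Adj d e) (hac : ¬ G.Adj a c) (had : ¬ G.Adj a d)
    (hae : ¬ G.Adj a e) (hbd : ¬ G.Adj b d) (hbe : ¬ G.Adj b e) (hce : ¬ G.Adj c e) : False := by
  have hs := G.adj_comm
  have := hab.ne; have := hbc.ne; have := hcd.ne; have := hde.ne
  refine hP5.false ⟨⟨![a, b, c, d, e], ?_⟩, ?_⟩
  · intro i j hij
    fin_cases i <;> fin_cases j <;> simp at hij ⊢ <;> grind
  · intro i j
    change G.Adj (![a, b, c, d, e] i) (![a, b, c, d, e] j) ↔ _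
    fin_cases i <;> fin_cases j <;>
      simp [SimpleGraph.pathGraph_adj, hab, hbc, hcd, hde, hac, had, hae, hbd, hbe, hce, hab.symm,
        hbc.symm, hcd.symm, hde.symm, hs c a, hs d a, hs e a, hs d b, hs e b, hs e c]

theorem no_kite (hkite : IsEmpty (kite ↪g G)) (x y p r w : V) (hxy : G.Adj x y) (hpx : G.Adj p x)
    (hpy : G.Adj p y) (hrx : G.Adj r x) (hry : G.Adj r y) (hpr : ¬ G.Adj p r) (hwx : ¬ G.Adj w x)
    (hwy : ¬ G.Adj w y) (hwp : G.Adj w p) : G.Adj w r := by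
  by_contra hwr
  have hs := G.adj_comm
  have := hxy.ne; have := hpx.ne; have := hpy.ne; have := hrx.ne; have := hry.ne; have := hwp.ne
  refine hkite.false ⟨⟨![r, x, p, w, y], ?_⟩, ?_⟩
  · intro i j hij
    fin_cases i <;> fin_cases j <;> simp at hij ⊢ <;> grind
  · intro i j
    change G.Adj (![r, x, p, w, y] i) (![r, x, p, w, y] j) ↔ _
    fin_cases i <;> fin_cases j <;>
      simp [_root_.kite, hxy, hpx, hpy, hrx, hry, hpr, hwx, hwy, hwp, hwr, hxy.symm, hpx.symm,
        hpy.symm, hrx.symm, hry.symm, hwp.symm, hs r p, hs x w, hs y w, hs r w]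

end Assembly

end Kite

/-- Every (P_5, kite, K_7)-free graph is 9-colorable. -/
theorem stmt7 {V : Type*} (G : SimpleGraph V)
    (hP5 : IsEmpty (SimpleGraph.pathGraph 5 ↪g G))
    (hkite : IsEmpty (kite ↪g G))
    (h7 : G.CliqueFree 7) :
    G.Colorable 9 := by
  have hω : ∀ S, Kite.OmegaLE G S 6 := by
    intro S s _ hs
    by_contra! hlt
    obtain ⟨t, hts, ht⟩ := Finset.exists_subset_card_eq (n := 7) (s := s) hlt
    exact h7 t ⟨hs.subset (Finset.coe_subset.2 hts), ht⟩
  refine SimpleGraph.nonempty_hom_of_forall_finite_subgraph_hom fun G' hG' => ?_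
  have hcol := (Kite.col_of_finite (Kite.no_p5 hP5) (Kite.no_kite hkite) hG' 6 le_rfl (hω _))
  refine ⟨fun x => ⟨hcol.choose x, hcol.choose_spec.1 x x.2⟩, fun {x y} hxy heq => ?_⟩
  exact hcol.choose_spec.2 x x.2 y y.2 (G'.adj_sub hxy) (Fin.mk.inj_iff.1 heq)
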